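/- arXiv:1106.2333 — 6 statements merged into one kernel-verified Lean document; each statement's English description precedes it below -/
import Mathlib

section
/- Let g be a nonnegative measurable function on ℝ supported on (0,∞) with 0 < ∫₀^∞ g(x) dx < ∞, let μ, β ∈ ℝ and σ > 0, and define f(y) = ∫₀^∞ (2πσ²x)^{-1/2} · exp(−(y − μ − βx)²/(2σ²x)) · g(x) dx, assumed finite for every y ∈ ℝ. If g is unimodal on (0,∞), then f is unimodal on ℝ. -/
open MeasureTheory Set Real

noncomputable def kk (b : ℝ) (n : ℕ) (y x : ℝ) : ℝ :=
  (x⁻¹) ^ n * (√x)⁻¹ * Real.exp (-y ^ 2 / (2 * x) - b * x)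

noncomputable def HH (g : ℝ → ℝ) (b : ℝ) (n : ℕ) (y : ℝ) : ℝ :=
  ∫ x in Ioi (0:ℝ), kk b n y x * g x

lemma kk_nonneg (b : ℝ) (n : ℕ) (y x : ℝ) (hx : 0 < x) : 0 ≤ kk b n y x := by
  unfold kk; positivity

lemma kk_meas (b : ℝ) (n : ℕ) (y : ℝ) : Measurable (kk b n y) := by
  unfold kk; fun_prop

lemma kk_succ (b : ℝ) (n : ℕ) (y x : ℝ) : kk b (n+1) y x = x⁻¹ * kk b n y x := by
  unfold kk; ring

lemma kk_bound (n : ℕ) (δ : ℝ) (hδ : 0 < δ) :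
    ∃ C : ℝ, 0 ≤ C ∧ ∀ b y x : ℝ, 0 ≤ b → δ ≤ y → 0 < x → kk b n y x ≤ C := by
  set c := δ^2/2 with hc
  have hc0 : 0 < c := by positivity
  refine ⟨n.factorial / c^n + (n+1).factorial / c^(n+1), by positivity, ?_⟩
  intro b y x hb hy hx
  unfold kk
  have ht : 0 < x⁻¹ := by positivity
  set t := x⁻¹ with htd
  have h1 : (√x)⁻¹ ≤ 1 + t := by
    rw [← Real.sqrt_inv, ← htd]
    apply Real.sqrt_le_iff.2
    constructor
    · positivity
    · nlinarith
  have h2 : Real.exp (-y ^ 2 / (2 * x) - b * x) ≤ Real.exp (-(c*t)) := by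
    apply Real.exp_le_exp.2
    have : -y ^ 2 / (2 * x) = -(y^2/2 * t) := by rw [htd]; field_simp
    rw [this]
    have : c * t ≤ y^2/2 * t := by
      apply mul_le_mul_of_nonneg_right _ ht.le
      rw [hc]; gcongr
    have := mul_nonneg hb hx.le
    linarith
  have key : ∀ k : ℕ, t^k * Real.exp (-(c*t)) ≤ k.factorial / c^k := by
    intro k
    have := Real.pow_div_factorial_le_exp (c*t) (by positivity) k
    rw [Real.exp_neg, ← div_eq_mul_inv, div_le_div_iff₀ (by positivity) (by positivity)]
    rw [div_le_iff₀ (by positivity), mul_pow] at this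
    linarith
  calc t^n * (√x)⁻¹ * Real.exp (-y ^ 2 / (2 * x) - b * x)
      ≤ t^n * (1+t) * Real.exp (-(c*t)) := by gcongr
    _ = t^n * Real.exp (-(c*t)) + t^(n+1) * Real.exp (-(c*t)) := by ring
    _ ≤ _ := add_le_add (key n) (key (n+1))

lemma kk_int (g : ℝ → ℝ) (hg : Measurable g) (hg_int : IntegrableOn g (Ioi 0)) (b : ℝ) (hb : 0 ≤ b)
    (n : ℕ) (y : ℝ) (hy : 0 < y) :
    IntegrableOn (fun x => kk b n y x * g x) (Ioi 0) := by
  obtain ⟨C, hC, h⟩ := kk_bound n y hy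
  refine (hg_int.norm.const_mul C).mono' ((kk_meas b n y).mul hg).aestronglyMeasurable ?_
  refine (ae_restrict_iff' measurableSet_Ioi).2 (Filter.Eventually.of_forall fun x hx => ?_)
  rw [norm_mul, Real.norm_of_nonneg (kk_nonneg b n y x hx)]
  exact mul_le_mul_of_nonneg_right (h b y x hb le_rfl hx) (norm_nonneg _)

lemma kk_deriv_y (b : ℝ) (n : ℕ) (y x : ℝ) (hx : 0 < x) :
    HasDerivAt (fun y => kk b n y x) (-y * kk b (n+1) y x) y := by
  unfold kk
  have h : HasDerivAt (fun y : ℝ => -y^2/(2*x) - b*x) (-(2*y)/(2*x)) y := by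
    have := (((hasDerivAt_pow 2 y).neg).div_const (2*x)).sub_const (b*x)
    simpa using this
  have := (h.exp).const_mul ((x⁻¹) ^ n * (√x)⁻¹)
  refine this.congr_deriv ?_
  rw [pow_succ]
  have : -(2*y)/(2*x) = -y * x⁻¹ := by field_simp
  rw [this]; ring

lemma HH_deriv (g : ℝ → ℝ) (hg : Measurable g) (hg_int : IntegrableOn g (Ioi 0)) (b : ℝ)
    (hb : 0 ≤ b) (n : ℕ) (y : ℝ) (hy : 0 < y) :
    HasDerivAt (HH g b n) (-y * HH g b (n+1) y) y := by
  obtain ⟨C, hC, h⟩ := kk_bound (n+1) (y/2) (by positivity)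
  have hs : Ioo (y/2) (2*y) ∈ nhds y := Ioo_mem_nhds (by linarith) (by linarith)
  have := (hasDerivAt_integral_of_dominated_loc_of_deriv_le (μ := volume.restrict (Ioi (0:ℝ)))
    (F := fun y x => kk b n y x * g x) (F' := fun y x => -y * kk b (n+1) y x * g x)
    (x₀ := y) (bound := fun x => 2 * y * C * ‖g x‖) hs
    (Filter.Eventually.of_forall fun z => ((kk_meas b n z).mul hg).aestronglyMeasurable)
    (kk_int g hg hg_int b hb n y hy)
    (((kk_meas b (n+1) y).const_mul (-y)).mul hg).aestronglyMeasurable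
    ((ae_restrict_iff' measurableSet_Ioi).2 (Filter.Eventually.of_forall fun x hx z hz => by
      have hz0 : 0 < z := by have := hz.1; linarith
      rw [norm_mul, norm_mul, norm_neg, Real.norm_of_nonneg hz0.le,
        Real.norm_of_nonneg (kk_nonneg b _ z x hx)]
      apply mul_le_mul_of_nonneg_right _ (norm_nonneg _)
      exact mul_le_mul hz.2.le (h b z x hb hz.1.le hx) (kk_nonneg b _ z x hx) (by positivity)))
    (hg_int.norm.const_mul (2*y*C))
    ((ae_restrict_iff' measurableSet_Ioi).2 (Filter.Eventually.of_forall fun x hx z hz =>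
      (kk_deriv_y b n z x hx).mul_const (g x)))).2
  unfold HH
  refine this.congr_deriv ?_
  rw [← integral_const_mul]
  simp only [mul_assoc]

lemma kk_deriv_x (b y x : ℝ) (hx : 0 < x) :
    HasDerivAt (kk b 0 y) ((y^2 * kk b 2 y x - kk b 1 y x - 2 * b * kk b 0 y x)/2) x := by
  unfold kk
  have h : HasDerivAt (fun x : ℝ => -y^2/(2*x) - b*x) (y^2/2 * (x⁻¹)^2 - b) x := by
    have h1 := ((hasDerivAt_inv hx.ne').const_mul (-y^2/2)).sub ((hasDerivAt_id x).const_mul b)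
    refine (h1.congr_of_eventuallyEq ?_).congr_deriv ?_
    · refine Filter.Eventually.of_forall fun z => ?_
      simp; ring
    · simp; ring
  have h2 : HasDerivAt (fun x : ℝ => (√x)⁻¹) (-(x⁻¹ * (√x)⁻¹)/2) x := by
    have := (Real.hasDerivAt_sqrt hx.ne').inv (by positivity)
    refine this.congr_deriv ?_
    have : √x ^ 2 = x := Real.sq_sqrt hx.le
    rw [this]; field_simp
  have h3 := h2.mul h.exp
  simp only [pow_zero, one_mul]
  refine h3.congr_deriv ?_
  ring

lemma kk_cont (b y : ℝ) (hb : 0 ≤ b) (hy : 0 < y) : ContinuousOn (kk b 0 y) (Ici 0) := by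
  intro x hx
  rcases eq_or_lt_of_le (show (0:ℝ) ≤ x from hx) with h | h
  · subst h
    obtain ⟨C, hC, hk⟩ := kk_bound 1 y hy
    have h0 : kk b 0 y 0 = 0 := by simp [kk]
    unfold ContinuousWithinAt
    rw [h0]
    refine squeeze_zero' (g := fun x => C * x) (eventually_nhdsWithin_of_forall fun x hx => ?_)
      (eventually_nhdsWithin_of_forall fun x hx => ?_) ?_
    · unfold kk; positivity
    · rcases eq_or_lt_of_le (show (0:ℝ) ≤ x from hx) with h | h
      · subst h; simp [h0]
      · have h1 := hk b y x hb le_rfl h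
        rw [kk_succ] at h1
        have : kk b 0 y x = (x⁻¹ * kk b 0 y x) * x := by field_simp
        rw [this]; gcongr
    · have : ContinuousWithinAt (fun x : ℝ => C * x) (Ici 0) 0 := by fun_prop
      simpa [ContinuousWithinAt] using this
  · exact (kk_deriv_x b y x h).continuousAt.continuousWithinAt

lemma layer (g ψ : ℝ → ℝ) (hg : Measurable g) (hg0 : ∀ x, 0 ≤ g x) (hψ : Measurable ψ)
    (hs : ∀ x ≤ 0, g x = 0)
    (hint : IntegrableOn (fun x => ψ x * g x) (Ioi 0))
    (hI : ∀ t > 0, IntegrableOn ψ {x | t < g x})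
    (hp : ∀ t > 0, 0 ≤ ∫ x in {x | t < g x}, ψ x) :
    0 ≤ ∫ x in Ioi (0:ℝ), ψ x * g x := by
  have hint' : Integrable (fun x => ψ x * g x) := by
    rw [← integrableOn_univ, ← Iic_union_Ioi (a := (0:ℝ))]
    refine IntegrableOn.union ?_ hint
    refine (integrableOn_zero).congr_fun (fun x hx => ?_) measurableSet_Iic
    simp [hs x hx]
  have hE : ∫ x in Ioi (0:ℝ), ψ x * g x = ∫ x, ψ x * g x := by
    apply setIntegral_eq_integral_of_forall_compl_eq_zero
    intro x hx
    simp [hs x (not_lt.1 hx)]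
  rw [hE, integral_eq_lintegral_pos_part_sub_lintegral_neg_part hint', sub_nonneg]
  have lc : ∀ χ : ℝ → ℝ, Measurable χ → (∫⁻ x, ENNReal.ofReal (χ x * g x)) =
      ∫⁻ t in Ioi (0:ℝ), ∫⁻ x in {x | t < g x}, ENNReal.ofReal (χ x) := by
    intro χ hχ
    have h1 := lintegral_eq_lintegral_meas_lt (volume.withDensity fun x => ENNReal.ofReal (χ x))
      (Filter.Eventually.of_forall hg0) hg.aemeasurable
    rw [lintegral_withDensity_eq_lintegral_mul _ hχ.ennreal_ofReal hg.ennreal_ofReal] at h1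
    simp only [Pi.mul_apply] at h1
    rw [lintegral_congr (fun x => (ENNReal.ofReal_mul' (hg0 x)))]
    rw [h1]
    refine lintegral_congr fun t => ?_
    rw [withDensity_apply _ (measurableSet_lt measurable_const hg)]
  have hneg : (∫⁻ x, ENNReal.ofReal (-(ψ x * g x))) = ∫⁻ x, ENNReal.ofReal ((-ψ x) * g x) := by
    simp
  rw [hneg, lc (fun x => -ψ x) hψ.neg, lc _ hψ]
  have hle : ∫⁻ t in Ioi (0:ℝ), ∫⁻ x in {x | t < g x}, ENNReal.ofReal (-ψ x) ≤
     ∫⁻ t in Ioi (0:ℝ), ∫⁻ x in {x | t < g x}, ENNReal.ofReal (ψ x) := by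
    refine setLIntegral_mono' measurableSet_Ioi fun t ht => ?_
    have h1 := hp t ht
    have h2 := hI t ht
    rw [integral_eq_lintegral_pos_part_sub_lintegral_neg_part h2, sub_nonneg] at h1
    refine (ENNReal.toReal_le_toReal ?_ ?_).1 h1
    · exact h2.neg.lintegral_lt_top.ne
    · exact h2.lintegral_lt_top.ne
  refine ENNReal.toReal_mono ?_ hle
  rw [← lc _ hψ]
  exact hint'.lintegral_lt_top.ne

noncomputable def qq (b y x : ℝ) : ℝ := y^2 * kk b 2 y x - kk b 1 y x - 2 * b * kk b 0 y x

lemma qq_meas (b y : ℝ) : Measurable (qq b y) := by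
  unfold qq
  have := kk_meas b 0 y
  have := kk_meas b 1 y
  have := kk_meas b 2 y
  fun_prop

lemma qq_bound (b y : ℝ) (hb : 0 ≤ b) (hy : 0 < y) : ∃ C, ∀ x > 0, |qq b y x| ≤ C := by
  obtain ⟨C0, h0, H0⟩ := kk_bound 0 y hy
  obtain ⟨C1, h1, H1⟩ := kk_bound 1 y hy
  obtain ⟨C2, h2, H2⟩ := kk_bound 2 y hy
  refine ⟨y^2 * C2 + C1 + 2 * b * C0, fun x hx => ?_⟩
  have a0 := kk_nonneg b 0 y x hx
  have a1 := kk_nonneg b 1 y x hx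
  have a2 := kk_nonneg b 2 y x hx
  have e0 : 2 * b * kk b 0 y x ≤ 2 * b * C0 := by gcongr; exact H0 b y x hb le_rfl hx
  have e1 := H1 b y x hb le_rfl hx
  have e2 : y^2 * kk b 2 y x ≤ y^2 * C2 := by gcongr; exact H2 b y x hb le_rfl hx
  have p0 : 0 ≤ 2 * b * kk b 0 y x := by positivity
  have p2 : 0 ≤ y^2 * kk b 2 y x := by positivity
  unfold qq
  rw [abs_le]; constructor <;> nlinarith

lemma qq_eq (g : ℝ → ℝ) (hg : Measurable g) (hg_int : IntegrableOn g (Ioi 0)) (b y : ℝ) (hb : 0 ≤ b)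
    (hy : 0 < y) :
    IntegrableOn (fun x => qq b y x * g x) (Ioi 0) ∧
    ∫ x in Ioi (0:ℝ), qq b y x * g x = y^2 * HH g b 2 y - HH g b 1 y - 2 * b * HH g b 0 y := by
  have i0 := (kk_int g hg hg_int b hb 0 y hy).const_mul (2*b)
  have i1 := (kk_int g hg hg_int b hb 1 y hy)
  have i2 := (kk_int g hg hg_int b hb 2 y hy).const_mul (y^2)
  have e : (fun x => qq b y x * g x) = fun x =>
      y^2 * (kk b 2 y x * g x) - (kk b 1 y x * g x) - 2 * b * (kk b 0 y x * g x) := by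
    funext x; unfold qq; ring
  rw [e]
  refine ⟨(i2.sub i1).sub i0, ?_⟩
  have i21 : IntegrableOn (fun x => y^2 * (kk b 2 y x * g x) - (kk b 1 y x * g x)) (Ioi 0) :=
    i2.sub i1
  rw [integral_sub i21 i0, integral_sub i2 i1, integral_const_mul, integral_const_mul]
  rfl

lemma D_sign (g : ℝ → ℝ) (hg : Measurable g) (hg0 : ∀ x, 0 ≤ g x) (hs : ∀ x ≤ 0, g x = 0)
    (hg_int : IntegrableOn g (Ioi 0)) (m : ℝ) (hm : 0 < m)
    (hmono : MonotoneOn g (Ioi 0 ∩ Iic m)) (hanti : AntitoneOn g (Ioi 0 ∩ Ici m))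
    (b : ℝ) (hb : 0 ≤ b) (y₁ y₂ : ℝ) (h1 : 0 < y₁) (h12 : y₁ < y₂) :
    ∃ r > 0, r * (∫ x in Ioi (0:ℝ), qq b y₁ x * g x) ≤ ∫ x in Ioi (0:ℝ), qq b y₂ x * g x := by
  have h2 : 0 < y₂ := h1.trans h12
  set d := (y₂^2 - y₁^2)/2 with hd
  have hd0 : 0 ≤ d := by
    have : y₁^2 ≤ y₂^2 := by gcongr
    rw [hd]; linarith
  set r := Real.exp (-(d * m⁻¹)) with hr
  refine ⟨r, Real.exp_pos _, ?_⟩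
  obtain ⟨i1, -⟩ := qq_eq g hg hg_int b y₁ hb h1
  obtain ⟨i2, -⟩ := qq_eq g hg hg_int b y₂ hb h2
  rw [← sub_nonneg, ← integral_const_mul, ← integral_sub i2 (i1.const_mul r)]
  set ψ : ℝ → ℝ := fun x => qq b y₂ x - r * qq b y₁ x with hψ
  have eψ : (fun x => qq b y₂ x * g x - r * (qq b y₁ x * g x)) = fun x => ψ x * g x := by
    funext x; simp only [hψ]; ring
  have hψm : Measurable ψ := (qq_meas b y₂).sub ((qq_meas b y₁).const_mul r)
  have iψ : IntegrableOn (fun x => ψ x * g x) (Ioi 0) := by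
    rw [← eψ]; exact i2.sub (i1.const_mul r)
  rw [eψ]
  set φ : ℝ → ℝ := fun x => 2 * (kk b 0 y₂ x - r * kk b 0 y₁ x) with hφ
  have hφd : ∀ x > 0, HasDerivAt φ (ψ x) x := by
    intro x hx
    refine (((kk_deriv_x b y₂ x hx).sub ((kk_deriv_x b y₁ x hx).const_mul r)).const_mul 2).congr_deriv ?_
    simp only [hψ, qq]; ring
  have hφc : ContinuousOn φ (Ici 0) :=
    (((kk_cont b y₂ hb h2).sub ((kk_cont b y₁ hb h1).const_mul r))).const_mul 2
  have hφ_eq : ∀ x, φ x = 2 * kk b 0 y₁ x * (Real.exp (-(d * x⁻¹)) - r) := by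
    intro x
    have : kk b 0 y₂ x = kk b 0 y₁ x * Real.exp (-(d * x⁻¹)) := by
      unfold kk
      rw [mul_assoc (_ * _) (Real.exp _), ← Real.exp_add]
      congr 2
      rw [hd]
      simp only [div_eq_mul_inv, mul_inv]; ring
    simp only [hφ, this]; ring
  have hφ0 : φ 0 = 0 := by simp [hφ, kk]
  have hφle : ∀ x, 0 ≤ x → x ≤ m → φ x ≤ 0 := by
    intro x hx hxm
    rcases eq_or_lt_of_le hx with h | h
    · rw [← h, hφ0]
    rw [hφ_eq]
    apply mul_nonpos_of_nonneg_of_nonpos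
    · have := kk_nonneg b 0 y₁ x h; positivity
    · rw [sub_nonpos, hr, Real.exp_le_exp, neg_le_neg_iff]
      gcongr
  have hφge : ∀ x, m ≤ x → 0 ≤ φ x := by
    intro x hxm
    have h : 0 < x := hm.trans_le hxm
    rw [hφ_eq]
    apply mul_nonneg
    · have := kk_nonneg b 0 y₁ x h; positivity
    · rw [sub_nonneg, hr, Real.exp_le_exp, neg_le_neg_iff]
      gcongr
  obtain ⟨C1, hC1⟩ := qq_bound b y₁ hb h1
  obtain ⟨C2, hC2⟩ := qq_bound b y₂ hb h2
  have hψb : ∀ x > 0, ‖ψ x‖ ≤ C2 + r * C1 := by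
    intro x hx
    refine (norm_sub_le _ _).trans (add_le_add (hC2 x hx) ?_)
    rw [norm_mul, Real.norm_of_nonneg (Real.exp_pos _).le]
    exact mul_le_mul_of_nonneg_left (hC1 x hx) (Real.exp_pos _).le
  have hgI : Integrable g := by
    rw [← integrableOn_univ, ← Iic_union_Ioi (a := (0:ℝ))]
    refine IntegrableOn.union ?_ hg_int
    refine (integrableOn_zero).congr_fun (fun x hx => ?_) measurableSet_Iic
    simp [hs x hx]
  have hfin : ∀ t > 0, volume {x | t < g x} < ⊤ := fun t ht => hgI.measure_gt_lt_top ht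
  have hpos : ∀ t > 0, ∀ x, t < g x → 0 < x := by
    intro t ht x hx
    by_contra h
    rw [hs x (not_lt.1 h)] at hx
    linarith
  have hSm : ∀ t, MeasurableSet {x | t < g x} := fun t => measurableSet_lt measurable_const hg
  have hI : ∀ t > 0, IntegrableOn ψ {x | t < g x} := by
    intro t ht
    refine IntegrableOn.of_bound (hfin t ht) hψm.aestronglyMeasurable (C2 + r * C1) ?_
    exact (ae_restrict_iff' (hSm t)).2 (Filter.Eventually.of_forall fun x hx =>
      hψb x (hpos t ht x hx))
  refine layer g ψ hg hg0 hψm hs iψ hI ?_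
  intro t ht
  set S := {x | t < g x} with hS
  rcases S.eq_empty_or_nonempty with he | ⟨z, hz⟩
  · rw [he]; simp
  have hup : ∀ x ∈ S, x ≤ m → ∀ w, x ≤ w → w ≤ m → w ∈ S := by
    intro x hx hxm w hw hwm
    have h0 := hpos t ht x hx
    exact lt_of_lt_of_le hx (hmono ⟨h0, hxm⟩ ⟨lt_of_lt_of_le h0 hw, hwm⟩ hw)
  have hdn : ∀ x ∈ S, m ≤ x → ∀ w, w ≤ x → m ≤ w → w ∈ S := by
    intro x hx hxm w hw hwm
    exact lt_of_lt_of_le hx (hanti ⟨lt_of_lt_of_le hm hwm, hwm⟩ ⟨lt_of_lt_of_le hm hxm, hxm⟩ hw)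
  have hmS : m ∈ S := by
    rcases le_total z m with h | h
    · exact hup z hz h m h le_rfl
    · exact hdn z hz h m h le_rfl
  have hbb : BddBelow S := ⟨0, fun x hx => (hpos t ht x hx).le⟩
  have hba : BddAbove S := by
    by_contra h
    have : Ici m ⊆ S := by
      intro w hw
      rw [not_bddAbove_iff] at h
      obtain ⟨x, hx, hwx⟩ := h w
      exact hdn x hx (le_trans hw hwx.le) w hwx.le hw
    have h3 := (measure_mono this).trans_lt (hfin t ht)
    simp at h3
  set a := sInf S with ha
  set c := sSup S with hc
  have ham : a ≤ m := csInf_le hbb hmS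
  have hmc : m ≤ c := le_csSup hba hmS
  have ha0 : 0 ≤ a := le_csInf ⟨m, hmS⟩ fun x hx => (hpos t ht x hx).le
  have hsub1 : S ⊆ Icc a c := fun x hx => ⟨csInf_le hbb hx, le_csSup hba hx⟩
  have hsub2 : Ioo a c ⊆ S := by
    intro w hw
    rcases le_total w m with h | h
    · obtain ⟨x, hx, hxw⟩ := exists_lt_of_csInf_lt ⟨m, hmS⟩ hw.1
      exact hup x hx (hxw.le.trans h) w hxw.le h
    · obtain ⟨x, hx, hxw⟩ := exists_lt_of_lt_csSup ⟨m, hmS⟩ hw.2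
      exact hdn x hx (h.trans hxw.le) w hxw.le h
  have hae : S =ᵐ[volume] Ioc a c := by
    have e1 : Ioo a c =ᵐ[volume] Icc a c := Ioo_ae_eq_Icc
    have e2 : Ioo a c =ᵐ[volume] Ioc a c := Ioo_ae_eq_Ioc
    refine Filter.EventuallyLE.antisymm ?_ ?_
    · exact (LE.le.eventuallyLE hsub1).trans (e1.symm.trans e2).le
    · exact e2.symm.le.trans (LE.le.eventuallyLE hsub2)
  rw [setIntegral_congr_set hae, ← intervalIntegral.integral_of_le (ham.trans hmc)]
  rw [intervalIntegral.integral_eq_sub_of_hasDerivAt_of_le (ham.trans hmc) 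
    (hφc.mono fun x hx => ha0.trans hx.1) (fun x hx => hφd x (ha0.trans_lt hx.1))]
  · have := hφle a ha0 ham
    have := hφge c hmc
    linarith
  · rw [intervalIntegrable_iff_integrableOn_Ioc_of_le (ham.trans hmc)]
    exact (hI t ht).congr_set_ae hae.symm

noncomputable def FF (g : ℝ → ℝ) (β y : ℝ) : ℝ :=
  ∫ x in Ioi (0:ℝ), (√x)⁻¹ * Real.exp (-(y - β * x)^2 / (2*x)) * g x

lemma ker_eq (β y x : ℝ) (hx : 0 < x) :
    (√x)⁻¹ * Real.exp (-(y - β * x)^2 / (2*x)) = Real.exp (β * y) * kk (β^2/2) 0 y x := by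
  unfold kk
  rw [pow_zero, one_mul, mul_left_comm, ← Real.exp_add]
  congr 2
  field_simp
  ring

lemma FF_eq (g : ℝ → ℝ) (β y : ℝ) : FF g β y = Real.exp (β * y) * HH g (β^2/2) 0 y := by
  unfold FF HH
  rw [← integral_const_mul]
  refine setIntegral_congr_fun measurableSet_Ioi fun x hx => ?_
  simp only [ker_eq β y x hx, mul_assoc]

lemma kk_le_zero (b y x : ℝ) (hx : 0 < x) : kk b 0 y x ≤ kk b 0 0 x := by
  unfold kk
  have h : -y^2/(2*x) ≤ -(0:ℝ)^2/(2*x) :=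
    div_le_div_of_nonneg_right (by nlinarith [sq_nonneg y]) (by positivity)
  exact mul_le_mul_of_nonneg_left (Real.exp_le_exp.2 (by linarith)) (by positivity)

lemma kk_int0 (g : ℝ → ℝ) (hg : Measurable g) (b : ℝ)
    (h0 : IntegrableOn (fun x => kk b 0 0 x * g x) (Ioi 0)) (y : ℝ) :
    IntegrableOn (fun x => kk b 0 y x * g x) (Ioi 0) := by
  refine h0.norm.mono' ((kk_meas b 0 y).mul hg).aestronglyMeasurable ?_
  refine (ae_restrict_iff' measurableSet_Ioi).2 (Filter.Eventually.of_forall fun x hx => ?_)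
  rw [norm_mul, norm_mul, Real.norm_of_nonneg (kk_nonneg b 0 y x hx),
    Real.norm_of_nonneg (kk_nonneg b 0 0 x hx)]
  exact mul_le_mul_of_nonneg_right (kk_le_zero b y x hx) (norm_nonneg _)

lemma HH_cont (g : ℝ → ℝ) (hg : Measurable g) (b : ℝ)
    (h0 : IntegrableOn (fun x => kk b 0 0 x * g x) (Ioi 0)) : Continuous (HH g b 0) := by
  unfold HH
  refine continuous_of_dominated (bound := fun x => ‖kk b 0 0 x * g x‖)
    (fun y => ((kk_meas b 0 y).mul hg).aestronglyMeasurable) (fun y => ?_) h0.norm ?_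
  · refine (ae_restrict_iff' measurableSet_Ioi).2 (Filter.Eventually.of_forall fun x hx => ?_)
    rw [norm_mul, norm_mul, Real.norm_of_nonneg (kk_nonneg b 0 y x hx),
      Real.norm_of_nonneg (kk_nonneg b 0 0 x hx)]
    exact mul_le_mul_of_nonneg_right (kk_le_zero b y x hx) (norm_nonneg _)
  · refine Filter.Eventually.of_forall fun x => ?_
    unfold kk
    fun_prop

lemma FF_tendsto (g : ℝ → ℝ) (hg : Measurable g) (hg_int : IntegrableOn g (Ioi 0)) (β : ℝ)
    (hβ : 0 ≤ β) : Filter.Tendsto (FF g β) Filter.atTop (nhds 0) := by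
  obtain ⟨C, hC, hk⟩ := kk_bound 0 1 one_pos
  have h00 : ∫ x in Ioi (0:ℝ), (0:ℝ) = 0 := by simp
  unfold FF
  rw [← congrArg nhds h00]
  refine tendsto_integral_filter_of_dominated_convergence (fun x => (C + 1) * ‖g x‖) 
    (Filter.Eventually.of_forall fun y => ?_) ?_ (hg_int.norm.const_mul _) ?_
  · exact Measurable.aestronglyMeasurable (by fun_prop)
  · filter_upwards [Filter.eventually_ge_atTop (β + 1)] with y hy
    refine (ae_restrict_iff' measurableSet_Ioi).2 (Filter.Eventually.of_forall fun x hx => ?_)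
    have hx : 0 < x := hx
    rw [norm_mul, Real.norm_of_nonneg (by positivity)]
    apply mul_le_mul_of_nonneg_right _ (norm_nonneg _)
    rcases le_total 1 x with h | h
    · have e1 : (√x)⁻¹ ≤ 1 := inv_le_one_of_one_le₀ (Real.one_le_sqrt.2 h)
      have e2 : Real.exp (-(y - β * x)^2 / (2*x)) ≤ 1 := by
        rw [Real.exp_le_one_iff, neg_div, neg_nonpos]
        positivity
      have : (√x)⁻¹ * Real.exp (-(y - β * x)^2 / (2*x)) ≤ 1 * 1 :=
        mul_le_mul e1 e2 (Real.exp_pos _).le zero_le_one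
      linarith
    · have e := hk 0 1 x le_rfl le_rfl hx
      unfold kk at e
      have : 1 ≤ y - β * x := by nlinarith
      have : (√x)⁻¹ * Real.exp (-(y - β * x)^2 / (2*x)) ≤ 
          x⁻¹ ^ 0 * (√x)⁻¹ * rexp (-1 ^ 2 / (2 * x) - 0 * x) := by
        rw [pow_zero, one_mul, zero_mul, sub_zero]
        gcongr
      linarith
  · refine (ae_restrict_iff' measurableSet_Ioi).2 (Filter.Eventually.of_forall fun x hx => ?_)
    have hx : 0 < x := hx
    have t1 : Filter.Tendsto (fun y : ℝ => y - β * x) Filter.atTop Filter.atTop :=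
      Filter.tendsto_atTop_add_const_right _ _ Filter.tendsto_id
    have t2 : Filter.Tendsto (fun y : ℝ => (y - β * x)^2/(2*x)) Filter.atTop Filter.atTop :=
      ((Filter.tendsto_pow_atTop two_ne_zero).comp t1).atTop_div_const (by positivity)
    have t3 := Real.tendsto_exp_neg_atTop_nhds_zero.comp t2
    have t4 := (t3.const_mul (√x)⁻¹).mul_const (g x)
    simpa [Function.comp_def, neg_div] using t4

lemma core (g : ℝ → ℝ) (hg : Measurable g) (hg0 : ∀ x, 0 ≤ g x) (hs : ∀ x ≤ 0, g x = 0)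
    (hg_int : IntegrableOn g (Ioi 0)) (m : ℝ) (hm : 0 < m)
    (hmono : MonotoneOn g (Ioi 0 ∩ Iic m)) (hanti : AntitoneOn g (Ioi 0 ∩ Ici m))
    (β : ℝ) (hβ : 0 ≤ β)
    (h0 : IntegrableOn (fun x => kk (β^2/2) 0 0 x * g x) (Ioi 0)) :
    ∃ y₀ : ℝ, MonotoneOn (FF g β) (Iic y₀) ∧ AntitoneOn (FF g β) (Ici y₀) := by
  set b := β^2/2 with hb
  have hb0 : 0 ≤ b := by positivity
  have hF : FF g β = fun y => Real.exp (β * y) * HH g b 0 y := funext fun y => FF_eq g β y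
  have hFc : Continuous (FF g β) := by
    rw [hF]
    have := HH_cont g hg b h0
    fun_prop
  have hFn : ∀ y, 0 ≤ FF g β y := by
    intro y
    refine setIntegral_nonneg measurableSet_Ioi fun x hx => ?_
    have := hg0 x
    positivity
  have hneg : MonotoneOn (FF g β) (Iic 0) := by
    intro y hy z hz hyz
    have hz : z ≤ 0 := hz
    rw [FF_eq, FF_eq]
    unfold HH
    rw [← integral_const_mul, ← integral_const_mul]
    refine setIntegral_mono_on ((kk_int0 g hg b h0 y).const_mul _)
      ((kk_int0 g hg b h0 z).const_mul _) measurableSet_Ioi fun x hx => ?_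
    have hx : 0 < x := hx
    have := hg0 x
    have e1 : Real.exp (β * y) ≤ Real.exp (β * z) := Real.exp_le_exp.2 (by gcongr)
    have e2 : kk b 0 y x ≤ kk b 0 z x := by
      unfold kk
      have h : -y^2/(2*x) ≤ -z^2/(2*x) :=
        div_le_div_of_nonneg_right (by nlinarith) (by positivity)
      exact mul_le_mul_of_nonneg_left (Real.exp_le_exp.2 (by linarith)) (by positivity)
    have e3 := kk_nonneg b 0 y x hx
    gcongr
  set u : ℝ → ℝ := fun y => Real.exp (-(β * y)) * (β * HH g b 0 y - y * HH g b 1 y) with hu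
  have hFd : ∀ y > 0, HasDerivAt (FF g β) (Real.exp (2 * (β * y)) * u y) y := by
    intro y hy
    rw [hF]
    have e1 : HasDerivAt (fun y => Real.exp (β * y)) (Real.exp (β * y) * β) y := by
      simpa using ((hasDerivAt_id y).const_mul β).exp
    refine (e1.mul (HH_deriv g hg hg_int b hb0 0 y hy)).congr_deriv ?_
    have : Real.exp (2 * (β * y)) * u y = (Real.exp (2 * (β * y)) * Real.exp (-(β * y))) *
       (β * HH g b 0 y - y * HH g b 1 y) := by simp only [hu]; ring
    rw [this, ← Real.exp_add, show 2 * (β * y) + -(β * y) = β * y by ring]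
    ring
  have hud : ∀ y > 0, HasDerivAt u
      (Real.exp (-(β * y)) * ∫ x in Ioi (0:ℝ), qq b y x * g x) y := by
    intro y hy
    have e1 : HasDerivAt (fun y => Real.exp (-(β * y))) (Real.exp (-(β * y)) * (-β)) y := by
      simpa using ((hasDerivAt_id y).const_mul β).neg.exp
    have e2 := ((HH_deriv g hg hg_int b hb0 0 y hy).const_mul β).sub
      ((hasDerivAt_id y).mul (HH_deriv g hg hg_int b hb0 1 y hy))
    refine (e1.mul e2).congr_deriv ?_
    rw [(qq_eq g hg hg_int b y hb0 hy).2, hb]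
    simp
    ring
  -- no eventual positivity
  have hno : ∀ z > 0, ¬ ∀ y ≥ z, 0 < u y := by
    intro z hz h
    have hst : StrictMonoOn (FF g β) (Ici z) := by
      refine strictMonoOn_of_deriv_pos (convex_Ici z) hFc.continuousOn fun y hy => ?_
      rw [interior_Ici] at hy
      have hy : z < y := hy
      rw [(hFd y (hz.trans hy)).deriv]
      exact mul_pos (Real.exp_pos _) (h y hy.le)
    have h1 : FF g β z < FF g β (z+1) := hst (by simp) (by simp) (by linarith)
    have h2 : FF g β (z+1) ≤ 0 := by
      refine ge_of_tendsto (FF_tendsto g hg hg_int β hβ) ?_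
      filter_upwards [Filter.eventually_ge_atTop (z+1)] with y hy
      exact hst.monotoneOn (by simp) (show z ≤ y by linarith) hy
    have := hFn z
    linarith
  have hkey : ∀ y₁ y₂, 0 < y₁ → y₁ < y₂ → u y₁ ≤ 0 → u y₂ ≤ 0 := by
    intro y₁ y₂ h1 h12 hu1
    by_contra hu2
    push Not at hu2
    obtain ⟨ξ, hξ, hξe⟩ := exists_hasDerivAt_eq_slope u _ h12
      (fun y hy => (hud y (h1.trans_le hy.1)).continuousAt.continuousWithinAt)
      (fun y hy => hud y (h1.trans hy.1))
    have hξ0 : 0 < ξ := h1.trans hξ.1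
    have hD : 0 < ∫ x in Ioi (0:ℝ), qq b ξ x * g x := by
      have : 0 < (u y₂ - u y₁) / (y₂ - y₁) := div_pos (by linarith) (by linarith)
      rw [← hξe] at this
      exact (mul_pos_iff_of_pos_left (Real.exp_pos _)).1 this
    have hD2 : ∀ y > ξ, 0 ≤ ∫ x in Ioi (0:ℝ), qq b y x * g x := by
      intro y hy
      obtain ⟨r, hr, h⟩ := D_sign g hg hg0 hs hg_int m hm hmono hanti b hb0 ξ y hξ0 hy
      exact le_trans (by positivity) h
    have hum : MonotoneOn u (Ici ξ) := by
      refine monotoneOn_of_deriv_nonneg (convex_Ici ξ)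
        (fun y hy => (hud y (hξ0.trans_le hy)).continuousAt.continuousWithinAt)
        (fun y hy => ?_) fun y hy => ?_
      · rw [interior_Ici] at hy
        exact (hud y (hξ0.trans hy)).differentiableAt.differentiableWithinAt
      · rw [interior_Ici] at hy
        rw [(hud y (hξ0.trans hy)).deriv]
        exact mul_nonneg (Real.exp_pos _).le (hD2 y hy)
    exact hno y₂ (h1.trans h12) fun y hy =>
      hu2.trans_le (hum hξ.2.le (hξ.2.le.trans hy) hy)
  set T := {y : ℝ | 0 < y ∧ u y ≤ 0} with hT
  have hTn : T.Nonempty := by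
    have := hno 1 one_pos
    push Not at this
    obtain ⟨y, hy, h⟩ := this
    exact ⟨y, by linarith, h⟩
  have hTb : BddBelow T := ⟨0, fun y hy => hy.1.le⟩
  set y₀ := sInf T with hy₀
  have hy0 : 0 ≤ y₀ := le_csInf hTn fun y hy => hy.1.le
  refine ⟨y₀, ?_, ?_⟩
  · have hm2 : MonotoneOn (FF g β) (Icc 0 y₀) := by
      refine monotoneOn_of_deriv_nonneg (convex_Icc 0 y₀) hFc.continuousOn 
        (fun y hy => ?_) fun y hy => ?_
      · rw [interior_Icc] at hy
        exact (hFd y hy.1).differentiableAt.differentiableWithinAt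
      · rw [interior_Icc] at hy
        rw [(hFd y hy.1).deriv]
        refine mul_nonneg (Real.exp_pos _).le ?_
        by_contra h
        push Not at h
        exact absurd (csInf_le hTb ⟨hy.1, h.le⟩) (not_le.2 hy.2)
    have := hneg.union_right hm2 isGreatest_Iic (isLeast_Icc hy0)
    rwa [Iic_union_Icc_eq_Iic hy0] at this
  · refine antitoneOn_of_deriv_nonpos (convex_Ici y₀) hFc.continuousOn 
        (fun y hy => ?_) fun y hy => ?_
    · rw [interior_Ici] at hy
      exact (hFd y (hy0.trans_lt hy)).differentiableAt.differentiableWithinAt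
    · rw [interior_Ici] at hy
      rw [(hFd y (hy0.trans_lt hy)).deriv]
      refine mul_nonpos_of_nonneg_of_nonpos (Real.exp_pos _).le ?_
      obtain ⟨z, hz, hzy⟩ := exists_lt_of_csInf_lt hTn hy
      exact hkey z y hz.1 hzy hz.2

lemma core' (g : ℝ → ℝ) (hg : Measurable g) (hg0 : ∀ x, 0 ≤ g x) (hs : ∀ x ≤ 0, g x = 0)
    (hg_int : IntegrableOn g (Ioi 0)) (m : ℝ) (hm : 0 < m)
    (hmono : MonotoneOn g (Ioi 0 ∩ Iic m)) (hanti : AntitoneOn g (Ioi 0 ∩ Ici m))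
    (β : ℝ) (h0 : IntegrableOn (fun x => kk (β^2/2) 0 0 x * g x) (Ioi 0)) :
    ∃ y₀ : ℝ, MonotoneOn (FF g β) (Iic y₀) ∧ AntitoneOn (FF g β) (Ici y₀) := by
  rcases le_total 0 β with h | h
  · exact core g hg hg0 hs hg_int m hm hmono hanti β h h0
  · obtain ⟨y₀, h1, h2⟩ := core g hg hg0 hs hg_int m hm hmono hanti (-β) (by linarith)
      (by rwa [neg_sq])
    have e : ∀ y, FF g β y = FF g (-β) (-y) := by
      intro y
      unfold FF
      congr 1; funext x
      rw [show (-y - -β * x)^2 = (y - β * x)^2 by ring]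
    refine ⟨-y₀, fun y hy z hz hyz => ?_, fun y hy z hz hyz => ?_⟩
    · rw [e, e]
      simp only [mem_Iic] at hy hz
      exact h2 (show y₀ ≤ -z by linarith) (show y₀ ≤ -y by linarith) (by linarith)
    · rw [e, e]
      simp only [mem_Ici] at hy hz
      exact h1 (show -z ≤ y₀ by linarith) (show -y ≤ y₀ by linarith) (by linarith)

/-- Theorem 1(i): if the mixing density `g` is unimodal on `(0, ∞)`, then the normal
variance-mean mixture density `f` is unimodal on `ℝ`. -/
theorem normal_variance_mean_mixture_unimodal
    (g : ℝ → ℝ) (hg_meas : Measurable g) (hg_nonneg : ∀ x, 0 ≤ g x)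
    (hg_supp : ∀ x ≤ 0, g x = 0)
    (hg_int : IntegrableOn g (Ioi 0))
    (hg_pos : 0 < ∫ x in Ioi (0:ℝ), g x)
    (μ β σ : ℝ) (hσ : 0 < σ)
    (f : ℝ → ℝ)
    (hf : ∀ y, f y = ∫ x in Ioi (0:ℝ),
      (2 * π * σ ^ 2 * x) ^ (-(1:ℝ)/2) *
        Real.exp (-(y - μ - β * x) ^ 2 / (2 * σ ^ 2 * x)) * g x)
    (hf_int : ∀ y, IntegrableOn (fun x =>
      (2 * π * σ ^ 2 * x) ^ (-(1:ℝ)/2) *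
        Real.exp (-(y - μ - β * x) ^ 2 / (2 * σ ^ 2 * x)) * g x) (Ioi 0))
    (hg_uni : ∃ x₀ ∈ Ioi (0:ℝ),
      MonotoneOn g (Ioi 0 ∩ Iic x₀) ∧ AntitoneOn g (Ioi 0 ∩ Ici x₀)) :
    ∃ y₀ : ℝ, MonotoneOn f (Iic y₀) ∧ AntitoneOn f (Ici y₀) := by
  obtain ⟨m, hm, hmono, hanti⟩ := hg_uni
  have hm : 0 < m := hm
  set c := (√(2 * π * σ^2))⁻¹ with hc
  have hc0 : 0 < c := by positivity
  have hker : ∀ y x : ℝ, 0 < x → (2 * π * σ ^ 2 * x) ^ (-(1:ℝ)/2) *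
        Real.exp (-(y - μ - β * x) ^ 2 / (2 * σ ^ 2 * x)) * g x =
      c * ((√x)⁻¹ * Real.exp (-((y - μ)/σ - β/σ * x)^2 / (2*x)) * g x) := by
    intro y x hx
    have e1 : (2 * π * σ ^ 2 * x) ^ (-(1:ℝ)/2) = c * (√x)⁻¹ := by
      rw [neg_div, Real.rpow_neg (by positivity), ← Real.sqrt_eq_rpow,
        Real.sqrt_mul (by positivity), mul_inv]
    have e2 : -(y - μ - β * x) ^ 2 / (2 * σ ^ 2 * x) =
        -((y - μ)/σ - β/σ * x)^2 / (2*x) := by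
      field_simp
    rw [e1, e2]; ring
  have hfF : ∀ y, f y = c * FF g (β/σ) ((y - μ)/σ) := by
    intro y
    rw [hf, FF, ← integral_const_mul]
    exact setIntegral_congr_fun measurableSet_Ioi fun x hx => hker y x hx
  have h0 : IntegrableOn (fun x => kk ((β/σ)^2/2) 0 0 x * g x) (Ioi 0) := by
    have h1 := (hf_int μ).const_mul c⁻¹
    refine IntegrableOn.congr_fun h1 (fun x hx => ?_) measurableSet_Ioi
    have h2 := ker_eq (β/σ) 0 x hx
    rw [mul_zero, Real.exp_zero, one_mul] at h2
    rw [hker μ x hx, sub_self, zero_div, h2, inv_mul_cancel_left₀ hc0.ne']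
  obtain ⟨y₀, h1, h2⟩ := core' g hg_meas hg_nonneg hg_supp hg_int m hm hmono hanti (β/σ) h0
  refine ⟨σ * y₀ + μ, fun y hy z hz hyz => ?_, fun y hy z hz hyz => ?_⟩
  · rw [hfF, hfF]
    simp only [mem_Iic] at hy hz
    refine mul_le_mul_of_nonneg_left (h1 ?_ ?_ ?_) hc0.le
    · rw [mem_Iic, div_le_iff₀ hσ]; linarith
    · rw [mem_Iic, div_le_iff₀ hσ]; linarith
    · gcongr
  · rw [hfF, hfF]
    simp only [mem_Ici] at hy hz
    refine mul_le_mul_of_nonneg_left (h2 ?_ ?_ ?_) hc0.le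
    · rw [mem_Ici, le_div_iff₀ hσ]; linarith
    · rw [mem_Ici, le_div_iff₀ hσ]; linarith
    · gcongr
end

section
/- Let g be a nonnegative measurable function on ℝ supported on (0,∞) with 0 < ∫₀^∞ g(x) dx < ∞, let μ, β ∈ ℝ and σ > 0, and define f(y) = ∫₀^∞ (2πσ²x)^{-1/2} · exp(−(y − μ − βx)²/(2σ²x)) · g(x) dx, assumed finite for every y ∈ ℝ. If g is nonincreasing on (0,∞), or if β = 0, then f is nondecreasing on (−∞, μ] and nonincreasing on [μ, ∞); in particular f(y) ≤ f(μ) for all y ∈ ℝ. -/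
open MeasureTheory Set Real

noncomputable def nvK (b y x : ℝ) : ℝ := (√x)⁻¹ * Real.exp (-(y - b * x) ^ 2 / (2 * x))

noncomputable def nvP (u : ℝ) : ℝ := ∫ v in (0:ℝ)..u, Real.exp (-(1/2) * v ^ 2)

lemma nvP_deriv (u : ℝ) : HasDerivAt nvP (Real.exp (-(1/2) * u ^ 2)) u := by
  unfold nvP
  have hc : Continuous (fun v : ℝ => Real.exp (-(1/2) * v ^ 2)) := by fun_prop
  exact intervalIntegral.integral_hasDerivAt_right (hc.intervalIntegrable _ _)
    (hc.stronglyMeasurableAtFilter _ _) hc.continuousAt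

lemma nvP_neg (u : ℝ) : nvP (-u) = - nvP u := by
  unfold nvP
  have := intervalIntegral.integral_comp_neg (a := 0) (b := u)
    (fun v : ℝ => Real.exp (-(1/2) * v ^ 2))
  simp only [neg_sq, neg_zero] at this
  rw [this, intervalIntegral.integral_symm]

lemma nvP_zero : nvP 0 = 0 := by simp [nvP]

lemma nvP_top : ∃ L : ℝ, Filter.Tendsto nvP Filter.atTop (nhds L) :=
  ⟨_, intervalIntegral_tendsto_integral_Ioi 0
    (integrable_exp_neg_mul_sq (by norm_num : (0:ℝ) < 1/2)).integrableOn Filter.tendsto_id⟩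

noncomputable def nvA (b y x : ℝ) : ℝ :=
  (nvP ((b * x - y) / √x) + Real.exp (2 * b * y) * nvP ((b * x + y) / √x)) / b

lemma nvA_deriv {b y x : ℝ} (hb : 0 < b) (hx : 0 < x) :
    HasDerivAt (nvA b y) (nvK b y x) x := by
  have hs : 0 < √x := Real.sqrt_pos.2 hx
  have hsq : √x ^ 2 = x := Real.sq_sqrt hx.le
  have hd (c : ℝ) : HasDerivAt (fun x => (b * x + c) / √x)
      ((b * √x - (b * x + c) * (1 / (2 * √x))) / √x ^ 2) x := by
    have h1 : HasDerivAt (fun x : ℝ => b * x + c) b x := by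
      simpa using ((hasDerivAt_id x).const_mul b).add_const c
    exact h1.div (Real.hasDerivAt_sqrt hx.ne') hs.ne'
  have h1 := (nvP_deriv ((b * x + -y) / √x)).comp x (hd (-y))
  have h2 := (nvP_deriv ((b * x + y) / √x)).comp x (hd y)
  have h3 := (h1.add (h2.const_mul (Real.exp (2 * b * y)))).div_const b
  have e1 : Real.exp (-(1/2) * ((b * x + -y) / √x) ^ 2)
      = Real.exp (-(y - b * x) ^ 2 / (2 * x)) := by
    congr 1
    rw [div_pow, hsq]; field_simp; ring
  have e2 : Real.exp (2 * b * y) * Real.exp (-(1/2) * ((b * x + y) / √x) ^ 2)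
      = Real.exp (-(y - b * x) ^ 2 / (2 * x)) := by
    rw [← Real.exp_add]
    congr 1
    rw [div_pow, hsq]; field_simp; ring
  refine HasDerivAt.congr_deriv h3 ?_
  rw [← mul_assoc, e1, e2, nvK]
  generalize Real.exp (-(y - b * x) ^ 2 / (2 * x)) = E
  generalize √x = s at *
  subst hsq
  field_simp
  ring

lemma nvK_nonneg (b y x : ℝ) : 0 ≤ nvK b y x := by unfold nvK; positivity

lemma nv_atTop {b : ℝ} (hb : 0 < b) (c : ℝ) :
    Filter.Tendsto (fun x => (b * x + c) / √x) Filter.atTop Filter.atTop := by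
  have h1 : Filter.Tendsto (fun x : ℝ => b * √x) Filter.atTop Filter.atTop :=
    Real.tendsto_sqrt_atTop.const_mul_atTop hb
  have h2 : Filter.Tendsto (fun x : ℝ => c / √x) Filter.atTop (nhds 0) :=
    Real.tendsto_sqrt_atTop.const_div_atTop c
  refine (h1.atTop_add h2).congr' ?_
  filter_upwards [Filter.eventually_gt_atTop 0] with x hx
  have hs : 0 < √x := Real.sqrt_pos.2 hx
  have hsq : √x ^ 2 = x := Real.sq_sqrt hx.le
  field_simp
  rw [hsq]

lemma nv_zero (b : ℝ) {c : ℝ} (hc : 0 < c) :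
    Filter.Tendsto (fun x => (b * x + c) / √x) (nhdsWithin 0 (Ioi 0)) Filter.atTop := by
  have h0 : Filter.Tendsto (fun x : ℝ => √x) (nhdsWithin 0 (Ioi 0)) (nhdsWithin 0 (Ioi 0)) := by
    refine tendsto_nhdsWithin_iff.2 ⟨?_, ?_⟩
    · have := (Real.continuous_sqrt.tendsto 0).mono_left (nhdsWithin_le_nhds (s := Ioi 0))
      simpa using this
    · filter_upwards [self_mem_nhdsWithin] with x hx using Real.sqrt_pos.2 hx
  have h1 : Filter.Tendsto (fun x : ℝ => b * x + c) (nhdsWithin 0 (Ioi 0)) (nhds c) := by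
    have : Continuous (fun x : ℝ => b * x + c) := by fun_prop
    have := (this.tendsto 0).mono_left (nhdsWithin_le_nhds (s := Ioi 0))
    simpa using this
  simp only [div_eq_mul_inv]
  exact h1.pos_mul_atTop hc h0.inv_tendsto_nhdsGT_zero

lemma nvK_int {b : ℝ} (hb : 0 < b) : ∃ C : ℝ, ∀ y, 0 ≤ y →
    IntegrableOn (nvK b y) (Ioi 0) ∧ ∫ x in Ioi (0:ℝ), nvK b y x = C := by
  obtain ⟨L, hL⟩ := nvP_top
  refine ⟨(L + L) / b, fun y hy => ?_⟩
  have ht : Filter.Tendsto (nvA b y) Filter.atTop (nhds ((L + Real.exp (2*b*y) * L) / b)) := by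
    have h1 := hL.comp (nv_atTop hb (-y))
    have h2 := hL.comp (nv_atTop hb y)
    exact (h1.add (h2.const_mul _)).div_const b
  have hz : Filter.Tendsto (nvA b y) (nhdsWithin 0 (Ioi 0))
      (nhds ((-L + Real.exp (2*b*y) * L) / b)) := by
    rcases hy.eq_or_lt with rfl | hy
    · have hc : Continuous (fun x : ℝ => (2 * nvP (b * √x)) / b) := by
        have : Continuous nvP := continuous_iff_continuousAt.2 fun u => (nvP_deriv u).continuousAt
        fun_prop
      have := (hc.tendsto 0).mono_left (nhdsWithin_le_nhds (s := Ioi 0))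
      simp only [Real.sqrt_zero, mul_zero, nvP_zero, zero_div] at this
      simp only [mul_zero, Real.exp_zero, one_mul, neg_add_cancel, zero_div]
      refine this.congr' ?_
      filter_upwards [self_mem_nhdsWithin] with x hx
      have : b * x / √x = b * √x := by rw [mul_div_assoc, Real.div_sqrt]
      simp only [nvA, sub_zero, add_zero, mul_zero, Real.exp_zero, one_mul, this, two_mul]
    · have h2 := hL.comp (nv_zero b hy)
      have h1 := (hL.comp (nv_zero (-b) hy)).neg
      refine ((h1.add (h2.const_mul (Real.exp (2*b*y)))).div_const b).congr fun x => ?_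
      simp only [nvA, Function.comp]
      rw [← nvP_neg]
      congr 4
      ring
  have hder : ∀ x ∈ Ioi (0:ℝ), HasDerivAt (nvA b y) (nvK b y x) x := fun x hx => nvA_deriv hb hx
  set a' := (-L + Real.exp (2*b*y) * L) / b with ha
  have hder' : ∀ x ∈ Ioi (0:ℝ),
      HasDerivAt (Function.update (nvA b y) 0 a') (nvK b y x) x := by
    intro x (hx : 0 < x)
    apply (hder x hx).congr_of_eventuallyEq
    filter_upwards [eventually_ne_nhds hx.ne.symm] with w hw
    exact Function.update_of_ne hw a' (nvA b y)
  have ht' : Filter.Tendsto (Function.update (nvA b y) 0 a') Filter.atTop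
      (nhds ((L + Real.exp (2*b*y) * L) / b)) := by
    apply ht.congr'
    filter_upwards [Filter.eventually_ne_atTop 0] with w hw
    exact (Function.update_of_ne hw a' (nvA b y)).symm
  have hcont : ContinuousWithinAt (Function.update (nvA b y) 0 a') (Ici 0) 0 := by
    rw [continuousWithinAt_update_same, Ici_sdiff_left]
    exact hz
  have hpos : ∀ x ∈ Ioi (0:ℝ), 0 ≤ nvK b y x := fun x _ => nvK_nonneg b y x
  refine ⟨integrableOn_Ioi_deriv_of_nonneg hcont hder' hpos ht', ?_⟩
  rw [integral_Ioi_of_hasDerivAt_of_nonneg hcont hder' hpos ht', Function.update_self, ha]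
  ring

lemma nv_core {g : ℝ → ℝ} (hg : ∀ x, 0 ≤ g x) {b y z : ℝ} (hd : AntitoneOn g (Ioi 0) ∨ b = 0)
    (hy : 0 ≤ y) (hyz : y ≤ z)
    (iy : IntegrableOn (fun x => nvK b y x * g x) (Ioi 0))
    (iz : IntegrableOn (fun x => nvK b z x * g x) (Ioi 0)) :
    ∫ x in Ioi (0:ℝ), nvK b z x * g x ≤ ∫ x in Ioi (0:ℝ), nvK b y x * g x := by
  rcases le_or_gt b 0 with hb | hb
  · refine setIntegral_mono_on iz iy measurableSet_Ioi fun x hx => ?_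
    have hx : 0 < x := hx
    refine mul_le_mul_of_nonneg_right ?_ (hg x)
    unfold nvK
    have : b * x ≤ 0 := mul_nonpos_of_nonpos_of_nonneg hb hx.le
    gcongr
    linarith
  · have hd : AntitoneOn g (Ioi 0) := hd.resolve_right hb.ne'
    rcases hyz.eq_or_lt with rfl | hlt
    · exact le_rfl
    obtain ⟨C, hC⟩ := nvK_int hb
    obtain ⟨jy, ey⟩ := hC y hy
    obtain ⟨jz, ez⟩ := hC z (hy.trans hyz)
    set p := (y + z) / (2 * b) with hp
    have hp0 : 0 < p := by rw [hp]; apply div_pos <;> linarith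
    have hpb : 2 * (b * p) = y + z := by rw [hp]; field_simp
    have key : ∫ x in Ioi (0:ℝ), (nvK b y x - nvK b z x) * g p ≤
        ∫ x in Ioi (0:ℝ), (nvK b y x * g x - nvK b z x * g x) := by
      refine setIntegral_mono_on ((jy.sub jz).mul_const _) (iy.sub iz) measurableSet_Ioi
        fun x hx => ?_
      have hx : 0 < x := hx
      rw [← sub_mul]
      rcases le_total x p with h | h
      · refine mul_le_mul_of_nonneg_left (hd hx hp0 h) (sub_nonneg.2 ?_)
        unfold nvK
        have : b * x ≤ b * p := by gcongr
        have h4 : (y - b * x) ^ 2 ≤ (z - b * x) ^ 2 := by nlinarith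
        gcongr
      · refine mul_le_mul_of_nonpos_left (hd hp0 hx h) (sub_nonpos.2 ?_)
        unfold nvK
        have : b * p ≤ b * x := by gcongr
        have h4 : (z - b * x) ^ 2 ≤ (y - b * x) ^ 2 := by nlinarith
        gcongr
    rw [integral_mul_const, integral_sub jy jz, integral_sub iy iz, ey, ez] at key
    linarith

lemma nv_ker {μ β σ x y : ℝ} (hσ : 0 < σ) (hx : 0 < x) :
    (2 * π * σ ^ 2 * x) ^ (-(1:ℝ)/2) * Real.exp (-(y - μ - β * x) ^ 2 / (2 * σ ^ 2 * x))
     = (2 * π * σ ^ 2) ^ (-(1:ℝ)/2) * nvK (β / σ) ((y - μ) / σ) x := by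
  rw [Real.mul_rpow (by positivity) hx.le, nvK, mul_assoc]
  congr 2
  · rw [Real.sqrt_eq_rpow, ← Real.rpow_neg hx.le]; norm_num
  · congr 1
    field_simp

lemma nvK_neg (b y x : ℝ) : nvK (-b) (-y) x = nvK b y x := by
  unfold nvK; congr 3; ring

theorem normal_variance_mean_mixture_mode_at_mu
    (g : ℝ → ℝ) (hg_meas : Measurable g) (hg_nonneg : ∀ x, 0 ≤ g x)
    (hg_supp : ∀ x ≤ 0, g x = 0)
    (hg_int : IntegrableOn g (Ioi 0))
    (hg_pos : 0 < ∫ x in Ioi (0:ℝ), g x)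
    (μ β σ : ℝ) (hσ : 0 < σ)
    (f : ℝ → ℝ)
    (hf : ∀ y, f y = ∫ x in Ioi (0:ℝ),
      (2 * π * σ ^ 2 * x) ^ (-(1:ℝ)/2) *
        Real.exp (-(y - μ - β * x) ^ 2 / (2 * σ ^ 2 * x)) * g x)
    (hf_int : ∀ y, IntegrableOn (fun x =>
      (2 * π * σ ^ 2 * x) ^ (-(1:ℝ)/2) *
        Real.exp (-(y - μ - β * x) ^ 2 / (2 * σ ^ 2 * x)) * g x) (Ioi 0))
    (hg_dec : AntitoneOn g (Ioi 0) ∨ β = 0) :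
    MonotoneOn f (Iic μ) ∧ AntitoneOn f (Ici μ) ∧ ∀ y, f y ≤ f μ := by
  have hc : 0 < (2 * π * σ ^ 2) ^ (-(1:ℝ)/2) := by positivity
  set c := (2 * π * σ ^ 2) ^ (-(1:ℝ)/2) with hcdef
  have hk (y : ℝ) : EqOn (fun x => (2 * π * σ ^ 2 * x) ^ (-(1:ℝ)/2) *
        Real.exp (-(y - μ - β * x) ^ 2 / (2 * σ ^ 2 * x)) * g x)
        (fun x => c * (nvK (β / σ) ((y - μ) / σ) x * g x)) (Ioi 0) := by
    intro x hx
    simp only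
    rw [nv_ker hσ hx, mul_assoc]
  have hf' (y : ℝ) : f y = c * ∫ x in Ioi (0:ℝ), nvK (β / σ) ((y - μ) / σ) x * g x := by
    rw [hf, setIntegral_congr_fun measurableSet_Ioi (hk y), integral_const_mul]
  have hi (y : ℝ) : IntegrableOn (fun x => nvK (β / σ) ((y - μ) / σ) x * g x) (Ioi 0) := by
    have h := ((integrableOn_congr_fun (hk y) measurableSet_Ioi).1 (hf_int y)).const_mul c⁻¹
    refine h.congr (Filter.Eventually.of_forall fun x => ?_)
    simp only
    field_simp
  have hd : AntitoneOn g (Ioi 0) ∨ β / σ = 0 := hg_dec.imp_right fun h => by simp [h]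
  have hd' : AntitoneOn g (Ioi 0) ∨ -(β / σ) = 0 := hd.imp_right fun h => by simp [h]
  have hA : AntitoneOn f (Ici μ) := by
    intro y hy z hz hyz
    rw [hf', hf']
    refine mul_le_mul_of_nonneg_left ?_ hc.le
    have hy : μ ≤ y := hy
    exact nv_core hg_nonneg hd (div_nonneg (by linarith) hσ.le) (by gcongr) (hi y) (hi z)
  have hM : MonotoneOn f (Iic μ) := by
    intro y hy z hz hyz
    rw [hf', hf']
    refine mul_le_mul_of_nonneg_left ?_ hc.le
    have hz : z ≤ μ := hz
    have := nv_core (b := -(β / σ)) (y := -((z - μ) / σ)) (z := -((y - μ) / σ)) hg_nonneg hd'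
      (neg_nonneg.2 (div_nonpos_of_nonpos_of_nonneg (by linarith) hσ.le))
      (neg_le_neg (by gcongr))
      (by simpa only [nvK_neg] using hi z) (by simpa only [nvK_neg] using hi y)
    simpa only [nvK_neg] using this
  refine ⟨hM, hA, fun y => ?_⟩
  rcases le_total y μ with h | h
  · exact hM h (mem_Iic.2 le_rfl) h
  · exact hA (mem_Ici.2 le_rfl) h h
end

section
/- Let g be a nonnegative measurable function on ℝ supported on (0,∞) with 0 < ∫₀^∞ g(x) dx < ∞, let μ, β ∈ ℝ and σ > 0, and define f(y) = ∫₀^∞ (2πσ²x)^{-1/2} · exp(−(y − μ − βx)²/(2σ²x)) · g(x) dx, assumed finite for every y ∈ ℝ. If g restricted to (0,∞) is log-concave, then f is log-concave on ℝ. -/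
open MeasureTheory Set Real

lemma conv_aux (A B α γ : ℝ) (hα : 0 ≤ α) (hγ : 0 ≤ γ) :
    ConvexOn ℝ univ (fun t : ℝ => α * exp (A * t) + γ * exp (-(B * t))) := by
  have h1 : ConvexOn ℝ univ (fun t : ℝ => exp (A * t)) := by
    have := convexOn_exp.comp_linearMap (LinearMap.mul ℝ ℝ A)
    simpa [Function.comp_def] using this
  have h2 : ConvexOn ℝ univ (fun t : ℝ => exp (-(B * t))) := by
    have := convexOn_exp.comp_linearMap (LinearMap.mul ℝ ℝ (-B))
    simpa [Function.comp_def] using this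
  exact (h1.smul hα).add (h2.smul hγ)

lemma two_pt (A B s t : ℝ) (hA : 0 < A) (hB : 0 < B) (hst : s < t) :
    ∃ α γ : ℝ, 0 ≤ α ∧ 0 ≤ γ ∧
      (∀ u, s ≤ u → u ≤ t → α * exp (A * u) + γ * exp (-(B * u)) ≤ 1) ∧
      (∀ u, (u ≤ s ∨ t ≤ u) → 1 ≤ α * exp (A * u) + γ * exp (-(B * u))) := by
  have e1 : exp (A * s) < exp (A * t) := exp_lt_exp.2 (by nlinarith)
  have e2 : exp (-(B * t)) < exp (-(B * s)) := exp_lt_exp.2 (by nlinarith)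
  have p1 := exp_pos (A * s)
  have p2 := exp_pos (-(B * t))
  set a1 := exp (A * s)
  set a2 := exp (A * t)
  set b1 := exp (-(B * s))
  set b2 := exp (-(B * t))
  have hD : 0 < a2 * b1 - a1 * b2 := by nlinarith
  have hα : 0 ≤ (b1 - b2) / (a2 * b1 - a1 * b2) := div_nonneg (by linarith) hD.le
  have hγ : 0 ≤ (a2 - a1) / (a2 * b1 - a1 * b2) := div_nonneg (by linarith) hD.le
  have hc := conv_aux A B _ _ hα hγ
  have hs : (b1 - b2) / (a2 * b1 - a1 * b2) * exp (A * s)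
      + (a2 - a1) / (a2 * b1 - a1 * b2) * exp (-(B * s)) = 1 := by
    change (b1 - b2) / (a2 * b1 - a1 * b2) * a1
      + (a2 - a1) / (a2 * b1 - a1 * b2) * b1 = 1
    rw [div_mul_eq_mul_div, div_mul_eq_mul_div, ← add_div, div_eq_one_iff_eq hD.ne']; ring
  have ht : (b1 - b2) / (a2 * b1 - a1 * b2) * exp (A * t)
      + (a2 - a1) / (a2 * b1 - a1 * b2) * exp (-(B * t)) = 1 := by
    change (b1 - b2) / (a2 * b1 - a1 * b2) * a2
      + (a2 - a1) / (a2 * b1 - a1 * b2) * b2 = 1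
    rw [div_mul_eq_mul_div, div_mul_eq_mul_div, ← add_div, div_eq_one_iff_eq hD.ne']; ring
  refine ⟨_, _, hα, hγ, ?_, ?_⟩
  · intro u h1 h2
    have := hc.le_max_of_mem_Icc (mem_univ s) (mem_univ t) ⟨h1, h2⟩
    simp only [hs, ht, max_self] at this
    exact this
  · rintro u (h | h)
    · rcases h.eq_or_lt with rfl | h
      · exact hs.ge
      · have := hc.slope_mono_adjacent (mem_univ u) (mem_univ t) h hst
        simp only [hs, ht, sub_self, zero_div] at this
        by_contra hcon
        have := div_pos (sub_pos.2 (not_le.1 hcon)) (sub_pos.2 h)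
        linarith
    · rcases h.eq_or_lt with rfl | h
      · exact ht.ge
      · have := hc.slope_mono_adjacent (mem_univ s) (mem_univ u) hst h
        simp only [hs, ht, sub_self, zero_div] at this
        by_contra hcon
        have := div_neg_of_neg_of_pos (sub_neg.2 (not_le.1 hcon)) (sub_pos.2 h)
        linarith

lemma sign_lem (A B : ℝ) (hA : 0 < A) (hB : 0 < B) (I : Set ℝ) (hI : I ⊆ Ioi 0)
    (hoc : I.OrdConnected) :
    ∃ α γ : ℝ, 0 ≤ α ∧ 0 ≤ γ ∧ ∀ᵐ x : ℝ, 0 < x →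
      (x ∈ I → α * exp (A * x⁻¹) + γ * exp (-(B * x⁻¹)) ≤ 1) ∧
      (x ∉ I → 1 ≤ α * exp (A * x⁻¹) + γ * exp (-(B * x⁻¹))) := by
  by_cases hsub : I.Subsingleton
  · refine ⟨1, 1, zero_le_one, zero_le_one, ?_⟩
    have h0 : ∀ᵐ x : ℝ, x ∉ I := measure_eq_zero_iff_ae_notMem.1 (hsub.measure_zero volume)
    filter_upwards [h0] with x hx hx0
    refine ⟨fun h => absurd h hx, fun _ => ?_⟩
    have : 1 ≤ exp (A * x⁻¹) := one_le_exp (by positivity)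
    have := exp_pos (-(B * x⁻¹))
    linarith
  obtain ⟨x0, h0, x1, h1, h01⟩ := (Set.not_subsingleton_iff.1 hsub).exists_lt
  have hne : I.Nonempty := ⟨x0, h0⟩
  have hbb : BddBelow I := ⟨0, fun x hx => le_of_lt (hI hx)⟩
  have ha0 : 0 ≤ sInf I := le_csInf hne fun x hx => le_of_lt (hI hx)
  set a := sInf I with ha
  have hal : ∀ x ∈ I, a ≤ x := fun x hx => csInf_le hbb hx
  have hag : ∀ x, a < x → ∃ z ∈ I, z < x := fun x hx => exists_lt_of_csInf_lt hne hx
  by_cases hab : BddAbove I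
  · set b := sSup I with hb
    have hbl : ∀ x ∈ I, x ≤ b := fun x hx => le_csSup hab hx
    have hbg : ∀ x, x < b → ∃ z ∈ I, x < z := fun x hx => exists_lt_of_lt_csSup hne hx
    have hlt : a < b := (hal _ h0).trans_lt (h01.trans_le (hbl _ h1))
    have hb0 : 0 < b := ha0.trans_lt hlt
    have hmem : ∀ x, x ∉ I → x ≤ a ∨ b ≤ x := by
      intro x hx
      by_contra! hcon
      obtain ⟨z, hz, hz'⟩ := hag x hcon.1
      obtain ⟨w, hw, hw'⟩ := hbg x hcon.2
      exact hx (hoc.out hz hw ⟨hz'.le, hw'.le⟩)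
    rcases ha0.eq_or_lt with ha0 | ha0
    · refine ⟨0, exp (B * b⁻¹), le_rfl, (exp_pos _).le, ae_of_all _ fun x hx => ⟨fun h => ?_, fun h => ?_⟩⟩
      · have : b⁻¹ ≤ x⁻¹ := inv_anti₀ hx (hbl x h)
        rw [zero_mul, zero_add, ← exp_add, exp_le_one_iff]
        nlinarith
      · have : b ≤ x := (hmem x h).resolve_left (by linarith)
        have : x⁻¹ ≤ b⁻¹ := inv_anti₀ hb0 this
        rw [zero_mul, zero_add, ← exp_add]
        apply one_le_exp
        nlinarith
    · obtain ⟨α, γ, hα, hγ, q1, q2⟩ := two_pt A B b⁻¹ a⁻¹ hA hB (inv_strictAnti₀ ha0 hlt)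
      refine ⟨α, γ, hα, hγ, ae_of_all _ fun x hx => ⟨fun h => ?_, fun h => ?_⟩⟩
      · exact q1 _ (inv_anti₀ hx (hbl x h)) (inv_anti₀ ha0 (hal x h))
      · refine q2 _ ((hmem x h).elim (fun h => Or.inr (inv_anti₀ hx h)) fun h => Or.inl (inv_anti₀ hb0 h))
  · have hmem : ∀ x, x ∉ I → x ≤ a := by
      intro x hx
      by_contra! hcon
      obtain ⟨z, hz, hz'⟩ := hag x hcon
      obtain ⟨w, hw, hw'⟩ := not_bddAbove_iff.1 hab x
      exact hx (hoc.out hz hw ⟨hz'.le, hw'.le⟩)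
    rcases ha0.eq_or_lt with ha0 | ha0
    · refine ⟨0, 0, le_rfl, le_rfl, ae_of_all _ fun x hx => ⟨fun h => by simp, fun h => ?_⟩⟩
      have := hmem x h
      linarith
    · refine ⟨exp (-(A * a⁻¹)), 0, (exp_pos _).le, le_rfl, ae_of_all _ fun x hx => ⟨fun h => ?_, fun h => ?_⟩⟩
      · have : x⁻¹ ≤ a⁻¹ := inv_anti₀ ha0 (hal x h)
        rw [zero_mul, add_zero, ← exp_add, exp_le_one_iff]
        nlinarith
      · have : a⁻¹ ≤ x⁻¹ := inv_anti₀ hx (hmem x h)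
        rw [zero_mul, add_zero, ← exp_add]
        apply one_le_exp
        nlinarith

lemma gaussPrim : ∃ (Φ : ℝ → ℝ) (κ : ℝ), 0 < κ ∧ Φ 0 = 0 ∧
    (∀ z, HasDerivAt Φ (exp (-(z ^ 2 / 2))) z) ∧
    Filter.Tendsto Φ Filter.atTop (nhds κ) ∧ Filter.Tendsto Φ Filter.atBot (nhds (-κ)) := by
  have hc : Continuous (fun t : ℝ => exp (-(t ^ 2 / 2))) := by fun_prop
  have heq : (fun t : ℝ => exp (-(t ^ 2 / 2))) = fun t => exp (-(1/2) * t ^ 2) := by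
    ext t; congr 1; ring
  have hint : Integrable (fun t : ℝ => exp (-(t ^ 2 / 2))) := by
    rw [heq]; exact integrable_exp_neg_mul_sq (by norm_num)
  have hT : Filter.Tendsto (fun z : ℝ => ∫ t in (0:ℝ)..z, exp (-(t ^ 2 / 2))) Filter.atTop
      (nhds (∫ t in Ioi (0:ℝ), exp (-(t ^ 2 / 2)))) :=
    intervalIntegral_tendsto_integral_Ioi 0 hint.integrableOn Filter.tendsto_id
  refine ⟨fun z => ∫ t in (0:ℝ)..z, exp (-(t ^ 2 / 2)), ∫ t in Ioi (0:ℝ), exp (-(t ^ 2 / 2)),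
    ?_, by simp, fun z => ?_, hT, ?_⟩
  · rw [heq, integral_gaussian_Ioi]; positivity
  · exact intervalIntegral.integral_hasDerivAt_right
      (hc.intervalIntegrable _ _) (hc.stronglyMeasurableAtFilter _ _) hc.continuousAt
  · have h2 := (hT.comp Filter.tendsto_neg_atBot_atTop).neg
    refine h2.congr fun z => ?_
    have := intervalIntegral.integral_comp_neg (a := 0) (b := -z) (fun t : ℝ => exp (-(t ^ 2 / 2)))
    simp only [neg_sq, neg_neg, neg_zero] at this
    simp only [Function.comp]
    rw [this, intervalIntegral.integral_symm, neg_neg]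

lemma lap (l : ℝ) (hl : 0 < l) : ∃ C : ℝ, 0 < C ∧ ∀ y, 0 ≤ y →
    IntegrableOn (fun x : ℝ => x ^ (-(1:ℝ)/2) * exp (-(y ^ 2 / 2 * x⁻¹)) * exp (-(l ^ 2 / 2 * x)))
      (Ioi 0) ∧
    ∫ x in Ioi (0:ℝ), x ^ (-(1:ℝ)/2) * exp (-(y ^ 2 / 2 * x⁻¹)) * exp (-(l ^ 2 / 2 * x))
      = C * exp (-(l * y)) := by
  obtain ⟨Φ, κ, hκ, hΦ0, hd, hT, hB⟩ := gaussPrim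
  refine ⟨2 * κ / l, by positivity, fun y hy => ?_⟩
  set P : ℝ → ℝ := fun x => l⁻¹ * (exp (-(l * y)) * Φ (l * √x - y * (√x)⁻¹) +
    exp (l * y) * Φ (l * √x + y * (√x)⁻¹)) with hP
  have hderiv : ∀ x ∈ Ioi (0:ℝ), HasDerivAt P
      (x ^ (-(1:ℝ)/2) * exp (-(y ^ 2 / 2 * x⁻¹)) * exp (-(l ^ 2 / 2 * x))) x := by
    intro x hx
    have hx0 : (0:ℝ) < x := hx
    have hs : 0 < √x := sqrt_pos.2 hx0
    have hsq : √x ^ 2 = x := sq_sqrt hx0.le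
    have d1 := (hasDerivAt_sqrt hx0.ne')
    have d2 := d1.inv hs.ne'
    have e1 := (hd (l * √x - y * (√x)⁻¹)).comp x ((d1.const_mul l).sub (d2.const_mul y))
    have e2 := (hd (l * √x + y * (√x)⁻¹)).comp x ((d1.const_mul l).add (d2.const_mul y))
    have e3 := ((e1.const_mul (exp (-(l * y)))).add (e2.const_mul (exp (l * y)))).const_mul l⁻¹
    refine HasDerivAt.congr_deriv e3 ?_
    have hr : x ^ (-(1:ℝ)/2) = (√x)⁻¹ := by
      rw [neg_div, rpow_neg hx0.le, sqrt_eq_rpow]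
    rw [hr, ← mul_assoc, ← mul_assoc, ← exp_add, ← exp_add, mul_assoc (√x)⁻¹, ← exp_add]
    have q1 : -(l * y) + -((l * √x - y * (√x)⁻¹) ^ 2 / 2) =
        -(y ^ 2 / 2 * x⁻¹) + -(l ^ 2 / 2 * x) := by
      rw [← hsq]; simp only [sqrt_sq hs.le]; field_simp; ring
    have q2 : (l * y) + -((l * √x + y * (√x)⁻¹) ^ 2 / 2) =
        -(y ^ 2 / 2 * x⁻¹) + -(l ^ 2 / 2 * x) := by
      rw [← hsq]; simp only [sqrt_sq hs.le]; field_simp; ring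
    rw [q1, q2]
    field_simp; ring
  have hst : Filter.Tendsto (fun x : ℝ => √x) Filter.atTop Filter.atTop := tendsto_sqrt_atTop
  have hlst : Filter.Tendsto (fun x : ℝ => l * √x) Filter.atTop Filter.atTop :=
    hst.const_mul_atTop hl
  have hinv : Filter.Tendsto (fun x : ℝ => y * (√x)⁻¹) Filter.atTop (nhds 0) := by
    simpa using (tendsto_inv_atTop_zero.comp hst).const_mul y
  have hinf : Filter.Tendsto P Filter.atTop
      (nhds (l⁻¹ * (exp (-(l * y)) * κ + exp (l * y) * κ))) := by
    refine ((Filter.Tendsto.const_mul _ (hT.comp ?_)).add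
      (Filter.Tendsto.const_mul _ (hT.comp ?_))).const_mul _
    · simpa [sub_eq_add_neg] using hlst.atTop_add hinv.neg
    · exact hlst.atTop_add hinv
  obtain ⟨L, hL, hL0⟩ : ∃ L, Filter.Tendsto P (nhdsWithin 0 (Ioi 0)) (nhds L) ∧
      l⁻¹ * (exp (-(l * y)) * κ + exp (l * y) * κ) - L = 2 * κ / l * exp (-(l * y)) := by
    have hs0 : Filter.Tendsto (fun x : ℝ => √x) (nhdsWithin 0 (Ioi 0)) (nhds 0) := by
      have := (continuous_sqrt.tendsto 0).mono_left (nhdsWithin_le_nhds (s := Ioi 0))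
      simpa using this
    have hs1 : Filter.Tendsto (fun x : ℝ => √x) (nhdsWithin 0 (Ioi 0)) (nhdsWithin 0 (Ioi 0)) :=
      tendsto_nhdsWithin_iff.2 ⟨hs0, by
        filter_upwards [self_mem_nhdsWithin] with x hx using sqrt_pos.2 hx⟩
    have hl0 : Filter.Tendsto (fun x : ℝ => l * √x) (nhdsWithin 0 (Ioi 0)) (nhds 0) := by
      simpa using hs0.const_mul l
    rcases hy.eq_or_lt with rfl | hy
    · refine ⟨0, ?_, by simp; field_simp; ring⟩
      have hc : Filter.Tendsto Φ (nhds 0) (nhds 0) := by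
        have := (hd 0).continuousAt.tendsto
        rwa [hΦ0] at this
      have := (((hc.comp hl0).const_mul (exp (-(l * 0)))).add
        ((hc.comp hl0).const_mul (exp (l * 0)))).const_mul l⁻¹
      simpa [hP, Function.comp_def] using this
    · refine ⟨l⁻¹ * (exp (-(l * y)) * (-κ) + exp (l * y) * κ), ?_, by field_simp; ring⟩
      have hi : Filter.Tendsto (fun x : ℝ => y * (√x)⁻¹) (nhdsWithin 0 (Ioi 0)) Filter.atTop :=
        (tendsto_inv_nhdsGT_zero.comp hs1).const_mul_atTop hy
      refine ((Filter.Tendsto.const_mul _ (hB.comp ?_)).add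
        (Filter.Tendsto.const_mul _ (hT.comp ?_))).const_mul _
      · simpa [sub_eq_add_neg] using hl0.add_atBot (Filter.tendsto_neg_atTop_atBot.comp hi)
      · exact hl0.add_atTop hi
  have hQc : ContinuousWithinAt (Function.update P 0 L) (Ici 0) 0 := by
    rw [continuousWithinAt_update_same]
    simpa using hL
  have hQd : ∀ x ∈ Ioi (0:ℝ), HasDerivAt (Function.update P 0 L)
      (x ^ (-(1:ℝ)/2) * exp (-(y ^ 2 / 2 * x⁻¹)) * exp (-(l ^ 2 / 2 * x))) x := by
    intro x hx
    refine (hderiv x hx).congr_of_eventuallyEq ?_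
    filter_upwards [Ioi_mem_nhds (show (0:ℝ) < x from hx)] with z hz
    exact Function.update_of_ne (ne_of_gt hz) _ _
  have hQi : Filter.Tendsto (Function.update P 0 L) Filter.atTop
      (nhds (l⁻¹ * (exp (-(l * y)) * κ + exp (l * y) * κ))) := by
    refine hinf.congr' ?_
    filter_upwards [Filter.eventually_gt_atTop 0] with z hz
    exact (Function.update_of_ne (ne_of_gt hz) _ _).symm
  have hnn : ∀ x ∈ Ioi (0:ℝ),
      0 ≤ x ^ (-(1:ℝ)/2) * exp (-(y ^ 2 / 2 * x⁻¹)) * exp (-(l ^ 2 / 2 * x)) := by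
    intro x hx
    have : (0:ℝ) < x := hx
    positivity
  refine ⟨integrableOn_Ioi_deriv_of_nonneg hQc hQd hnn hQi, ?_⟩
  rw [integral_Ioi_of_hasDerivAt_of_nonneg hQc hQd hnn hQi, Function.update_self, hL0]

lemma core_anti (G : ℝ → ℝ) (hG0 : ∀ x, 0 ≤ G x)
    (hint : ∀ y : ℝ, IntegrableOn
      (fun x : ℝ => x ^ (-(1:ℝ)/2) * exp (-(y ^ 2 / 2 * x⁻¹)) * G x) (Ioi 0))
    (y z : ℝ) (h : y ^ 2 ≤ z ^ 2) :
    ∫ x in Ioi (0:ℝ), x ^ (-(1:ℝ)/2) * exp (-(z ^ 2 / 2 * x⁻¹)) * G x ≤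
    ∫ x in Ioi (0:ℝ), x ^ (-(1:ℝ)/2) * exp (-(y ^ 2 / 2 * x⁻¹)) * G x := by
  refine setIntegral_mono_on (hint z) (hint y) measurableSet_Ioi fun x hx => ?_
  have hx0 : (0:ℝ) < x := hx
  have := hG0 x
  gcongr

lemma core_lt (G : ℝ → ℝ) (hG0 : ∀ x, 0 ≤ G x)
    (hoc : ∀ c : ℝ, 0 < c → ∀ k : ℝ, {x : ℝ | 0 < x ∧ c * exp (-(k * x)) ≤ G x}.OrdConnected)
    (hint : ∀ y : ℝ, IntegrableOn
      (fun x : ℝ => x ^ (-(1:ℝ)/2) * exp (-(y ^ 2 / 2 * x⁻¹)) * G x) (Ioi 0))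
    (F : ℝ → ℝ)
    (hF : ∀ y, F y = ∫ x in Ioi (0:ℝ), x ^ (-(1:ℝ)/2) * exp (-(y ^ 2 / 2 * x⁻¹)) * G x)
    (y₁ y₂ : ℝ) (h1 : 0 ≤ y₁) (h12 : y₁ < y₂) (θ : ℝ) (hθ : θ ∈ Ioo (0:ℝ) 1) :
    F y₁ ^ θ * F y₂ ^ (1 - θ) ≤ F (θ * y₁ + (1 - θ) * y₂) := by
  have hnn : ∀ y, 0 ≤ F y := by
    intro y
    rw [hF]
    refine setIntegral_nonneg measurableSet_Ioi fun x hx => ?_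
    have hx0 : (0:ℝ) < x := hx
    have := hG0 x
    positivity
  have hanti : ∀ y z : ℝ, y ^ 2 ≤ z ^ 2 → F z ≤ F y := by
    intro y z h
    rw [hF, hF]
    exact core_anti G hG0 hint y z h
  obtain ⟨hθ0, hθ1⟩ := hθ
  have h2 : 0 < y₂ := h1.trans_lt h12
  set y := θ * y₁ + (1 - θ) * y₂ with hy
  have hy1 : y₁ < y := by rw [hy]; nlinarith
  have hy2 : y < y₂ := by rw [hy]; nlinarith
  have hy0 : 0 < y := by linarith
  rcases (hnn y₂).eq_or_lt with hz | hp2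
  · rw [← hz, zero_rpow (by linarith), mul_zero]; exact hnn _
  have hle : F y₂ ≤ F y₁ := hanti _ _ (by nlinarith)
  rcases hle.eq_or_lt with heq | hlt
  · rw [← heq, ← rpow_add hp2, add_sub_cancel, rpow_one]
    exact hanti _ _ (by nlinarith)
  have hp1 : 0 < F y₁ := hp2.trans hlt
  have hlog : log (F y₂) < log (F y₁) := log_lt_log hp2 hlt
  set l := (log (F y₁) - log (F y₂)) / (y₂ - y₁) with hl
  have hl0 : 0 < l := div_pos (by linarith) (by linarith)
  have hlm : l * (y₂ - y₁) = log (F y₁) - log (F y₂) := div_mul_cancel₀ _ (by linarith)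
  obtain ⟨C, hC, hlap⟩ := lap l hl0
  set c := F y₁ * exp (l * y₁) / C with hc
  have hc0 : 0 < c := by positivity
  have hcC : c * C = F y₁ * exp (l * y₁) := div_mul_cancel₀ _ hC.ne'
  have hv : ∀ u : ℝ, c * (C * exp (-(l * u))) = exp (log (F y₁) + l * y₁ - l * u) := by
    intro u
    rw [← mul_assoc, hcC, sub_eq_add_neg, exp_add, exp_add, exp_log hp1]
  have hv1 : c * (C * exp (-(l * y₁))) = F y₁ := by
    rw [hv, add_sub_cancel_right, exp_log hp1]
  have hv2 : c * (C * exp (-(l * y₂))) = F y₂ := by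
    rw [hv, show log (F y₁) + l * y₁ - l * y₂ = log (F y₂) by linarith, exp_log hp2]
  have hvy : c * (C * exp (-(l * y))) = F y₁ ^ θ * F y₂ ^ (1 - θ) := by
    rw [hv, rpow_def_of_pos hp1, rpow_def_of_pos hp2, ← exp_add]
    congr 1
    rw [hy]
    linear_combination (-(1 - θ)) * hlm
  rw [← hvy]
  -- the difference
  set k := l ^ 2 / 2
  set H : ℝ → ℝ := fun x => G x - c * exp (-(k * x)) with hH
  have hdec : ∀ u : ℝ, (fun x : ℝ => x ^ (-(1:ℝ)/2) * exp (-(u ^ 2 / 2 * x⁻¹)) * H x) =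
      fun x => x ^ (-(1:ℝ)/2) * exp (-(u ^ 2 / 2 * x⁻¹)) * G x -
        c * (x ^ (-(1:ℝ)/2) * exp (-(u ^ 2 / 2 * x⁻¹)) * exp (-(k * x))) := by
    intro u; ext x; simp only [hH]; ring
  have hHi : ∀ u : ℝ, 0 ≤ u → IntegrableOn
      (fun x : ℝ => x ^ (-(1:ℝ)/2) * exp (-(u ^ 2 / 2 * x⁻¹)) * H x) (Ioi 0) := by
    intro u hu
    rw [hdec]
    exact (hint u).sub ((hlap u hu).1.const_mul c)
  have hHv : ∀ u : ℝ, 0 ≤ u →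
      ∫ x in Ioi (0:ℝ), x ^ (-(1:ℝ)/2) * exp (-(u ^ 2 / 2 * x⁻¹)) * H x =
        F u - c * (C * exp (-(l * u))) := by
    intro u hu
    rw [hdec, integral_sub (hint u) ((hlap u hu).1.const_mul c), integral_const_mul,
      (hlap u hu).2, hF]
  obtain ⟨α, γ, -, -, hae⟩ := sign_lem ((y ^ 2 - y₁ ^ 2) / 2) ((y₂ ^ 2 - y ^ 2) / 2)
    (by nlinarith) (by nlinarith) {x : ℝ | 0 < x ∧ c * exp (-(k * x)) ≤ G x}
    (fun x hx => hx.1) (hoc c hc0 k)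
  have hI1 := hHi y₁ h1
  have hI2 := hHi y₂ h2.le
  have hmono : ∫ x in Ioi (0:ℝ),
      (α * (x ^ (-(1:ℝ)/2) * exp (-(y₁ ^ 2 / 2 * x⁻¹)) * H x) +
        γ * (x ^ (-(1:ℝ)/2) * exp (-(y₂ ^ 2 / 2 * x⁻¹)) * H x)) ≤
      ∫ x in Ioi (0:ℝ), x ^ (-(1:ℝ)/2) * exp (-(y ^ 2 / 2 * x⁻¹)) * H x := by
    refine setIntegral_mono_on_ae ((hI1.const_mul α).add (hI2.const_mul γ)) (hHi y hy0.le)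
      measurableSet_Ioi ?_
    filter_upwards [hae] with x hx hx0
    have hx0 : (0:ℝ) < x := hx0
    obtain ⟨ha, hb⟩ := hx hx0
    set φ := α * exp ((y ^ 2 - y₁ ^ 2) / 2 * x⁻¹) + γ * exp (-((y₂ ^ 2 - y ^ 2) / 2 * x⁻¹)) with hφ
    have hprod : 0 ≤ (1 - φ) * H x := by
      by_cases hm : c * exp (-(k * x)) ≤ G x
      · exact mul_nonneg (sub_nonneg.2 (ha ⟨hx0, hm⟩)) (sub_nonneg.2 hm)
      · exact mul_nonneg_of_nonpos_of_nonpos (sub_nonpos.2 (hb fun h => hm h.2))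
          (sub_nonpos.2 (not_le.1 hm).le)
    have hpos : 0 ≤ x ^ (-(1:ℝ)/2) * exp (-(y ^ 2 / 2 * x⁻¹)) := by positivity
    have key := mul_nonneg hpos hprod
    have r1 : exp (-(y₁ ^ 2 / 2 * x⁻¹)) =
        exp (-(y ^ 2 / 2 * x⁻¹)) * exp ((y ^ 2 - y₁ ^ 2) / 2 * x⁻¹) := by
      rw [← exp_add]; congr 1; ring
    have r2 : exp (-(y₂ ^ 2 / 2 * x⁻¹)) =
        exp (-(y ^ 2 / 2 * x⁻¹)) * exp (-((y₂ ^ 2 - y ^ 2) / 2 * x⁻¹)) := by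
      rw [← exp_add]; congr 1; ring
    rw [r1, r2, ← sub_nonneg]
    refine key.trans_eq ?_
    rw [hφ]; ring
  rw [integral_add (hI1.const_mul α) (hI2.const_mul γ), integral_const_mul, integral_const_mul,
    hHv _ h1, hHv _ h2.le, hHv _ hy0.le, hv1, hv2] at hmono
  linarith

lemma core_s2 (G : ℝ → ℝ) (hG0 : ∀ x, 0 ≤ G x)
    (hoc : ∀ c : ℝ, 0 < c → ∀ k : ℝ, {x : ℝ | 0 < x ∧ c * exp (-(k * x)) ≤ G x}.OrdConnected)
    (hint : ∀ y : ℝ, IntegrableOn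
      (fun x : ℝ => x ^ (-(1:ℝ)/2) * exp (-(y ^ 2 / 2 * x⁻¹)) * G x) (Ioi 0))
    (F : ℝ → ℝ)
    (hF : ∀ y, F y = ∫ x in Ioi (0:ℝ), x ^ (-(1:ℝ)/2) * exp (-(y ^ 2 / 2 * x⁻¹)) * G x)
    (y₁ y₂ : ℝ) (θ : ℝ) (hθ : θ ∈ Ioo (0:ℝ) 1) :
    F y₁ ^ θ * F y₂ ^ (1 - θ) ≤ F (θ * y₁ + (1 - θ) * y₂) := by
  have habs : ∀ y, F |y| = F y := by intro y; rw [hF, hF, sq_abs]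
  have hanti : ∀ y z : ℝ, |y| ≤ |z| → F z ≤ F y := by
    intro y z h
    rw [hF, hF]
    exact core_anti G hG0 hint y z (sq_le_sq.2 h)
  have hnn : ∀ y, 0 ≤ F y := by
    intro y
    rw [hF]
    refine setIntegral_nonneg measurableSet_Ioi fun x hx => ?_
    have hx0 : (0:ℝ) < x := hx
    have := hG0 x
    positivity
  have h1θ : 0 < 1 - θ := by linarith [hθ.2]
  have hstep : F (θ * |y₁| + (1 - θ) * |y₂|) ≤ F (θ * y₁ + (1 - θ) * y₂) := by
    apply hanti
    refine le_trans ?_ (le_abs_self _)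
    refine (abs_add_le _ _).trans_eq ?_
    rw [abs_mul, abs_mul, abs_of_pos hθ.1, abs_of_pos h1θ]
  refine le_trans ?_ hstep
  rw [← habs y₁, ← habs y₂]
  rcases lt_trichotomy |y₁| |y₂| with h | h | h
  · exact core_lt G hG0 hoc hint F hF _ _ (abs_nonneg _) h θ hθ
  · rw [h, ← add_mul, add_sub_cancel, one_mul]
    rw [← rpow_add_of_nonneg (hnn _) hθ.1.le h1θ.le, add_sub_cancel, rpow_one]
  · have := core_lt G hG0 hoc hint F hF _ _ (abs_nonneg _) h (1 - θ) ⟨h1θ, by linarith [hθ.1]⟩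
    rw [sub_sub_cancel] at this
    rw [mul_comm, add_comm]
    exact this

/-- Theorem 1(iii): if the mixing density `g` is log-concave on `(0, ∞)`, then the
mixture density `f` is log-concave on `ℝ`. -/
theorem normal_variance_mean_mixture_logConcave
    (g : ℝ → ℝ) (hg_meas : Measurable g) (hg_nonneg : ∀ x, 0 ≤ g x)
    (hg_supp : ∀ x ≤ 0, g x = 0)
    (hg_int : IntegrableOn g (Ioi 0))
    (hg_pos : 0 < ∫ x in Ioi (0:ℝ), g x)
    (μ β σ : ℝ) (hσ : 0 < σ)
    (f : ℝ → ℝ)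
    (hf : ∀ y, f y = ∫ x in Ioi (0:ℝ),
      (2 * π * σ ^ 2 * x) ^ (-(1:ℝ)/2) *
        Real.exp (-(y - μ - β * x) ^ 2 / (2 * σ ^ 2 * x)) * g x)
    (hf_int : ∀ y, IntegrableOn (fun x =>
      (2 * π * σ ^ 2 * x) ^ (-(1:ℝ)/2) *
        Real.exp (-(y - μ - β * x) ^ 2 / (2 * σ ^ 2 * x)) * g x) (Ioi 0))
    (hg_lc : ∀ x₁ ∈ Ioi (0:ℝ), ∀ x₂ ∈ Ioi (0:ℝ), ∀ θ ∈ Ioo (0:ℝ) 1,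
      g x₁ ^ θ * g x₂ ^ (1 - θ) ≤ g (θ * x₁ + (1 - θ) * x₂)) :
    ∀ y₁ y₂ : ℝ, ∀ θ ∈ Ioo (0:ℝ) 1,
      f y₁ ^ θ * f y₂ ^ (1 - θ) ≤ f (θ * y₁ + (1 - θ) * y₂) := by
  have hsπ : 0 < 2 * π * σ ^ 2 := by positivity
  set a : ℝ := (2 * π * σ ^ 2) ^ (-(1:ℝ)/2) with ha
  have ha0 : 0 < a := rpow_pos_of_pos hsπ _
  set m : ℝ := β ^ 2 / (2 * σ ^ 2) with hm
  set G : ℝ → ℝ := fun x => a * exp (-(m * x)) * g x with hG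
  have hG0 : ∀ x, 0 ≤ G x := fun x => mul_nonneg (by positivity) (hg_nonneg x)
  -- pointwise factorization
  have hpt : ∀ y : ℝ, ∀ x ∈ Ioi (0:ℝ), (2 * π * σ ^ 2 * x) ^ (-(1:ℝ)/2) *
        Real.exp (-(y - μ - β * x) ^ 2 / (2 * σ ^ 2 * x)) * g x =
      exp (β * (y - μ) / σ ^ 2) *
        (x ^ (-(1:ℝ)/2) * exp (-(((y - μ) / σ) ^ 2 / 2 * x⁻¹)) * G x) := by
    intro y x hx
    have hx0 : (0:ℝ) < x := hx
    rw [mul_rpow hsπ.le hx0.le]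
    have : exp (-(y - μ - β * x) ^ 2 / (2 * σ ^ 2 * x)) = exp (β * (y - μ) / σ ^ 2) *
        exp (-(((y - μ) / σ) ^ 2 / 2 * x⁻¹)) * exp (-(m * x)) := by
      rw [← exp_add, ← exp_add]
      congr 1
      rw [hm]
      field_simp
      ring
    rw [this]
    simp only [hG, ← ha]
    ring
  have hint : ∀ z : ℝ, IntegrableOn
      (fun x : ℝ => x ^ (-(1:ℝ)/2) * exp (-(z ^ 2 / 2 * x⁻¹)) * G x) (Ioi 0) := by
    intro z
    have h1 := ((integrableOn_congr_fun (hpt (μ + σ * z)) measurableSet_Ioi).1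
      (hf_int (μ + σ * z))).const_mul (exp (β * (μ + σ * z - μ) / σ ^ 2))⁻¹
    refine h1.congr (ae_of_all _ fun x => ?_)
    have hz : (μ + σ * z - μ) / σ = z := by field_simp; ring
    simp only [hz]
    rw [inv_mul_cancel_left₀ (exp_pos _).ne']
  have hfF : ∀ y, f y = exp (β * (y - μ) / σ ^ 2) *
      ∫ x in Ioi (0:ℝ), x ^ (-(1:ℝ)/2) * exp (-(((y - μ) / σ) ^ 2 / 2 * x⁻¹)) * G x := by
    intro y
    rw [hf, setIntegral_congr_fun measurableSet_Ioi (hpt y), integral_const_mul]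
  have hoc : ∀ c : ℝ, 0 < c → ∀ k : ℝ,
      {x : ℝ | 0 < x ∧ c * exp (-(k * x)) ≤ G x}.OrdConnected := by
    intro c hc k
    have hset : {x : ℝ | 0 < x ∧ c * exp (-(k * x)) ≤ G x} =
        {x : ℝ | 0 < x ∧ (c / a) * exp (-((k - m) * x)) ≤ g x} := by
      ext x
      simp only [mem_setOf_eq, hG]
      refine and_congr_right fun _ => ?_
      have e : exp (-((k - m) * x)) = exp (-(k * x)) / exp (-(m * x)) := by
        rw [← exp_sub]; congr 1; ring
      rw [e, div_mul_div_comm, div_le_iff₀ (by positivity), mul_comm (g x)]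
    rw [hset]
    have hca : 0 < c / a := div_pos hc ha0
    set d := c / a
    set n := k - m
    refine Convex.ordConnected ?_
    rw [convex_iff_forall_pos]
    rintro x ⟨hx, hx'⟩ z ⟨hz, hz'⟩ s t hs ht hst
    obtain rfl : t = 1 - s := by linarith
    simp only [smul_eq_mul]
    refine ⟨by positivity, le_trans ?_ (hg_lc x hx z hz s ⟨hs, by linarith⟩)⟩
    have p1 : 0 < d * exp (-(n * x)) := by positivity
    have p2 : 0 < d * exp (-(n * z)) := by positivity
    have q1 := rpow_le_rpow p1.le hx' hs.le
    have q2 := rpow_le_rpow p2.le hz' ht.le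
    refine le_trans (le_of_eq ?_) (mul_le_mul q1 q2 (by positivity)
      (rpow_nonneg (hg_nonneg _) _))
    rw [mul_rpow hca.le (exp_pos _).le, mul_rpow hca.le (exp_pos _).le, ← exp_mul, ← exp_mul,
      mul_mul_mul_comm, ← rpow_add hca, ← exp_add, add_sub_cancel, rpow_one]
    congr 2
    ring
  intro y₁ y₂ θ hθ
  set F : ℝ → ℝ := fun z =>
    ∫ x in Ioi (0:ℝ), x ^ (-(1:ℝ)/2) * exp (-(z ^ 2 / 2 * x⁻¹)) * G x with hF
  have hFnn : ∀ y, 0 ≤ F y := by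
    intro y
    refine setIntegral_nonneg measurableSet_Ioi fun x hx => ?_
    have hx0 : (0:ℝ) < x := hx
    have := hG0 x
    positivity
  have hc := core_s2 G hG0 hoc hint F (fun _ => rfl) ((y₁ - μ) / σ) ((y₂ - μ) / σ) θ hθ
  have hfF' : ∀ y, f y = exp (β * (y - μ) / σ ^ 2) * F ((y - μ) / σ) := hfF
  rw [hfF', hfF', hfF', mul_rpow (exp_pos _).le (hFnn _), mul_rpow (exp_pos _).le (hFnn _),
    ← exp_mul, ← exp_mul, mul_mul_mul_comm, ← exp_add]
  have e1 : β * (y₁ - μ) / σ ^ 2 * θ + β * (y₂ - μ) / σ ^ 2 * (1 - θ) =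
      β * (θ * y₁ + (1 - θ) * y₂ - μ) / σ ^ 2 := by ring
  have e2 : θ * ((y₁ - μ) / σ) + (1 - θ) * ((y₂ - μ) / σ) =
      (θ * y₁ + (1 - θ) * y₂ - μ) / σ := by ring
  rw [e1, ← e2]
  exact mul_le_mul_of_nonneg_left hc (exp_pos _).le
end

section
/- Let g be a nonnegative measurable function on ℝ supported on (0,∞) with 0 < ∫₀^∞ g(x) dx < ∞, let μ, β ∈ ℝ and σ > 0, and define f(y) = ∫₀^∞ (2πσ²x)^{-1/2} · exp(−(y − μ − βx)²/(2σ²x)) · g(x) dx, assumed finite for every y ∈ ℝ. If g is log-convex on (0,∞), then f is log-convex on (−∞, μ) and f is log-convex on (μ, ∞). -/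
open MeasureTheory Set Real

lemma psi_two (p q s1 s2 : ℝ) (hp : 0 < p) (hq : 0 < q) (h : s1 < s2) :
    ∃ α γ : ℝ, ∀ s, (s1 ≤ s → s ≤ s2 → α * exp (p * s) + γ * exp (-(q * s)) - 1 ≤ 0) ∧
      ((s ≤ s1 ∨ s2 ≤ s) → 0 ≤ α * exp (p * s) + γ * exp (-(q * s)) - 1) := by
  have hP : exp (p * s1) < exp (p * s2) := by gcongr
  have hQ : exp (-(q * s2)) < exp (-(q * s1)) := by gcongr
  have p1 := exp_pos (p * s1)
  have q2 := exp_pos (-(q * s2))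
  set P1 := exp (p * s1) with hP1
  set P2 := exp (p * s2) with hP2
  set Q1 := exp (-(q * s1)) with hQ1
  set Q2 := exp (-(q * s2)) with hQ2
  have hD : 0 < P2 * Q1 - P1 * Q2 := by nlinarith
  set α := (Q1 - Q2) / (P2 * Q1 - P1 * Q2) with hα
  set γ := (P2 - P1) / (P2 * Q1 - P1 * Q2) with hγ
  have hα0 : 0 ≤ α := div_nonneg (by linarith) hD.le
  have hγ0 : 0 ≤ γ := div_nonneg (by linarith) hD.le
  let ψ : ℝ → ℝ := fun s => α * exp (p * s) + γ * exp (-(q * s)) - 1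
  have e1 : ψ s1 = 0 := by
    show α * P1 + γ * Q1 - 1 = 0
    have hD' := hD.ne'
    rw [hα, hγ, div_mul_eq_mul_div, div_mul_eq_mul_div, ← add_div, sub_eq_zero, div_eq_one_iff_eq hD']
    ring
  have e2 : ψ s2 = 0 := by
    show α * P2 + γ * Q2 - 1 = 0
    have hD' := hD.ne'
    rw [hα, hγ, div_mul_eq_mul_div, div_mul_eq_mul_div, ← add_div, sub_eq_zero, div_eq_one_iff_eq hD']
    ring
  have hexp : ∀ r : ℝ, ConvexOn ℝ univ (fun s : ℝ => exp (r * s)) := fun r =>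
    convexOn_exp.comp_linearMap (LinearMap.mulLeft ℝ r)
  have hc : ConvexOn ℝ univ ψ := by
    have := (((hexp p).smul hα0).add ((hexp (-q)).smul hγ0)).add_const (-1)
    refine this.congr fun s _ => ?_
    simp [ψ, sub_eq_add_neg]
  refine ⟨α, γ, fun s => ⟨fun h1 h2 => ?_, ?_⟩⟩
  · have := hc.le_max_of_mem_Icc (mem_univ s1) (mem_univ s2) ⟨h1, h2⟩
    rw [e1, e2, max_self] at this; exact this
  · rintro (h1 | h2)
    · rcases h1.eq_or_lt with rfl | h1
      · exact e1.ge
      have := hc.le_left_of_right_le (mem_univ s) (mem_univ s2) (z := s1)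
        (by rw [openSegment_eq_Ioo (h1.trans h)]; exact ⟨h1, h⟩) (by rw [e1, e2])
      rw [e1] at this; exact this
    · rcases h2.eq_or_lt with rfl | h2
      · exact e2.ge
      have := hc.le_right_of_left_le (mem_univ s1) (mem_univ s) (z := s2)
        (by rw [openSegment_eq_Ioo (h.trans h2)]; exact ⟨h, h2⟩) (by rw [e1, e2])
      rw [e2] at this; exact this

lemma sign_lemma (N : Set ℝ) (hN : N.OrdConnected) (hN0 : N ⊆ Ioi 0) (p q : ℝ) (hp : 0 < p)
    (hq : 0 < q) : ∃ α γ : ℝ, ∀ᵐ x ∂(volume.restrict (Ioi (0:ℝ))),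
      (x ∈ N → α * exp (p * x⁻¹) + γ * exp (-(q * x⁻¹)) - 1 ≤ 0) ∧
      (x ∉ N → 0 ≤ α * exp (p * x⁻¹) + γ * exp (-(q * x⁻¹)) - 1) := by
  by_cases hs : N.Subsingleton
  · refine ⟨1, 0, ?_⟩
    have h1 : ∀ᵐ x ∂(volume.restrict (Ioi (0:ℝ))), x ∉ N :=
      ae_restrict_of_ae (measure_eq_zero_iff_ae_notMem.1 (hs.measure_zero volume))
    filter_upwards [h1, ae_restrict_mem measurableSet_Ioi] with x hx hx0
    refine ⟨fun h => absurd h hx, fun _ => ?_⟩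
    have : 0 < x := hx0
    have := one_le_exp (show 0 ≤ p * x⁻¹ by positivity)
    linarith
  rw [Set.not_subsingleton_iff] at hs
  obtain ⟨a, ha, b, hb, hab⟩ := hs.exists_lt
  have hbb : BddBelow N := ⟨0, fun x hx => (hN0 hx).le⟩
  have hne : N.Nonempty := ⟨a, ha⟩
  have hi0 : 0 ≤ sInf N := le_csInf hne fun x hx => (hN0 hx).le
  have ha0 : 0 < a := hN0 ha
  have hia : sInf N ≤ a := csInf_le hbb ha
  -- below/above
  have hmem : ∀ x, x ∉ N → sInf N < x → ∀ y ∈ N, y ≤ x := by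
    intro x hx hlt y hy
    by_contra hxy
    push Not at hxy
    obtain ⟨z, hz, hzx⟩ := exists_lt_of_csInf_lt hne hlt
    exact hx (hN.out hz hy ⟨hzx.le, hxy.le⟩)
  by_cases hba : BddAbove N
  · have hsb : b ≤ sSup N := le_csSup hba hb
    have hsup : ∀ x, x ∉ N → sInf N < x → sSup N ≤ x := fun x hx hlt =>
      csSup_le hne (hmem x hx hlt)
    have hs0 : 0 < sSup N := by linarith
    rcases hi0.eq_or_lt with h0 | h0
    · refine ⟨0, exp (q * (sSup N)⁻¹), ?_⟩
      filter_upwards [ae_restrict_mem measurableSet_Ioi] with x hx0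
      have hx0' : 0 < x := hx0
      rw [zero_mul, zero_add, ← exp_add]
      refine ⟨fun h => ?_, fun h => ?_⟩
      · have h2 : (sSup N)⁻¹ ≤ x⁻¹ := inv_anti₀ hx0' (le_csSup hba h)
        have : exp (q * (sSup N)⁻¹ + -(q * x⁻¹)) ≤ 1 := exp_le_one_iff.2 (by nlinarith)
        linarith
      · have h2 : x⁻¹ ≤ (sSup N)⁻¹ := inv_anti₀ hs0 (hsup x h (by rw [← h0]; exact hx0'))
        have := one_le_exp (show 0 ≤ q * (sSup N)⁻¹ + -(q * x⁻¹) by nlinarith)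
        linarith
    · obtain ⟨α, γ, H⟩ := psi_two p q (sSup N)⁻¹ (sInf N)⁻¹ hp hq
        (inv_strictAnti₀ h0 (by linarith))
      refine ⟨α, γ, ?_⟩
      filter_upwards [ae_restrict_mem measurableSet_Ioi] with x hx0
      have hx0' : 0 < x := hx0
      refine ⟨fun h => (H _).1 (inv_anti₀ hx0' (le_csSup hba h)) (inv_anti₀ h0 (csInf_le hbb h)),
        fun h => (H _).2 ?_⟩
      rcases le_or_gt x (sInf N) with h1 | h1
      · exact Or.inr (inv_anti₀ hx0' h1)
      · exact Or.inl (inv_anti₀ hs0 (hsup x h h1))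
  · have hnm : ∀ x, x ∉ N → x ≤ sInf N := by
      intro x hx
      by_contra hlt
      push Not at hlt
      exact hba ⟨x, hmem x hx hlt⟩
    rcases hi0.eq_or_lt with h0 | h0
    · refine ⟨0, 0, ?_⟩
      filter_upwards [ae_restrict_mem measurableSet_Ioi] with x hx0
      have hx0' : 0 < x := hx0
      refine ⟨fun h => by norm_num, fun h => ?_⟩
      have := hnm x h
      linarith
    · refine ⟨exp (-(p * (sInf N)⁻¹)), 0, ?_⟩
      filter_upwards [ae_restrict_mem measurableSet_Ioi] with x hx0
      have hx0' : 0 < x := hx0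
      rw [zero_mul, add_zero, ← exp_add]
      refine ⟨fun h => ?_, fun h => ?_⟩
      · have h2 : x⁻¹ ≤ (sInf N)⁻¹ := inv_anti₀ h0 (csInf_le hbb h)
        have : exp (-(p * (sInf N)⁻¹) + p * x⁻¹) ≤ 1 := exp_le_one_iff.2 (by nlinarith)
        linarith
      · have h2 : (sInf N)⁻¹ ≤ x⁻¹ := inv_anti₀ hx0' (hnm x h)
        have := one_le_exp (show 0 ≤ -(p * (sInf N)⁻¹) + p * x⁻¹ by nlinarith)
        linarith

lemma gauss_aux (m u : ℝ) (hm : 0 < m) (hu : 0 < u) :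
    ∫ s in Ioi (0:ℝ), exp (-(m * s - u / s) ^ 2) = √π / (2 * m) := by
  let S : ℝ → ℝ := fun s => m * s - u / s
  let F : ℝ → ℝ := fun t => exp (-t ^ 2)
  have hd : ∀ x ∈ Ioi (0:ℝ), HasDerivWithinAt S (m + u / x ^ 2) (Ioi 0) x := by
    intro x hx
    have hx0 : x ≠ 0 := (ne_of_gt hx)
    have := (((hasDerivAt_id x).const_mul m).sub ((hasDerivAt_inv hx0).const_mul u)).hasDerivWithinAt
      (s := Ioi (0:ℝ))
    refine (this.congr_deriv ?_).congr_of_mem ?_ hx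
    · simp; ring
    · intro y _; simp [S, div_eq_mul_inv]
  have hmono : StrictMonoOn S (Ioi 0) := by
    intro a ha b hb hab
    have ha' : 0 < a := ha
    have h1 : u / b < u / a := by gcongr
    have : m * a < m * b := by gcongr
    simp only [S]; linarith
  have himg : S '' Ioi 0 = univ := by
    refine eq_univ_of_forall fun t => ?_
    have hr : t ^ 2 < t ^ 2 + 4 * m * u := by nlinarith [mul_pos hm hu]
    have h1 : |t| < √(t ^ 2 + 4 * m * u) := by
      rw [← sqrt_sq_eq_abs]; exact sqrt_lt_sqrt (sq_nonneg t) hr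
    have h2 := neg_abs_le t
    have h3 : √(t ^ 2 + 4 * m * u) ^ 2 = t ^ 2 + 4 * m * u := sq_sqrt (by nlinarith [sq_nonneg t])
    set r := √(t ^ 2 + 4 * m * u)
    have h4 : 0 < t + r := by linarith
    refine ⟨(t + r) / (2 * m), div_pos h4 (by positivity), ?_⟩
    simp only [S]
    field_simp
    nlinarith
  have hFi : Integrable F := by
    have := integrable_exp_neg_mul_sq (b := 1) one_pos
    simpa [F] using this
  have hFv : ∫ t, F t = √π := by
    have := integral_gaussian 1
    simpa [F] using this
  have hpos : ∀ x ∈ Ioi (0:ℝ), |m + u / x ^ 2| = m + u / x ^ 2 := fun x hx => by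
    have : 0 < x := hx
    exact abs_of_pos (by positivity)
  have hI := (integrableOn_image_iff_integrableOn_abs_deriv_smul measurableSet_Ioi hd
    hmono.injOn F).1 (by rw [himg]; exact hFi.integrableOn)
  have hV := integral_image_eq_integral_abs_deriv_smul measurableSet_Ioi hd hmono.injOn F
  rw [himg, setIntegral_univ, hFv] at hV
  have hmeas : Measurable (fun s => F (S s)) := by fun_prop
  have hI1 : IntegrableOn (fun s => m * F (S s)) (Ioi 0) := by
    refine Integrable.mono' hI (by fun_prop) ?_
    filter_upwards [ae_restrict_mem measurableSet_Ioi] with x hx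
    have hx' : 0 < x := hx
    have hF : 0 < F (S x) := exp_pos _
    rw [hpos x hx, norm_eq_abs, abs_of_pos (by positivity), smul_eq_mul]
    have : 0 ≤ u / x ^ 2 := by positivity
    gcongr; linarith
  have hI2 : IntegrableOn (fun s => u / s ^ 2 * F (S s)) (Ioi 0) := by
    refine (Integrable.sub hI hI1).congr ?_
    filter_upwards [ae_restrict_mem measurableSet_Ioi] with x hx
    simp only [Pi.sub_apply, hpos x hx, smul_eq_mul]; ring
  have hinv : ∫ s in Ioi (0:ℝ), m * F (S s) = ∫ s in Ioi (0:ℝ), u / s ^ 2 * F (S s) := by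
    let T : ℝ → ℝ := fun s => (u / m) * s⁻¹
    have hTd : ∀ x ∈ Ioi (0:ℝ), HasDerivWithinAt T ((u / m) * (-(x ^ 2)⁻¹)) (Ioi 0) x := by
      intro x hx
      exact ((hasDerivAt_inv (ne_of_gt hx)).const_mul _).hasDerivWithinAt
    have hTi : InjOn T (Ioi 0) := by
      intro a _ b _ h
      have : u / m ≠ 0 := by positivity
      exact inv_injective (mul_left_cancel₀ this h)
    have hTimg : T '' Ioi 0 = Ioi 0 := by
      ext t; constructor
      · rintro ⟨s, hs, rfl⟩
        have : 0 < s := hs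
        show 0 < u / m * s⁻¹
        positivity
      · intro ht
        have : 0 < t := ht
        refine ⟨(u / m) * t⁻¹, (by show 0 < u / m * t⁻¹; positivity), ?_⟩
        simp only [T]; field_simp
    have := integral_image_eq_integral_abs_deriv_smul measurableSet_Ioi hTd hTi
      (fun s => m * F (S s))
    rw [hTimg] at this
    rw [this]
    refine setIntegral_congr_fun measurableSet_Ioi fun x hx => ?_
    have hx' : 0 < x := hx
    have e : S (T x) = - S x := by simp only [S, T]; field_simp; ring
    have e2 : |u / m * -(x ^ 2)⁻¹| = u / m * (x ^ 2)⁻¹ := by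
      rw [mul_neg, abs_neg, abs_of_pos (by positivity)]
    simp only [e, e2, F, neg_sq, smul_eq_mul]
    field_simp
  have hsum : √π = (∫ s in Ioi (0:ℝ), m * F (S s)) + ∫ s in Ioi (0:ℝ), u / s ^ 2 * F (S s) := by
    rw [hV, ← integral_add hI1 hI2]
    refine setIntegral_congr_fun measurableSet_Ioi fun x hx => ?_
    simp only [hpos x hx, smul_eq_mul]; ring
  rw [← hinv, integral_const_mul] at hsum
  rw [eq_div_iff (by positivity)]
  change (∫ s in Ioi (0:ℝ), F (S s)) * (2 * m) = √π
  linarith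

lemma kernel_exp (m u : ℝ) (hm : 0 < m) (hu : 0 < u) :
    ∫ x in Ioi (0:ℝ), x ^ (-(1:ℝ)/2) * exp (-(u ^ 2 * x⁻¹)) * exp (-(m ^ 2 * x)) =
      √π / m * exp (-(2 * u * m)) := by
  rw [← integral_comp_rpow_Ioi_of_pos (p := 2) two_pos]
  have : ∀ s ∈ Ioi (0:ℝ), ((2:ℝ) * s ^ ((2:ℝ) - 1)) • ((s ^ (2:ℝ)) ^ (-(1:ℝ)/2) *
      exp (-(u ^ 2 * (s ^ (2:ℝ))⁻¹)) * exp (-(m ^ 2 * s ^ (2:ℝ)))) =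
      (2 * exp (-(2 * u * m))) * exp (-(m * s - u / s) ^ 2) := by
    intro s hs
    have hs' : 0 < s := hs
    have e1 : (s ^ (2:ℝ)) ^ (-(1:ℝ)/2) = s⁻¹ := by
      rw [← rpow_mul hs'.le, ← rpow_neg_one]; norm_num
    have e2 : s ^ ((2:ℝ) - 1) = s := by norm_num
    rw [e1, e2, rpow_two, smul_eq_mul]
    have : exp (-(u ^ 2 * (s ^ 2)⁻¹)) * exp (-(m ^ 2 * s ^ 2)) =
        exp (-(2 * u * m)) * exp (-(m * s - u / s) ^ 2) := by
      rw [← exp_add, ← exp_add]; congr 1; field_simp; ring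
    calc _ = 2 * (s * s⁻¹) * (exp (-(u ^ 2 * (s ^ 2)⁻¹)) * exp (-(m ^ 2 * s ^ 2))) := by ring
      _ = _ := by rw [this, mul_inv_cancel₀ hs'.ne']; ring
  rw [setIntegral_congr_fun measurableSet_Ioi this, integral_const_mul, gauss_aux m u hm hu]
  field_simp

lemma kernel_exp_int (m u : ℝ) (hm : 0 < m) (hu : 0 < u) :
    IntegrableOn (fun x => x ^ (-(1:ℝ)/2) * exp (-(u ^ 2 * x⁻¹)) * exp (-(m ^ 2 * x))) (Ioi 0) := by
  apply Integrable.of_integral_ne_zero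
  rw [kernel_exp m u hm hu]
  have := pi_pos
  positivity

lemma core_pos (w : ℝ → ℝ) (hw : ∀ x ∈ Ioi (0:ℝ), 0 < w x) (hi : IntegrableOn w (Ioi 0)) :
    0 < ∫ x in Ioi (0:ℝ), w x := by
  rw [setIntegral_pos_iff_support_of_nonneg_ae ?_ hi]
  · have : Function.support w ∩ Ioi 0 = Ioi 0 := by
      ext x; simp only [mem_inter_iff, Function.mem_support, and_iff_right_iff_imp]
      exact fun hx => (hw x hx).ne'
    rw [this]; simp
  · filter_upwards [ae_restrict_mem measurableSet_Ioi] with x hx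
    exact (hw x hx).le

lemma core_lt_s3 (G : ℝ → ℝ) (hG : ∀ x ∈ Ioi (0:ℝ), 0 < G x)
    (hGl : ∀ x₁ ∈ Ioi (0:ℝ), ∀ x₂ ∈ Ioi (0:ℝ), ∀ θ ∈ Ioo (0:ℝ) 1,
      G (θ * x₁ + (1 - θ) * x₂) ≤ G x₁ ^ θ * G x₂ ^ (1 - θ))
    (K : ℝ → ℝ)
    (hK : ∀ u, K u = ∫ x in Ioi (0:ℝ), x ^ (-(1:ℝ)/2) * exp (-(u ^ 2 * x⁻¹)) * G x)
    (hI : ∀ u : ℝ, IntegrableOn (fun x => x ^ (-(1:ℝ)/2) * exp (-(u ^ 2 * x⁻¹)) * G x) (Ioi 0))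
    (hKpos : ∀ u, 0 < K u)
    (u₁ u₂ θ : ℝ) (h1 : 0 < u₁) (h12 : u₁ < u₂) (hθ : θ ∈ Ioo (0:ℝ) 1) :
    K (θ * u₁ + (1 - θ) * u₂) ≤ K u₁ ^ θ * K u₂ ^ (1 - θ) := by
  obtain ⟨hθ0, hθ1⟩ := hθ
  set u₀ := θ * u₁ + (1 - θ) * u₂ with hu₀
  have h10 : u₁ < u₀ := by nlinarith
  have h02 : u₀ < u₂ := by nlinarith
  have hKlt : K u₂ < K u₁ := by
    rw [← sub_pos, hK u₁, hK u₂, ← integral_sub (hI _) (hI _)]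
    refine core_pos _ (fun x hx => ?_) ((hI _).sub (hI _))
    have hx' : 0 < x := hx
    have hG' := hG x hx
    have : u₁ ^ 2 * x⁻¹ < u₂ ^ 2 * x⁻¹ := by gcongr
    have : exp (-(u₂ ^ 2 * x⁻¹)) < exp (-(u₁ ^ 2 * x⁻¹)) := by gcongr
    rw [sub_pos]
    have : 0 < x ^ (-(1:ℝ)/2) := rpow_pos_of_pos hx' _
    gcongr
  have hlog := log_lt_log (hKpos u₂) hKlt
  set m := (log (K u₁) - log (K u₂)) / (2 * (u₂ - u₁)) with hm
  have hm0 : 0 < m := div_pos (by linarith) (by linarith)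
  have hmm : log (K u₁) - log (K u₂) = 2 * (u₂ - u₁) * m := by
    have : u₂ - u₁ ≠ 0 := by linarith
    rw [hm]; field_simp
  have hpi := sqrt_pos.2 pi_pos
  set A := K u₁ * exp (2 * u₁ * m) * m / √π with hA
  have hA0 : 0 < A := by have := hKpos u₁; positivity
  set E : ℝ → ℝ := fun u => A * (√π / m * exp (-(2 * u * m))) with hE
  have hE' : ∀ u, E u = K u₁ * exp (2 * (u₁ - u) * m) := by
    intro u
    have : exp (2 * (u₁ - u) * m) = exp (2 * u₁ * m) * exp (-(2 * u * m)) := by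
      rw [← exp_add]; congr 1; ring
    rw [this]; simp only [hE, hA]; field_simp
  have hE1 : E u₁ = K u₁ := by rw [hE']; simp
  have hE2 : E u₂ = K u₂ := by
    rw [hE', ← exp_log (hKpos u₁), ← exp_add, ← exp_log (hKpos u₂)]
    congr 1; linarith
  have hE0 : E u₀ = K u₁ ^ θ * K u₂ ^ (1 - θ) := by
    rw [hE', rpow_def_of_pos (hKpos u₁), rpow_def_of_pos (hKpos u₂), ← exp_add]
    nth_rewrite 1 [← exp_log (hKpos u₁)]
    rw [← exp_add]; congr 1
    rw [hu₀]
    linear_combination (1 - θ) * hmm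
  -- difference
  have hJ : ∀ u, 0 < u → IntegrableOn (fun x => x ^ (-(1:ℝ)/2) * exp (-(u ^ 2 * x⁻¹)) *
      (G x - A * exp (-(m ^ 2 * x)))) (Ioi 0) := by
    intro u hu
    refine ((hI u).sub ((kernel_exp_int m u hm0 hu).const_mul A)).congr ?_
    refine Filter.Eventually.of_forall fun x => ?_
    simp only [Pi.sub_apply]; ring
  have hJv : ∀ u, 0 < u → ∫ x in Ioi (0:ℝ), x ^ (-(1:ℝ)/2) * exp (-(u ^ 2 * x⁻¹)) *
      (G x - A * exp (-(m ^ 2 * x))) = K u - E u := by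
    intro u hu
    rw [hK u, hE]
    simp only
    rw [← kernel_exp m u hm0 hu, ← integral_const_mul,
      ← integral_sub (hI u) ((kernel_exp_int m u hm0 hu).const_mul A)]
    congr 1; ext x; ring
  set N : Set ℝ := {x | 0 < x ∧ G x < A * exp (-(m ^ 2 * x))} with hN
  have hNc : N.OrdConnected := by
    refine Convex.ordConnected ?_
    intro x hx y hy a b ha hb hab
    rcases ha.eq_or_lt with rfl | ha
    · have : b = 1 := by linarith
      subst this; simpa using hy
    rcases hb.eq_or_lt with rfl | hb
    · have : a = 1 := by linarith
      subst this; simpa using hx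
    have hb' : b = 1 - a := by linarith
    obtain ⟨hx0, hx⟩ := hx
    obtain ⟨hy0, hy⟩ := hy
    simp only [smul_eq_mul]
    refine ⟨by positivity, ?_⟩
    have hle := hGl x hx0 y hy0 a ⟨ha, by linarith⟩
    rw [← hb'] at hle
    refine hle.trans_lt ?_
    have hgx := hG x hx0
    have hgy := hG y hy0
    calc G x ^ a * G y ^ b < (A * exp (-(m ^ 2 * x))) ^ a * (A * exp (-(m ^ 2 * y))) ^ b := by
          gcongr
      _ = A * exp (-(m ^ 2 * (a * x + b * y))) := by
          rw [mul_rpow hA0.le (exp_pos _).le, mul_rpow hA0.le (exp_pos _).le, ← exp_mul, ← exp_mul,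
            mul_mul_mul_comm, ← rpow_add hA0, hab, rpow_one, ← exp_add]
          congr 2; ring
  obtain ⟨α, γ, H⟩ := sign_lemma N hNc (fun x hx => hx.1) (u₀ ^ 2 - u₁ ^ 2) (u₂ ^ 2 - u₀ ^ 2)
    (by nlinarith) (by nlinarith)
  have h0 : 0 < u₀ := by linarith
  have h2 : 0 < u₂ := by linarith
  have key : 0 ≤ ∫ x in Ioi (0:ℝ),
      (α * (x ^ (-(1:ℝ)/2) * exp (-(u₁ ^ 2 * x⁻¹)) * (G x - A * exp (-(m ^ 2 * x)))) +
      γ * (x ^ (-(1:ℝ)/2) * exp (-(u₂ ^ 2 * x⁻¹)) * (G x - A * exp (-(m ^ 2 * x)))) -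
      x ^ (-(1:ℝ)/2) * exp (-(u₀ ^ 2 * x⁻¹)) * (G x - A * exp (-(m ^ 2 * x)))) := by
    refine integral_nonneg_of_ae ?_
    filter_upwards [H, ae_restrict_mem measurableSet_Ioi] with x hx hx0
    have hx' : 0 < x := hx0
    have hr : 0 < x ^ (-(1:ℝ)/2) := rpow_pos_of_pos hx' _
    have e1 : exp (-(u₁ ^ 2 * x⁻¹)) = exp (-(u₀ ^ 2 * x⁻¹)) * exp ((u₀ ^ 2 - u₁ ^ 2) * x⁻¹) := by
      rw [← exp_add]; congr 1; ring
    have e2 : exp (-(u₂ ^ 2 * x⁻¹)) =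
        exp (-(u₀ ^ 2 * x⁻¹)) * exp (-((u₂ ^ 2 - u₀ ^ 2) * x⁻¹)) := by
      rw [← exp_add]; congr 1; ring
    rw [e1, e2]
    set D := G x - A * exp (-(m ^ 2 * x)) with hD
    set P := α * exp ((u₀ ^ 2 - u₁ ^ 2) * x⁻¹) + γ * exp (-((u₂ ^ 2 - u₀ ^ 2) * x⁻¹)) - 1 with hP
    have hPD : 0 ≤ P * D := by
      by_cases hxN : x ∈ N
      · exact mul_nonneg_of_nonpos_of_nonpos (hx.1 hxN) (by have := hxN.2; linarith)
      · refine mul_nonneg (hx.2 hxN) ?_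
        by_contra hlt
        exact hxN ⟨hx', by linarith⟩
    have : 0 ≤ x ^ (-(1:ℝ)/2) * exp (-(u₀ ^ 2 * x⁻¹)) * (P * D) := by positivity
    refine this.trans_eq ?_
    rw [hP]; ring
  have hadd : IntegrableOn (fun x : ℝ =>
      α * (x ^ (-(1:ℝ)/2) * exp (-(u₁ ^ 2 * x⁻¹)) * (G x - A * exp (-(m ^ 2 * x)))) +
      γ * (x ^ (-(1:ℝ)/2) * exp (-(u₂ ^ 2 * x⁻¹)) * (G x - A * exp (-(m ^ 2 * x))))) (Ioi 0) :=
    ((hJ _ h1).const_mul α).add ((hJ _ h2).const_mul γ)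
  rw [integral_sub hadd (hJ _ h0),
    integral_add ((hJ _ h1).const_mul α) ((hJ _ h2).const_mul γ), integral_const_mul,
    integral_const_mul, hJv _ h1, hJv _ h2, hJv _ h0, hE1, hE2, hE0] at key
  linarith

lemma core_s3 (G : ℝ → ℝ) (hG : ∀ x ∈ Ioi (0:ℝ), 0 < G x)
    (hGl : ∀ x₁ ∈ Ioi (0:ℝ), ∀ x₂ ∈ Ioi (0:ℝ), ∀ θ ∈ Ioo (0:ℝ) 1,
      G (θ * x₁ + (1 - θ) * x₂) ≤ G x₁ ^ θ * G x₂ ^ (1 - θ))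
    (K : ℝ → ℝ)
    (hK : ∀ u, K u = ∫ x in Ioi (0:ℝ), x ^ (-(1:ℝ)/2) * exp (-(u ^ 2 * x⁻¹)) * G x)
    (hI : ∀ u : ℝ, IntegrableOn (fun x => x ^ (-(1:ℝ)/2) * exp (-(u ^ 2 * x⁻¹)) * G x) (Ioi 0)) :
    (∀ u, 0 < K u) ∧ ∀ u₁ u₂ θ : ℝ, 0 < u₁ → 0 < u₂ → θ ∈ Ioo (0:ℝ) 1 →
    K (θ * u₁ + (1 - θ) * u₂) ≤ K u₁ ^ θ * K u₂ ^ (1 - θ) := by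
  have hKpos : ∀ u, 0 < K u := by
    intro u
    rw [hK u]
    refine core_pos _ (fun x hx => ?_) (hI u)
    have hx' : 0 < x := hx
    have hr : 0 < x ^ (-(1:ℝ)/2) := rpow_pos_of_pos hx' _
    have := hG x hx
    positivity
  refine ⟨hKpos, fun u₁ u₂ θ h1 h2 hθ => ?_⟩
  rcases lt_trichotomy u₁ u₂ with h | h | h
  · exact core_lt_s3 G hG hGl K hK hI hKpos u₁ u₂ θ h1 h hθ
  · subst h
    rw [← rpow_add (hKpos _)]
    ring_nf; simp
  · have := core_lt_s3 G hG hGl K hK hI hKpos u₂ u₁ (1 - θ) h2 h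
      ⟨by linarith [hθ.2], by linarith [hθ.1]⟩
    rw [sub_sub_cancel, add_comm, mul_comm (K u₂ ^ _)] at this
    exact this

/-- Theorem 1(iv): if the mixing density `g` is log-convex on `(0, ∞)`, then the
mixture density `f` is log-convex on each of `(-∞, μ)` and `(μ, ∞)`. -/
theorem normal_variance_mean_mixture_logConvex
    (g : ℝ → ℝ) (hg_meas : Measurable g) (hg_nonneg : ∀ x, 0 ≤ g x)
    (hg_supp : ∀ x ≤ 0, g x = 0)
    (hg_int : IntegrableOn g (Ioi 0))
    (hg_pos : 0 < ∫ x in Ioi (0:ℝ), g x)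
    (μ β σ : ℝ) (hσ : 0 < σ)
    (f : ℝ → ℝ)
    (hf : ∀ y, f y = ∫ x in Ioi (0:ℝ),
      (2 * π * σ ^ 2 * x) ^ (-(1:ℝ)/2) *
        Real.exp (-(y - μ - β * x) ^ 2 / (2 * σ ^ 2 * x)) * g x)
    (hf_int : ∀ y, IntegrableOn (fun x =>
      (2 * π * σ ^ 2 * x) ^ (-(1:ℝ)/2) *
        Real.exp (-(y - μ - β * x) ^ 2 / (2 * σ ^ 2 * x)) * g x) (Ioi 0))
    (hg_pos' : ∀ x ∈ Ioi (0:ℝ), 0 < g x)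
    (hg_lcx : ∀ x₁ ∈ Ioi (0:ℝ), ∀ x₂ ∈ Ioi (0:ℝ), ∀ θ ∈ Ioo (0:ℝ) 1,
      g (θ * x₁ + (1 - θ) * x₂) ≤ g x₁ ^ θ * g x₂ ^ (1 - θ)) :
    ((∀ y ∈ Iio μ, 0 < f y) ∧
      (∀ y₁ ∈ Iio μ, ∀ y₂ ∈ Iio μ, ∀ θ ∈ Ioo (0:ℝ) 1,
        f (θ * y₁ + (1 - θ) * y₂) ≤ f y₁ ^ θ * f y₂ ^ (1 - θ))) ∧
    ((∀ y ∈ Ioi μ, 0 < f y) ∧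
      (∀ y₁ ∈ Ioi μ, ∀ y₂ ∈ Ioi μ, ∀ θ ∈ Ioo (0:ℝ) 1,
        f (θ * y₁ + (1 - θ) * y₂) ≤ f y₁ ^ θ * f y₂ ^ (1 - θ))) := by
  have hs2 : 0 < √2 * σ := by positivity
  set G : ℝ → ℝ := fun x => exp (-(β ^ 2 / (2 * σ ^ 2) * x)) * g x with hGdef
  set C : ℝ := (2 * π * σ ^ 2) ^ (-(1:ℝ)/2) with hC
  have hC0 : 0 < C := rpow_pos_of_pos (by positivity) _
  have hpt : ∀ y, ∀ x ∈ Ioi (0:ℝ), (2 * π * σ ^ 2 * x) ^ (-(1:ℝ)/2) *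
        Real.exp (-(y - μ - β * x) ^ 2 / (2 * σ ^ 2 * x)) * g x =
      (C * exp (β * (y - μ) / σ ^ 2)) *
        (x ^ (-(1:ℝ)/2) * exp (-(((y - μ) / (√2 * σ)) ^ 2 * x⁻¹)) * G x) := by
    intro y x hx
    have hx' : 0 < x := hx
    have e : exp (-(y - μ - β * x) ^ 2 / (2 * σ ^ 2 * x)) = exp (β * (y - μ) / σ ^ 2) *
        exp (-(((y - μ) / (√2 * σ)) ^ 2 * x⁻¹)) * exp (-(β ^ 2 / (2 * σ ^ 2) * x)) := by
      rw [← exp_add, ← exp_add, div_pow, mul_pow, sq_sqrt (by norm_num : (0:ℝ) ≤ 2)]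
      congr 1; field_simp; ring
    rw [mul_rpow (by positivity) hx'.le, e]
    simp only [hGdef]; ring
  set K : ℝ → ℝ := fun u => ∫ x in Ioi (0:ℝ), x ^ (-(1:ℝ)/2) * exp (-(u ^ 2 * x⁻¹)) * G x with hKdef
  have hI : ∀ u : ℝ, IntegrableOn (fun x => x ^ (-(1:ℝ)/2) * exp (-(u ^ 2 * x⁻¹)) * G x)
      (Ioi 0) := by
    intro u
    have h := (hf_int (μ + u * (√2 * σ))).congr_fun (hpt _) measurableSet_Ioi
    have e : (μ + u * (√2 * σ) - μ) / (√2 * σ) = u := by field_simp; ring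
    rw [e] at h
    have hne : C * exp (β * (μ + u * (√2 * σ) - μ) / σ ^ 2) ≠ 0 := by positivity
    exact (integrable_const_mul_iff (IsUnit.mk0 _ hne) _).1 h
  have hfK : ∀ y, f y = C * exp (β * (y - μ) / σ ^ 2) * K ((y - μ) / (√2 * σ)) := by
    intro y
    rw [hf, setIntegral_congr_fun measurableSet_Ioi (hpt y), integral_const_mul]
  have hKneg : ∀ u, K (-u) = K u := by
    intro u; simp only [hKdef, neg_sq]
  obtain ⟨hKpos, hKl⟩ := core_s3 G (fun x hx => mul_pos (exp_pos _) (hg_pos' x hx)) (by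
    intro x₁ h1 x₂ h2 θ hθ
    have g1 := hg_pos' x₁ h1
    have g2 := hg_pos' x₂ h2
    simp only [hGdef]
    rw [mul_rpow (exp_pos _).le g1.le, mul_rpow (exp_pos _).le g2.le, ← exp_mul, ← exp_mul,
      mul_mul_mul_comm, ← exp_add]
    have e : -(β ^ 2 / (2 * σ ^ 2) * x₁) * θ + -(β ^ 2 / (2 * σ ^ 2) * x₂) * (1 - θ) =
      -(β ^ 2 / (2 * σ ^ 2) * (θ * x₁ + (1 - θ) * x₂)) := by ring
    rw [e]
    exact mul_le_mul_of_nonneg_left (hg_lcx x₁ h1 x₂ h2 θ hθ) (exp_pos _).le) K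
    (fun u => rfl) hI
  have hfpos : ∀ y, 0 < f y := by
    intro y; rw [hfK]; have := hKpos ((y - μ) / (√2 * σ)); positivity
  have hfinal : ∀ y₁ y₂ θ : ℝ, θ ∈ Ioo (0:ℝ) 1 →
      K ((θ * y₁ + (1 - θ) * y₂ - μ) / (√2 * σ)) ≤
        K ((y₁ - μ) / (√2 * σ)) ^ θ * K ((y₂ - μ) / (√2 * σ)) ^ (1 - θ) →
      f (θ * y₁ + (1 - θ) * y₂) ≤ f y₁ ^ θ * f y₂ ^ (1 - θ) := by
    intro y₁ y₂ θ hθ h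
    have k1 := hKpos ((y₁ - μ) / (√2 * σ))
    have k2 := hKpos ((y₂ - μ) / (√2 * σ))
    rw [hfK, hfK y₁, hfK y₂, mul_rpow (by positivity) k1.le, mul_rpow (by positivity) k2.le,
      mul_mul_mul_comm, mul_rpow hC0.le (exp_pos _).le, mul_rpow hC0.le (exp_pos _).le,
      mul_mul_mul_comm (C ^ θ), ← rpow_add hC0, ← exp_mul, ← exp_mul, ← exp_add]
    have e : β * (y₁ - μ) / σ ^ 2 * θ + β * (y₂ - μ) / σ ^ 2 * (1 - θ) =
      β * (θ * y₁ + (1 - θ) * y₂ - μ) / σ ^ 2 := by ring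
    rw [e, add_sub_cancel, rpow_one]
    exact mul_le_mul_of_nonneg_left h (by positivity)
  refine ⟨⟨fun y _ => hfpos y, fun y₁ h1 y₂ h2 θ hθ => hfinal y₁ y₂ θ hθ ?_⟩,
    ⟨fun y _ => hfpos y, fun y₁ h1 y₂ h2 θ hθ => hfinal y₁ y₂ θ hθ ?_⟩⟩
  · have h1' : y₁ < μ := h1
    have h2' : y₂ < μ := h2
    have := hKl (-((y₁ - μ) / (√2 * σ))) (-((y₂ - μ) / (√2 * σ))) θ
      (neg_pos.2 (div_neg_of_neg_of_pos (by linarith) hs2))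
      (neg_pos.2 (div_neg_of_neg_of_pos (by linarith) hs2)) hθ
    rw [hKneg, hKneg] at this
    rw [← hKneg]
    refine le_of_eq_of_le ?_ this
    congr 1; ring
  · have h1' : μ < y₁ := h1
    have h2' : μ < y₂ := h2
    have := hKl ((y₁ - μ) / (√2 * σ)) ((y₂ - μ) / (√2 * σ)) θ
      (div_pos (by linarith) hs2) (div_pos (by linarith) hs2) hθ
    refine le_of_eq_of_le ?_ this
    congr 1; ring
end

section
/- Let λ, χ, ψ ∈ ℝ satisfy: (χ ≥ 0 and ψ > 0) if λ > 0; (χ > 0 and ψ > 0) if λ = 0; (χ > 0 and ψ ≥ 0) if λ < 0. Let μ, β ∈ ℝ with β² + ψ > 0 or λ < 1/2, and define the (unnormalized) generalized hyperbolic density f : ℝ → [0,∞] by f(y) = ∫₀^∞ (2πx)^{-1/2} · exp(−(y − μ − βx)²/(2x)) · x^{λ−1} exp(−(χ/x + ψx)/2) dx. Then f is unimodal on ℝ: there exists y* ∈ ℝ such that f is nondecreasing on (−∞, y*] and nonincreasing on [y*, ∞). -/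
open MeasureTheory Set Real ENNReal

noncomputable def ghK (p s a θ : ℝ) : ℝ := Real.exp (p * θ - (s * Real.exp (-θ) + a * Real.exp θ) / 2)

lemma gh_exp_lin (k M : ℝ) (hk : 0 < k) (hM : 0 < M) : ∃ C : ℝ, ∀ y : ℝ, M * y - C ≤ k * Real.exp y := by
  refine ⟨M * (Real.log (M / k) - 1), fun y => ?_⟩
  have h := Real.add_one_le_exp (y - Real.log (M / k))
  rw [Real.exp_sub, Real.exp_log (by positivity)] at h
  have h2 : k * Real.exp y = M * (Real.exp y / (M / k)) := by field_simp
  rw [h2]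
  nlinarith

lemma gh_int_abs (c : ℝ) (hc : 0 < c) : Integrable (fun θ : ℝ => Real.exp (-c * |θ|)) := by
  rw [← integrableOn_univ, ← Iic_union_Ioi (a := (0:ℝ))]
  refine IntegrableOn.union ?_ ?_
  · refine (integrableOn_exp_mul_Iic hc 0).congr_fun (fun x hx => ?_) measurableSet_Iic
    simp only [abs_of_nonpos (show x ≤ 0 from hx)]; ring_nf
  · refine (integrableOn_exp_mul_Ioi (a := -c) (by linarith) 0).congr_fun (fun x hx => ?_) measurableSet_Ioi
    simp only [abs_of_pos (show 0 < x from hx)]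

lemma ghK_pos (p s a θ : ℝ) : 0 < ghK p s a θ := Real.exp_pos _

lemma ghK_cont (p s a : ℝ) : Continuous (ghK p s a) := by
  unfold ghK; fun_prop

lemma ghK_int (p s a : ℝ) (hs : 0 < s) (h : 0 < a ∨ (0 ≤ a ∧ p < 0)) : Integrable (ghK p s a) := by
  obtain ⟨c, C, hc, hb⟩ : ∃ c C : ℝ, 0 < c ∧ ∀ θ, p * θ - (s * Real.exp (-θ) + a * Real.exp θ) / 2 ≤ C + -c * |θ| := by
    have hp := abs_nonneg p
    have hp1 := le_abs_self p
    have hp2 := neg_abs_le p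
    obtain ⟨C1, h1⟩ := gh_exp_lin s (2 * (2 * |p| + 1)) hs (by positivity)
    rcases h with ha | ⟨ha, hpn⟩
    · obtain ⟨C2, h2⟩ := gh_exp_lin a (2 * (|p| + 1)) ha (by positivity)
      refine ⟨1, max (C1/2) (C2/2), one_pos, fun θ => ?_⟩
      have h1' := h1 (-θ)
      have h2' := h2 θ
      have e1 := mul_pos hs (Real.exp_pos (-θ))
      have e2 := mul_pos ha (Real.exp_pos θ)
      have m1 := le_max_left (C1/2) (C2/2)
      have m2 := le_max_right (C1/2) (C2/2)
      rcases abs_cases θ with ⟨e, h0⟩ | ⟨e, h0⟩ <;> rw [e] <;> nlinarith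
    · refine ⟨-p, max 0 (C1/2), by linarith, fun θ => ?_⟩
      have h1' := h1 (-θ)
      have e1 := mul_pos hs (Real.exp_pos (-θ))
      have e2 := mul_nonneg ha (Real.exp_pos θ).le
      have m1 := le_max_left 0 (C1/2)
      have m2 := le_max_right 0 (C1/2)
      rw [abs_of_neg hpn] at *
      rcases abs_cases θ with ⟨e, h0⟩ | ⟨e, h0⟩ <;> rw [e] <;> nlinarith
  refine ((gh_int_abs c hc).const_mul (Real.exp C)).mono' (ghK_cont p s a).aestronglyMeasurable (Filter.Eventually.of_forall fun θ => ?_)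
  rw [Real.norm_of_nonneg (ghK_pos _ _ _ _).le, ← Real.exp_add]
  exact Real.exp_le_exp.2 (hb θ)

noncomputable def ghH (p s a : ℝ) : ℝ := ∫ θ, ghK p s a θ

lemma ghH_deriv (p s a : ℝ) (hs : 0 < s) (ha : 0 < a) :
    HasDerivAt (fun s => ghH p s a) (-(1/2) * ghH (p - 1) s a) s := by
  have key := hasDerivAt_integral_of_dominated_loc_of_deriv_le (μ := volume) (F := fun s θ => ghK p s a θ)
    (F' := fun s θ => -(1/2) * ghK (p - 1) s a θ) (x₀ := s) (s := Ioi (s/2))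
    (bound := fun θ => (1/2) * ghK (p - 1) (s/2) a θ) (Ioi_mem_nhds (by linarith))
    (Filter.Eventually.of_forall fun t => (ghK_cont p t a).aestronglyMeasurable)
    (ghK_int p s a hs (Or.inl ha))
    ((ghK_cont (p-1) s a).const_smul (-(1/2):ℝ)).aestronglyMeasurable
    (Filter.Eventually.of_forall fun θ t ht => ?_)
    ((ghK_int (p-1) (s/2) a (by linarith) (Or.inl ha)).const_mul _)
    (Filter.Eventually.of_forall fun θ t ht => ?_)
  · have := key.2
    rw [integral_const_mul] at this
    exact this
  · rw [norm_mul, Real.norm_of_nonneg (ghK_pos _ _ _ _).le]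
    have : ‖(-(1/2):ℝ)‖ = 1/2 := by norm_num
    rw [this]
    have ht' : s / 2 < t := ht
    unfold ghK
    have := Real.exp_pos (-θ)
    gcongr
  · have e : -(1/2) * ghK (p - 1) t a θ = ghK p t a θ * (-(1 * Real.exp (-θ)) / 2) := by
      unfold ghK
      have : (p - 1) * θ - (t * Real.exp (-θ) + a * Real.exp θ) / 2 = (p * θ - (t * Real.exp (-θ) + a * Real.exp θ) / 2) + -θ := by ring
      rw [this, Real.exp_add]; ring
    rw [e]
    unfold ghK
    have h1 : HasDerivAt (fun t : ℝ => p * θ - (t * Real.exp (-θ) + a * Real.exp θ) / 2) (-(1 * Real.exp (-θ)) / 2) t := by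
      have := ((((hasDerivAt_id t).mul_const (Real.exp (-θ))).add_const (a * Real.exp θ)).div_const 2).const_sub (p * θ)
      rw [neg_div]
      exact this
    exact h1.exp

/-- single crossing -/
lemma gh_sc (k0 k1 r : ℝ → ℝ) (i0 : IntegrableOn k0 (Ioi 0)) (i1 : IntegrableOn k1 (Ioi 0))
    (hr : AntitoneOn r (Ici 0)) (hk : ∀ x, 0 < x → k1 x ≤ Real.exp (r x) * k0 x)
    (hs : ∀ x y, 0 < x → x ≤ y → 0 < k0 x → 0 ≤ k0 y)
    (h0 : ∫ x in Ioi 0, k0 x ≤ 0) : ∫ x in Ioi 0, k1 x ≤ 0 := by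
  by_cases hall : ∀ x, 0 < x → k0 x ≤ 0
  · refine setIntegral_nonpos measurableSet_Ioi fun x hx => (hk x hx).trans ?_
    exact mul_nonpos_of_nonneg_of_nonpos (Real.exp_pos _).le (hall x hx)
  push Not at hall
  set S : Set ℝ := {x | 0 < x ∧ 0 < k0 x} with hS
  have hne : S.Nonempty := by obtain ⟨x, h1, h2⟩ := hall; exact ⟨x, h1, h2⟩
  have hbdd : BddBelow S := ⟨0, fun x hx => hx.1.le⟩
  set t := sInf S with ht
  have ht0 : 0 ≤ t := le_csInf hne fun x hx => hx.1.le
  have hle : ∫ x in Ioi 0, k1 x ≤ ∫ x in Ioi 0, Real.exp (r t) * k0 x := by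
    refine setIntegral_mono_on i1 (i0.const_mul _) measurableSet_Ioi fun x hx => (hk x hx).trans ?_
    have hx' : (0:ℝ) < x := hx
    rcases lt_trichotomy x t with h | h | h
    · have hk0 : k0 x ≤ 0 := by
        by_contra hc
        push Not at hc
        exact absurd (csInf_le hbdd (show x ∈ S from ⟨hx', hc⟩)) (not_le.2 h)
      exact mul_le_mul_of_nonpos_right (Real.exp_le_exp.2 (hr hx'.le ht0 h.le)) hk0
    · rw [h]
    · obtain ⟨z, hz, hzx⟩ := (csInf_lt_iff hbdd hne).1 h
      exact mul_le_mul_of_nonneg_right (Real.exp_le_exp.2 (hr ht0 hx'.le h.le)) (hs z x hz.1 hzx.le hz.2)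
  rw [integral_const_mul] at hle
  exact hle.trans (mul_nonpos_of_nonneg_of_nonpos (Real.exp_pos _).le h0)

lemma gh_fold (k : ℝ → ℝ) (hk : Integrable k) :
    IntegrableOn (fun x => k x + k (-x)) (Ioi 0) ∧ ∫ x, k x = ∫ x in Ioi 0, (k x + k (-x)) := by
  have hn : Integrable (fun x => k (-x)) := hk.comp_neg
  refine ⟨(hk.add hn).integrableOn, ?_⟩
  rw [integral_add hk.integrableOn hn.integrableOn, integral_comp_neg_Ioi, neg_zero, add_comm]
  exact (intervalIntegral.integral_Iic_add_Ioi hk.integrableOn hk.integrableOn).symm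

lemma ghH_shift (p s a c : ℝ) :
    ghH p s a = Real.exp (p * c) * ghH p (s * Real.exp (-c)) (a * Real.exp c) := by
  unfold ghH
  rw [← integral_add_right_eq_self (ghK p s a) c, ← integral_const_mul]
  congr 1; ext θ
  unfold ghK
  rw [← Real.exp_add, neg_add, Real.exp_add, Real.exp_add]
  congr 1; ring

lemma gh_sinh (x y : ℝ) (hx : 0 < x) (hxy : x ≤ y) : y * Real.sinh x ≤ x * Real.sinh y := by
  have hc : ConvexOn ℝ (Ici 0) Real.sinh := by
    refine MonotoneOn.convexOn_of_deriv (convex_Ici 0) Real.continuous_sinh.continuousOn Real.differentiable_sinh.differentiableOn ?_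
    rw [Real.deriv_sinh, interior_Ici]
    intro a ha b hb hab
    have ha' : (0:ℝ) < a := ha
    exact Real.cosh_le_cosh.2 (by rw [abs_of_pos ha', abs_of_pos (by linarith)]; exact hab)
  have hy : 0 < y := by linarith
  have h := hc.2 (show (0:ℝ) ∈ Ici 0 from le_refl (0:ℝ)) (show y ∈ Ici (0:ℝ) from hy.le)
    (show 0 ≤ 1 - x / y by rw [sub_nonneg, div_le_one hy]; exact hxy) (show 0 ≤ x / y by positivity) (by ring)
  simp only [smul_eq_mul, mul_zero, zero_add, Real.sinh_zero, div_mul_cancel₀ _ hy.ne'] at h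
  rw [div_mul_eq_mul_div, le_div_iff₀ hy] at h
  linarith

lemma gh_kA (ν s a θ : ℝ) : (ghK ν s a θ - ghK (ν - 1) s a θ) + (ghK ν s a (-θ) - ghK (ν - 1) s a (-θ)) =
    (Real.exp (θ/2) - Real.exp (-(θ/2))) * (ghK (ν - 1/2) s a θ - ghK (ν - 1/2) s a (-θ)) := by
  unfold ghK
  simp only [sub_mul, mul_sub, ← Real.exp_add]
  ring_nf

lemma gh_crossA (ν s0 a0 s1 a1 : ℝ) (hν : ν ≤ 1/2) (hs0 : 0 < s0) (hs1 : 0 < s1) (ha0 : 0 < a0)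
    (ha : a0 ≤ a1) (hsa : s1 - s0 ≤ a1 - a0) (h : ghH ν s0 a0 - ghH (ν - 1) s0 a0 ≤ 0) :
    ghH ν s1 a1 - ghH (ν - 1) s1 a1 ≤ 0 := by
  have ha1 : 0 < a1 := by linarith
  have I0 := ghK_int ν s0 a0 hs0 (Or.inl ha0)
  have I0' := ghK_int (ν-1) s0 a0 hs0 (Or.inl ha0)
  have I1 := ghK_int ν s1 a1 hs1 (Or.inl ha1)
  have I1' := ghK_int (ν-1) s1 a1 hs1 (Or.inl ha1)
  unfold ghH at h ⊢
  rw [← integral_sub I0 I0'] at h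
  rw [← integral_sub I1 I1']
  obtain ⟨i0, e0⟩ := gh_fold _ (I0.sub I0')
  obtain ⟨i1, e1⟩ := gh_fold _ (I1.sub I1')
  simp only [Pi.sub_apply] at i0 e0 i1 e1
  rw [e0] at h
  rw [e1]
  simp only [gh_kA] at *
  have hfac : ∀ x : ℝ, 0 < x → 0 < Real.exp (x/2) - Real.exp (-(x/2)) := fun x hx => by
    rw [sub_pos, Real.exp_lt_exp]; linarith
  refine gh_sc _ _ (fun θ => -((s1 - s0) * Real.exp (-θ) + (a1 - a0) * Real.exp θ) / 2) i0 i1 ?_ ?_ ?_ h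
  · intro x hx y hy hxy
    have hx' : (0:ℝ) ≤ x := hx
    have X1 : 1 ≤ Real.exp x := Real.one_le_exp hx'
    have XY : Real.exp x ≤ Real.exp y := Real.exp_le_exp.2 hxy
    have d0 : Real.exp (-y) ≤ Real.exp (-x) := Real.exp_le_exp.2 (by linarith)
    have d1 : Real.exp (-x) - Real.exp (-y) ≤ Real.exp y - Real.exp x := by
      rw [Real.exp_neg, Real.exp_neg, inv_sub_inv (by positivity) (by positivity)]
      refine div_le_self (by linarith) (by nlinarith)
    simp only
    nlinarith [mul_nonneg (sub_nonneg.2 hsa) (sub_nonneg.2 d0), mul_nonneg (sub_nonneg.2 ha) (sub_nonneg.2 d1)]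
  · intro x hx
    have hf := hfac x hx
    have e1 : ghK (ν - 1/2) s1 a1 x = Real.exp (-((s1 - s0) * Real.exp (-x) + (a1 - a0) * Real.exp x) / 2) * ghK (ν - 1/2) s0 a0 x := by
      unfold ghK; rw [← Real.exp_add]; congr 1; ring
    have e2 : Real.exp (-((s1 - s0) * Real.exp (-x) + (a1 - a0) * Real.exp x) / 2) * ghK (ν - 1/2) s0 a0 (-x) ≤ ghK (ν - 1/2) s1 a1 (-x) := by
      unfold ghK; rw [← Real.exp_add]
      apply Real.exp_le_exp.2
      rw [neg_neg]
      have : Real.exp (-x) ≤ Real.exp x := Real.exp_le_exp.2 (by linarith)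
      nlinarith [mul_nonneg (sub_nonneg.2 hsa) (sub_nonneg.2 this)]
    rw [e1]
    nlinarith
  · intro x y hx hxy hpos
    have hy : 0 < y := by linarith
    have key : ∀ z : ℝ, ((ν - 1/2) * z - (s0 * Real.exp (-z) + a0 * Real.exp z)/2) - ((ν - 1/2) * (-z) - (s0 * Real.exp (-(-z)) + a0 * Real.exp (-z))/2) = 2 * ((ν - 1/2) * z) + (s0 - a0) * Real.sinh z := by
      intro z; rw [Real.sinh_eq, neg_neg]; ring
    have hp := (mul_pos_iff_of_pos_left (hfac x hx)).1 hpos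
    apply mul_nonneg (hfac y hy).le
    rw [sub_nonneg]
    rw [sub_pos] at hp
    unfold ghK at hp ⊢
    rw [Real.exp_lt_exp, ← sub_pos, key] at hp
    rw [Real.exp_le_exp, ← sub_nonneg, key]
    have hsx : 0 < Real.sinh x := Real.sinh_pos_iff.2 hx
    have hD : 0 < s0 - a0 := by
      by_contra hc
      push Not at hc
      nlinarith
    have := gh_sinh x y hx hxy
    have h3 : 0 ≤ x * (2 * ((ν - 1/2) * y) + (s0 - a0) * Real.sinh y) := by
      nlinarith [mul_le_mul_of_nonneg_left this hD.le, mul_pos hy hp]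
    exact nonneg_of_mul_nonneg_right h3 hx

lemma gh_cosh (ν x y : ℝ) (hν : 1/2 ≤ ν) (hx : 0 < x) (hxy : x ≤ y) :
    Real.cosh (ν * x) * Real.cosh ((ν - 1) * y) ≤ Real.cosh (ν * y) * Real.cosh ((ν - 1) * x) := by
  have P : ∀ A B : ℝ, Real.cosh A * Real.cosh B = (Real.cosh (A + B) + Real.cosh (A - B)) / 2 := by
    intro A B; rw [Real.cosh_add, Real.cosh_sub]; ring
  have Q : ∀ p q : ℝ, 0 ≤ p → 0 ≤ q → Real.cosh (p - q) ≤ Real.cosh (p + q) := by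
    intro p q hp hq
    rw [Real.cosh_le_cosh, abs_of_nonneg (add_nonneg hp hq), abs_le]
    constructor <;> linarith
  rw [P, P]
  have h1 := Q ((ν - 1/2) * (x + y)) ((y - x)/2) (mul_nonneg (by linarith) (by linarith)) (by linarith)
  have h2 := Q ((x + y)/2) ((ν - 1/2) * (y - x)) (by linarith) (mul_nonneg (by linarith) (by linarith))
  have e1 : ν * x + (ν - 1) * y = (ν - 1/2) * (x + y) - (y - x)/2 := by ring
  have e2 : ν * y + (ν - 1) * x = (ν - 1/2) * (x + y) + (y - x)/2 := by ring
  have e3 : ν * x - (ν - 1) * y = (x + y)/2 - (ν - 1/2) * (y - x) := by ring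
  have e4 : ν * y - (ν - 1) * x = (x + y)/2 + (ν - 1/2) * (y - x) := by ring
  rw [e1, e2, e3, e4]; linarith

lemma gh_kB (ν z b q θ : ℝ) : (b * ghK ν z z θ - q * ghK (ν - 1) z z θ) + (b * ghK ν z z (-θ) - q * ghK (ν - 1) z z (-θ)) =
    Real.exp (-(z * Real.cosh θ)) * (2 * (b * Real.cosh (ν * θ) - q * Real.cosh ((ν - 1) * θ))) := by
  have e : ∀ p t : ℝ, ghK p z z t = Real.exp (-(z * Real.cosh t)) * Real.exp (p * t) := by
    intro p t; unfold ghK; rw [← Real.exp_add]; congr 1; rw [Real.cosh_eq]; ring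
  simp only [e, Real.cosh_neg]
  rw [Real.cosh_eq (ν * θ), Real.cosh_eq ((ν - 1) * θ)]
  simp only [mul_neg]
  ring

lemma gh_crossB (ν b q0 q1 z0 z1 : ℝ) (hν : 1/2 ≤ ν) (hb : 0 < b) (hq : q0 ≤ q1) (hz0 : 0 < z0) (hz : z0 ≤ z1)
    (h : b * ghH ν z0 z0 - q0 * ghH (ν - 1) z0 z0 ≤ 0) :
    b * ghH ν z1 z1 - q1 * ghH (ν - 1) z1 z1 ≤ 0 := by
  have hz1 : 0 < z1 := by linarith
  have I0 := (ghK_int ν z0 z0 hz0 (Or.inl hz0)).const_mul b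
  have I0' := (ghK_int (ν-1) z0 z0 hz0 (Or.inl hz0)).const_mul q0
  have I1 := (ghK_int ν z1 z1 hz1 (Or.inl hz1)).const_mul b
  have I1' := (ghK_int (ν-1) z1 z1 hz1 (Or.inl hz1)).const_mul q1
  unfold ghH at h ⊢
  simp only [← integral_const_mul] at h ⊢
  rw [← integral_sub I0 I0'] at h
  rw [← integral_sub I1 I1']
  obtain ⟨i0, e0⟩ := gh_fold _ (I0.sub I0')
  obtain ⟨i1, e1⟩ := gh_fold _ (I1.sub I1')
  simp only [Pi.sub_apply] at i0 e0 i1 e1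
  rw [e0] at h
  rw [e1]
  simp only [gh_kB] at *
  refine gh_sc _ _ (fun θ => -((z1 - z0) * Real.cosh θ)) i0 i1 ?_ ?_ ?_ h
  · intro x hx y hy hxy
    have hx' : (0:ℝ) ≤ x := hx
    have : Real.cosh x ≤ Real.cosh y := Real.cosh_le_cosh.2 (by rw [abs_of_nonneg hx', abs_of_nonneg (by linarith)]; exact hxy)
    simp only
    nlinarith
  · intro x hx
    rw [← mul_assoc (Real.exp (-((z1 - z0) * Real.cosh x))), ← Real.exp_add]
    have : -((z1 - z0) * Real.cosh x) + -(z0 * Real.cosh x) = -(z1 * Real.cosh x) := by ring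
    rw [this]
    have := Real.cosh_pos ((ν - 1) * x)
    gcongr
  · intro x y hx hxy hpos
    have hp := (mul_pos_iff_of_pos_left (Real.exp_pos _)).1 hpos
    apply mul_nonneg (Real.exp_pos _).le
    have := gh_cosh ν x y hν hx hxy
    have c1 := Real.cosh_pos ((ν - 1) * x)
    have c2 := Real.cosh_pos ((ν - 1) * y)
    have h3 : 0 ≤ Real.cosh ((ν - 1) * x) * (2 * (b * Real.cosh (ν * y) - q0 * Real.cosh ((ν - 1) * y))) := by
      nlinarith [mul_le_mul_of_nonneg_left this hb.le, mul_pos c2 hp]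
    exact nonneg_of_mul_nonneg_right h3 c1

lemma gh_cross (ν χ a β u0 u1 : ℝ) (hχ : 0 ≤ χ) (hβ : 0 < β) (ha : β ^ 2 ≤ a) (hu0 : 0 < u0) (hu : u0 ≤ u1)
    (h : β * ghH ν (χ + u0 ^ 2) a - u0 * ghH (ν - 1) (χ + u0 ^ 2) a ≤ 0) :
    β * ghH ν (χ + u1 ^ 2) a - u1 * ghH (ν - 1) (χ + u1 ^ 2) a ≤ 0 := by
  have ha0 : 0 < a := lt_of_lt_of_le (by positivity) ha
  have hu1 : 0 < u1 := by linarith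
  rcases le_total ν (1/2) with hν | hν
  · have T : ∀ u : ℝ, 0 < u → β * ghH ν (χ + u ^ 2) a - u * ghH (ν - 1) (χ + u ^ 2) a =
        (β * Real.exp (ν * Real.log (u / β))) * (ghH ν ((χ + u ^ 2) * (β / u)) (a * (u / β)) - ghH (ν - 1) ((χ + u ^ 2) * (β / u)) (a * (u / β))) := by
      intro u hu
      rw [ghH_shift ν _ _ (Real.log (u / β)), ghH_shift (ν - 1) _ _ (Real.log (u / β)), sub_mul, Real.exp_sub, one_mul,
        Real.exp_neg, Real.exp_log (by positivity), inv_div]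
      field_simp
    rw [T u0 hu0] at h
    rw [T u1 hu1]
    apply mul_nonpos_of_nonneg_of_nonpos (by positivity)
    have h' := nonpos_of_mul_nonpos_right h (by positivity)
    refine gh_crossA ν _ _ _ _ hν (by positivity) (by positivity) (by positivity) (by gcongr) ?_ h'
    have e : ∀ u : ℝ, 0 < u → (χ + u ^ 2) * (β / u) = χ * β * (1 / u) + β * u := by
      intro u hu; field_simp
    rw [e u0 hu0, e u1 hu1]
    have e2 : a * (u1 / β) - a * (u0 / β) = (a / β) * (u1 - u0) := by ring
    rw [e2]
    have e3 : β ≤ a / β := by rw [le_div_iff₀ hβ]; nlinarith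
    have e4 : 1 / u1 ≤ 1 / u0 := one_div_le_one_div_of_le hu0 hu
    nlinarith [mul_le_mul_of_nonneg_left e4 (mul_nonneg hχ hβ.le)]
  · have T : ∀ u : ℝ, 0 < u → β * ghH ν (χ + u ^ 2) a - u * ghH (ν - 1) (χ + u ^ 2) a =
        (Real.exp (ν * Real.log (√(χ + u ^ 2) / √a))) * (β * ghH ν (√(χ + u ^ 2) * √a) (√(χ + u ^ 2) * √a) - (u / √(χ + u ^ 2) * √a) * ghH (ν - 1) (√(χ + u ^ 2) * √a) (√(χ + u ^ 2) * √a)) := by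
      intro u hu
      have hs : 0 < χ + u ^ 2 := by positivity
      have hs' := Real.sqrt_pos.2 hs
      have ha' := Real.sqrt_pos.2 ha0
      rw [ghH_shift ν _ _ (Real.log (√(χ + u ^ 2) / √a)), ghH_shift (ν - 1) _ _ (Real.log (√(χ + u ^ 2) / √a)), sub_mul, Real.exp_sub, one_mul,
        Real.exp_neg, Real.exp_log (by positivity), inv_div]
      have e1 : (χ + u ^ 2) * (√a / √(χ + u ^ 2)) = √(χ + u ^ 2) * √a := by
        rw [mul_div_assoc', div_eq_iff hs'.ne']
        linear_combination (-√a) * Real.mul_self_sqrt hs.le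
      have e2 : a * (√(χ + u ^ 2) / √a) = √(χ + u ^ 2) * √a := by
        rw [mul_div_assoc', div_eq_iff ha'.ne']
        linear_combination (-√(χ + u ^ 2)) * Real.mul_self_sqrt ha0.le
      rw [e1, e2]
      field_simp
    rw [T u0 hu0] at h
    rw [T u1 hu1]
    apply mul_nonpos_of_nonneg_of_nonpos (by positivity)
    have h' := nonpos_of_mul_nonpos_right h (by positivity)
    refine gh_crossB ν β _ _ _ _ hν hβ ?_ (by positivity) (by gcongr) h'
    gcongr ?_ * _
    rw [div_le_div_iff₀ (by positivity) (by positivity)]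
    apply le_of_sq_le_sq ?_ (by positivity)
    rw [mul_pow, mul_pow, Real.sq_sqrt (by positivity), Real.sq_sqrt (by positivity)]
    nlinarith [mul_le_mul_of_nonneg_left (pow_le_pow_left₀ hu0.le hu 2) hχ]

noncomputable def ghPhi (ν χ a β u : ℝ) : ℝ≥0∞ := ∫⁻ θ, ENNReal.ofReal (Real.exp (β * u) * ghK ν (χ + u ^ 2) a θ)

lemma ghPhi_eq (ν χ a β u : ℝ) (hχ : 0 ≤ χ) (ha : 0 < a) (hu : 0 < u) :
    ghPhi ν χ a β u = ENNReal.ofReal (Real.exp (β * u) * ghH ν (χ + u ^ 2) a) := by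
  unfold ghPhi ghH
  rw [← integral_const_mul, ofReal_integral_eq_lintegral_ofReal]
  · exact (ghK_int _ _ _ (by positivity) (Or.inl ha)).const_mul _
  · exact Filter.Eventually.of_forall fun θ => mul_nonneg (Real.exp_pos _).le (ghK_pos _ _ _ _).le

lemma ghK_anti (p s t a θ : ℝ) (h : s ≤ t) : ghK p t a θ ≤ ghK p s a θ := by
  unfold ghK
  have := Real.exp_pos (-θ)
  gcongr

lemma ghPhi_mono_neg (ν χ a β u v : ℝ) (hβ : 0 ≤ β) (huv : u ≤ v) (hv : v ≤ 0) :
    ghPhi ν χ a β u ≤ ghPhi ν χ a β v := by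
  refine lintegral_mono fun θ => ENNReal.ofReal_le_ofReal ?_
  refine mul_le_mul (Real.exp_le_exp.2 (by gcongr)) (ghK_anti _ _ _ _ _ ?_) (ghK_pos _ _ _ _).le (Real.exp_pos _).le
  nlinarith

lemma ghPhi_upper (ν χ a β u : ℝ) :
    ghPhi ν χ a β u ≤ ENNReal.ofReal (Real.exp (β * u)) * ghPhi ν χ a β 0 := by
  unfold ghPhi
  rw [← lintegral_const_mul' _ _ ENNReal.ofReal_ne_top]
  refine lintegral_mono fun θ => ?_
  simp only
  rw [← ENNReal.ofReal_mul (Real.exp_pos _).le]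
  refine ENNReal.ofReal_le_ofReal ?_
  rw [mul_zero, Real.exp_zero, one_mul]
  exact mul_le_mul_of_nonneg_left (ghK_anti _ _ _ _ _ (by nlinarith [sq_nonneg u])) (Real.exp_pos _).le

lemma ghPhi_cont (ν χ a β θ : ℝ) : Continuous (fun u => ENNReal.ofReal (Real.exp (β * u) * ghK ν (χ + u ^ 2) a θ)) := by
  unfold ghK
  exact ENNReal.continuous_ofReal.comp (by fun_prop)

lemma ghPhi_lower (ν χ a β : ℝ) (B : ℝ≥0∞) (v : ℝ) (hv : 0 < v) (h : ∀ u, 0 < u → u ≤ v → ghPhi ν χ a β u ≤ B) :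
    ghPhi ν χ a β 0 ≤ B := by
  have hlim : Filter.Tendsto (fun n : ℕ => v / ((n:ℝ) + 1)) Filter.atTop (nhds 0) :=
    by simpa [div_eq_mul_inv] using (tendsto_one_div_add_atTop_nhds_zero_nat (𝕜 := ℝ)).const_mul v
  have hf := lintegral_liminf_le (μ := (volume : Measure ℝ)) (u := Filter.atTop) (f := fun (n : ℕ) θ => ENNReal.ofReal (Real.exp (β * (v / ((n:ℝ) + 1))) * ghK ν (χ + (v / ((n:ℝ) + 1)) ^ 2) a θ))
    (fun n => ENNReal.measurable_ofReal.comp ((ghK_cont _ _ _).measurable.const_mul _))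
  have e : ∀ θ, Filter.liminf (fun n : ℕ => ENNReal.ofReal (Real.exp (β * (v / ((n:ℝ) + 1))) * ghK ν (χ + (v / ((n:ℝ) + 1)) ^ 2) a θ)) Filter.atTop
      = ENNReal.ofReal (Real.exp (β * 0) * ghK ν (χ + 0 ^ 2) a θ) := fun θ =>
    (((ghPhi_cont ν χ a β θ).tendsto 0).comp hlim).liminf_eq
  simp only [e] at hf
  refine hf.trans ?_
  refine Filter.liminf_le_of_le (by isBoundedDefault) fun b hb => ?_
  obtain ⟨n, hn⟩ := hb.exists
  refine hn.trans (h _ (by positivity) ?_)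
  exact div_le_self hv.le (by linarith [(Nat.cast_nonneg n : (0:ℝ) ≤ n)])

lemma ghG_deriv (ν χ a β u : ℝ) (hχ : 0 ≤ χ) (ha : 0 < a) (hu : 0 < u) :
    HasDerivAt (fun u => Real.exp (β * u) * ghH ν (χ + u ^ 2) a)
      (Real.exp (β * u) * (β * ghH ν (χ + u ^ 2) a - u * ghH (ν - 1) (χ + u ^ 2) a)) u := by
  have h1 : HasDerivAt (fun u : ℝ => χ + u ^ 2) (2 * u) u := by
    simpa using (hasDerivAt_pow 2 u).const_add χ
  have h2 := (ghH_deriv ν (χ + u ^ 2) a (by positivity) ha).comp u h1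
  have h3 : HasDerivAt (fun u : ℝ => Real.exp (β * u)) (Real.exp (β * u) * β) u := by
    simpa using ((hasDerivAt_id u).const_mul β).exp
  have h4 := h3.mul h2
  refine h4.congr_deriv ?_
  simp only [Function.comp]
  ring

lemma ghG_tendsto (ν χ ψ β : ℝ) (hχ : 0 ≤ χ) (hβ : 0 < β) (hψ : 0 < ψ ∨ (0 ≤ ψ ∧ ν < 0)) :
    Filter.Tendsto (fun u => Real.exp (β * u) * ghH ν (χ + u ^ 2) (ψ + β ^ 2)) Filter.atTop (nhds 0) := by
  have key := tendsto_integral_filter_of_dominated_convergence (μ := (volume : Measure ℝ)) (l := (Filter.atTop : Filter ℝ))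
    (F := fun u θ => Real.exp (β * u) * ghK ν (χ + u ^ 2) (ψ + β ^ 2) θ) (f := fun _ => 0)
    (fun θ => Real.exp β * ghK ν 1 ψ θ)
    (Filter.Eventually.of_forall fun u => ((ghK_cont _ _ _).const_smul (Real.exp (β * u))).aestronglyMeasurable)
    ?_ ((ghK_int ν 1 ψ one_pos hψ).const_mul _) (Filter.Eventually.of_forall fun θ => ?_)
  · simpa [integral_const_mul, ghH] using key
  · filter_upwards [Filter.eventually_ge_atTop (1:ℝ)] with u hu
    refine Filter.Eventually.of_forall fun θ => ?_
    rw [Real.norm_of_nonneg (mul_nonneg (Real.exp_pos _).le (ghK_pos _ _ _ _).le)]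
    unfold ghK
    rw [← Real.exp_add, ← Real.exp_add]
    apply Real.exp_le_exp.2
    have hx := Real.exp_pos (-θ)
    have hxy : Real.exp (-θ) * Real.exp θ = 1 := by rw [← Real.exp_add]; simp
    set X := Real.exp θ
    set Y := Real.exp (-θ)
    have h1 : 0 ≤ Y * ((u - 1 - β * X) ^ 2 + 2 * (u - 1)) := mul_nonneg hx.le (by nlinarith [sq_nonneg (u - 1 - β * X)])
    have h2 : Y * ((u - 1 - β * X) ^ 2 + 2 * (u - 1)) = u ^ 2 * Y - Y - 2 * β * (u - 1) + β ^ 2 * X := by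
      linear_combination (β ^ 2 * X - 2 * β * (u - 1)) * hxy
    nlinarith [mul_nonneg hχ hx.le]
  · have e : ∀ u, Real.exp (β * u) * ghK ν (χ + u ^ 2) (ψ + β ^ 2) θ =
        ghK ν χ (ψ + β ^ 2) θ * Real.exp (-(u * ((Real.exp (-θ) / 2) * u + -β))) := by
      intro u; unfold ghK; rw [← Real.exp_add, ← Real.exp_add]; congr 1; ring
    simp only [e]
    rw [← mul_zero (ghK ν χ (ψ + β ^ 2) θ)]
    refine Filter.Tendsto.const_mul _ ?_
    refine Real.tendsto_exp_neg_atTop_nhds_zero.comp ?_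
    refine Filter.Tendsto.atTop_mul_atTop₀ Filter.tendsto_id ?_
    exact Filter.tendsto_atTop_add_const_right _ _ (Filter.Tendsto.const_mul_atTop (by positivity) Filter.tendsto_id)

lemma ghPhi_unimodal (ν χ ψ β : ℝ) (hχ : 0 ≤ χ) (hβ : 0 < β) (hψ : 0 < ψ ∨ (0 ≤ ψ ∧ ν < 0)) :
    ∃ u₀ : ℝ, MonotoneOn (ghPhi ν χ (ψ + β ^ 2) β) (Iic u₀) ∧ AntitoneOn (ghPhi ν χ (ψ + β ^ 2) β) (Ici u₀) := by
  have hψ0 : 0 ≤ ψ := by rcases hψ with h | h; exacts [h.le, h.1]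
  set a := ψ + β ^ 2 with ha_def
  have ha : 0 < a := by positivity
  have haβ : β ^ 2 ≤ a := by linarith
  set G : ℝ → ℝ := fun u => Real.exp (β * u) * ghH ν (χ + u ^ 2) a with hG
  set L : ℝ → ℝ := fun u => β * ghH ν (χ + u ^ 2) a - u * ghH (ν - 1) (χ + u ^ 2) a with hL
  have hd : ∀ u, 0 < u → HasDerivAt G (Real.exp (β * u) * L u) u := fun u hu => ghG_deriv ν χ a β u hχ ha hu
  have hPG : ∀ u, 0 < u → ghPhi ν χ a β u = ENNReal.ofReal (G u) := fun u hu => ghPhi_eq ν χ a β u hχ ha hu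
  have hcross : ∀ u v, 0 < u → u ≤ v → L u ≤ 0 → L v ≤ 0 := fun u v hu huv h => gh_cross ν χ a β u v hχ hβ haβ hu huv h
  have hGpos : ∀ u, 0 < u → 0 < G u := by
    intro u hu
    refine mul_pos (Real.exp_pos _) ?_
    have hi := ghK_int ν (χ + u ^ 2) a (by positivity) (Or.inl ha)
    exact integral_exp_pos hi
  set S : Set ℝ := {u | 0 < u ∧ L u ≤ 0} with hS
  have monoOn : ∀ t, (∀ u, 0 < u → u < t → 0 ≤ L u) → MonotoneOn G (Ioc 0 t) := by
    intro t ht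
    refine monotoneOn_of_deriv_nonneg (convex_Ioc 0 t) (fun u hu => (hd u hu.1).continuousAt.continuousWithinAt) ?_ ?_
    · rw [interior_Ioc]; exact fun u hu => (hd u hu.1).differentiableAt.differentiableWithinAt
    · rw [interior_Ioc]; intro u hu
      rw [(hd u hu.1).deriv]
      exact mul_nonneg (Real.exp_pos _).le (ht u hu.1 hu.2)
  have hne : S.Nonempty := by
    by_contra hc
    have hp : ∀ u, 0 < u → 0 < L u := by
      intro u hu
      by_contra h
      exact hc ⟨u, hu, not_lt.1 h⟩
    have hge : ∀ᶠ u in Filter.atTop, G 1 ≤ G u := by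
      filter_upwards [Filter.eventually_ge_atTop (1:ℝ)] with u hu
      exact monoOn u (fun w hw _ => (hp w hw).le) ⟨one_pos, hu⟩ ⟨by linarith, le_refl u⟩ hu
    have := ge_of_tendsto (ghG_tendsto ν χ ψ β hχ hβ hψ) hge
    exact absurd this (not_le.2 (hGpos 1 one_pos))
  have hbdd : BddBelow S := ⟨0, fun x hx => hx.1.le⟩
  set t := sInf S with ht
  have ht0 : 0 ≤ t := le_csInf hne fun x hx => hx.1.le
  have hbefore : ∀ u, 0 < u → u < t → 0 ≤ L u := by
    intro u hu hut
    by_contra hc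
    exact absurd (csInf_le hbdd (show u ∈ S from ⟨hu, (not_le.1 hc).le⟩)) (not_le.2 hut)
  have hafter : ∀ u, t < u → L u ≤ 0 := by
    intro u hu
    obtain ⟨z, hz, hzu⟩ := (csInf_lt_iff hbdd hne).1 hu
    exact hcross z u hz.1 hzu.le hz.2
  have antiOn : AntitoneOn G (Ici t ∩ Ioi 0) := by
    have hint : interior (Ici t ∩ Ioi 0) = Ioi t ∩ Ioi 0 := by
      rw [interior_inter, interior_Ici, interior_Ioi]
    refine antitoneOn_of_deriv_nonpos ((convex_Ici t).inter (convex_Ioi 0)) (fun u hu => (hd u hu.2).continuousAt.continuousWithinAt) ?_ ?_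
    · rw [hint]; exact fun u hu => (hd u hu.2).differentiableAt.differentiableWithinAt
    · rw [hint]; intro u hu
      rw [(hd u hu.2).deriv]
      exact mul_nonpos_of_nonneg_of_nonpos (Real.exp_pos _).le (hafter u hu.1)
  refine ⟨t, ?_, ?_⟩
  · intro u hu v hv huv
    have hu' : u ≤ t := hu
    have hv' : v ≤ t := hv
    rcases le_or_gt v 0 with hv0 | hv0
    · exact ghPhi_mono_neg _ _ _ _ _ _ hβ.le huv hv0
    have hm := monoOn t hbefore
    rcases le_or_gt u 0 with hu0 | hu0
    · refine (ghPhi_mono_neg _ _ _ _ _ _ hβ.le hu0 le_rfl).trans (ghPhi_lower _ _ _ _ _ v hv0 fun w hw hwv => ?_)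
      rw [hPG w hw, hPG v hv0]
      exact ENNReal.ofReal_le_ofReal (hm ⟨hw, hwv.trans hv'⟩ ⟨hv0, hv'⟩ hwv)
    · rw [hPG u hu0, hPG v hv0]
      exact ENNReal.ofReal_le_ofReal (hm ⟨hu0, hu'⟩ ⟨hv0, hv'⟩ huv)
  · intro u hu v hv huv
    have hu' : t ≤ u := hu
    have hv' : t ≤ v := hv
    have hu0 : 0 ≤ u := ht0.trans hu'
    rcases hu0.eq_or_lt with h0 | h0
    · subst h0
      rcases huv.eq_or_lt with h1 | hv0
      · rw [← h1]
      have hlim : Filter.Tendsto (fun w : ℝ => ENNReal.ofReal (Real.exp (β * w)) * ghPhi ν χ a β 0) (nhdsWithin 0 (Ioi 0)) (nhds (ghPhi ν χ a β 0)) := by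
        have h1 : Filter.Tendsto (fun w : ℝ => ENNReal.ofReal (Real.exp (β * w))) (nhdsWithin 0 (Ioi 0)) (nhds 1) := by
          have : Continuous (fun w : ℝ => ENNReal.ofReal (Real.exp (β * w))) := ENNReal.continuous_ofReal.comp (by fun_prop)
          have h := (this.tendsto 0).mono_left (nhdsWithin_le_nhds (s := Ioi 0))
          simpa using h
        have h2 := ENNReal.Tendsto.mul_const (b := ghPhi ν χ a β 0) h1 (Or.inl one_ne_zero)
        simpa using h2
      refine ge_of_tendsto hlim ?_
      filter_upwards [Ioo_mem_nhdsGT hv0] with w hw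
      refine le_trans ?_ (ghPhi_upper ν χ a β w)
      rw [hPG w hw.1, hPG v hv0]
      exact ENNReal.ofReal_le_ofReal (antiOn ⟨hu'.trans hw.1.le, hw.1⟩ ⟨hv', hv0⟩ hw.2.le)
    · have hv0 : 0 < v := by linarith
      rw [hPG u h0, hPG v hv0]
      exact ENNReal.ofReal_le_ofReal (antiOn ⟨hu', h0⟩ ⟨hv', hv0⟩ huv)

lemma gh_transform (lam χ ψ μ β y : ℝ) :
    ∫⁻ x in Ioi (0:ℝ), ENNReal.ofReal
      ((2 * π * x) ^ (-(1:ℝ)/2) * Real.exp (-(y - μ - β * x) ^ 2 / (2 * x)) *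
        (x ^ (lam - 1) * Real.exp (-(χ / x + ψ * x) / 2))) =
    ENNReal.ofReal ((2 * π) ^ (-(1:ℝ)/2)) * ghPhi (lam - 1/2) χ (ψ + β ^ 2) β (y - μ) := by
  have him : Real.exp '' univ = Ioi (0:ℝ) := by rw [image_univ, Real.range_exp]
  rw [← him, lintegral_image_eq_lintegral_abs_deriv_mul MeasurableSet.univ
    (fun x _ => (Real.hasDerivAt_exp x).hasDerivWithinAt) Real.exp_injective.injOn, Measure.restrict_univ]
  unfold ghPhi
  rw [← lintegral_const_mul' _ _ ENNReal.ofReal_ne_top]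
  refine lintegral_congr fun θ => ?_
  rw [← ENNReal.ofReal_mul (abs_nonneg _), ← ENNReal.ofReal_mul (by positivity)]
  congr 1
  rw [abs_of_pos (Real.exp_pos θ), Real.mul_rpow (by positivity) (Real.exp_pos θ).le, ← Real.exp_mul, ← Real.exp_mul]
  unfold ghK
  have e : ∀ c A B C D E A' B' : ℝ, A + (B + C + (D + E)) = A' + B' → Real.exp A * (c * Real.exp B * Real.exp C * (Real.exp D * Real.exp E)) = c * (Real.exp A' * Real.exp B') := by
    intro c A B C D E A' B' h
    have : Real.exp A * (c * Real.exp B * Real.exp C * (Real.exp D * Real.exp E)) = c * Real.exp (A + (B + C + (D + E))) := by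
      simp only [Real.exp_add]; ring
    rw [this, h, Real.exp_add]
  apply e
  rw [Real.exp_neg]
  have := (Real.exp_pos θ).ne'
  field_simp
  ring

theorem generalized_hyperbolic_unimodal
    (lam χ ψ μ β : ℝ)
    (hlam_pos : 0 < lam → 0 ≤ χ ∧ 0 < ψ)
    (hlam_zero : lam = 0 → 0 < χ ∧ 0 < ψ)
    (hlam_neg : lam < 0 → 0 < χ ∧ 0 ≤ ψ)
    (hconv : 0 < β ^ 2 + ψ ∨ lam < 1/2)
    (f : ℝ → ℝ≥0∞)
    (hf : ∀ y, f y = ∫⁻ x in Ioi (0:ℝ), ENNReal.ofReal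
      ((2 * π * x) ^ (-(1:ℝ)/2) * Real.exp (-(y - μ - β * x) ^ 2 / (2 * x)) *
        (x ^ (lam - 1) * Real.exp (-(χ / x + ψ * x) / 2)))) :
    ∃ y₀ : ℝ, MonotoneOn f (Iic y₀) ∧ AntitoneOn f (Ici y₀) := by
  have hχ : 0 ≤ χ := by
    rcases lt_trichotomy lam 0 with h | h | h
    exacts [(hlam_neg h).1.le, (hlam_zero h).1.le, (hlam_pos h).1]
  have hψ : 0 < ψ ∨ (0 ≤ ψ ∧ lam - 1/2 < 0) := by
    rcases lt_trichotomy lam 0 with h | h | h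
    exacts [Or.inr ⟨(hlam_neg h).2, by linarith⟩, Or.inl (hlam_zero h).2, Or.inl (hlam_pos h).2]
  simp only [gh_transform] at hf
  have hrefl : ∀ b u : ℝ, ghPhi (lam - 1/2) χ (ψ + b ^ 2) b u = ghPhi (lam - 1/2) χ (ψ + (-b) ^ 2) (-b) (-u) := by
    intro b u; unfold ghPhi; simp only [neg_mul_neg, neg_sq]
  rcases lt_trichotomy β 0 with hβ | hβ | hβ
  · obtain ⟨t, h1, h2⟩ := ghPhi_unimodal (lam - 1/2) χ ψ (-β) hχ (by linarith) hψ
    refine ⟨μ - t, fun x hx y hy hxy => ?_, fun x hx y hy hxy => ?_⟩ <;> rw [hf, hf, hrefl β, hrefl β] <;>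
      have hx' := mem_ofPred.1 hx <;> have hy' := mem_ofPred.1 hy <;> gcongr
    · exact h2 (show t ≤ _ by linarith) (show t ≤ _ by linarith) (by linarith)
    · exact h1 (show _ ≤ t by linarith) (show _ ≤ t by linarith) (by linarith)
  · subst hβ
    refine ⟨μ, fun x hx y hy hxy => ?_, fun x hx y hy hxy => ?_⟩ <;> rw [hf, hf] <;>
      have hx' := mem_ofPred.1 hx <;> have hy' := mem_ofPred.1 hy <;> gcongr
    · exact ghPhi_mono_neg _ _ _ _ _ _ le_rfl (by linarith) (by linarith)
    · have := hrefl 0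
      rw [this, this (x - μ), neg_zero]
      exact ghPhi_mono_neg _ _ _ _ _ _ le_rfl (by linarith) (by linarith)
  · obtain ⟨t, h1, h2⟩ := ghPhi_unimodal (lam - 1/2) χ ψ β hχ hβ hψ
    refine ⟨μ + t, fun x hx y hy hxy => ?_, fun x hx y hy hxy => ?_⟩ <;> rw [hf, hf] <;>
      have hx' := mem_ofPred.1 hx <;> have hy' := mem_ofPred.1 hy <;> gcongr
    · exact h1 (show _ ≤ t by linarith) (show _ ≤ t by linarith) (by linarith)
    · exact h2 (show t ≤ _ by linarith) (show t ≤ _ by linarith) (by linarith)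
end

section
/- Let λ, χ, ψ ∈ ℝ satisfy: (χ ≥ 0 and ψ > 0) if λ > 0; (χ > 0 and ψ > 0) if λ = 0; (χ > 0 and ψ ≥ 0) if λ < 0. Let μ, β ∈ ℝ with β² + ψ > 0 or λ < 1/2, and define f : ℝ → [0,∞] by f(y) = ∫₀^∞ (2πx)^{-1/2} · exp(−(y − μ − βx)²/(2x)) · x^{λ−1} exp(−(χ/x + ψx)/2) dx. Then f(y) ≤ f(μ) for all y ∈ ℝ if and only if β = 0, or (χ = 0 and 0 < λ ≤ 1). -/
open MeasureTheory Set Real ENNReal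

lemma gh_sub (b t : ℝ) (hb : 0 < b) (ht : 0 ≤ t) :
    ∫⁻ x in Ioi (0:ℝ), ENNReal.ofReal ((b / (2 * √x) + t / (2 * (x * √x))) *
        rexp (-(b * √x - t / √x) ^ 2 / 2)) =
      ∫⁻ u in (fun x : ℝ => b * √x - t / √x) '' Ioi 0, ENNReal.ofReal (rexp (-u ^ 2 / 2)) := by
  have hd : ∀ x ∈ Ioi (0:ℝ), HasDerivWithinAt (fun x : ℝ => b * √x - t / √x)
      (b / (2 * √x) + t / (2 * (x * √x))) (Ioi 0) x := by
    intro x hx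
    have hx : 0 < x := hx
    have hs : 0 < √x := Real.sqrt_pos.2 hx
    have h1 := Real.hasDerivAt_sqrt hx.ne'
    have h2 : HasDerivAt (fun x : ℝ => b * √x - t / √x) _ x := (h1.const_mul b).sub ((hasDerivAt_const x t).div h1 hs.ne')
    refine HasDerivAt.hasDerivWithinAt ?_
    refine h2.congr_deriv ?_
    have : √x ^ 2 = x := Real.sq_sqrt hx.le
    rw [this]
    field_simp
    ring
  have hi : InjOn (fun x : ℝ => b * √x - t / √x) (Ioi 0) := by
    have : StrictMonoOn (fun x : ℝ => b * √x - t / √x) (Ioi 0) := by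
      intro x hx y hy hxy
      have hx : 0 < x := hx
      have hs : 0 < √x := Real.sqrt_pos.2 hx
      have h1 : √x < √y := Real.sqrt_lt_sqrt hx.le hxy
      have h2 : t / √y ≤ t / √x := by gcongr
      have h3 : b * √x < b * √y := by gcongr
      simp only
      linarith
    exact this.injOn
  rw [lintegral_image_eq_lintegral_abs_deriv_mul measurableSet_Ioi hd hi]
  refine setLIntegral_congr_fun measurableSet_Ioi ?_
  intro x hx
  have hx : 0 < x := hx
  have hp : 0 ≤ b / (2 * √x) + t / (2 * (x * √x)) := by positivity
  simp only
  rw [abs_of_nonneg hp, ENNReal.ofReal_mul hp]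

lemma gh_symm (b t : ℝ) (hb : 0 < b) (ht : 0 < t) :
    ∫⁻ x in Ioi (0:ℝ), ENNReal.ofReal (t / (2 * (x * √x)) *
        rexp (-(b * √x - t / √x) ^ 2 / 2)) =
    ∫⁻ x in Ioi (0:ℝ), ENNReal.ofReal (b / (2 * √x) *
        rexp (-(b * √x - t / √x) ^ 2 / 2)) := by
  set k : ℝ := (t / b) ^ 2 with hk
  have hk0 : 0 < k := by positivity
  have him : (fun x : ℝ => k / x) '' Ioi 0 = Ioi 0 := by
    ext y
    simp only [mem_image, mem_Ioi]
    constructor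
    · rintro ⟨x, hx, rfl⟩
      positivity
    · intro hy
      exact ⟨k / y, by positivity, by field_simp⟩
  have hd : ∀ x ∈ Ioi (0:ℝ), HasDerivWithinAt (fun x : ℝ => k / x) (-(k / x ^ 2)) (Ioi 0) x := by
    intro x hx
    have hx : 0 < x := hx
    refine HasDerivAt.hasDerivWithinAt ?_
    have h2 : HasDerivAt (fun x : ℝ => k / x) _ x :=
      (hasDerivAt_const x k).div (hasDerivAt_id x) hx.ne'
    refine h2.congr_deriv ?_
    simp [neg_div]
  have hi : InjOn (fun x : ℝ => k / x) (Ioi 0) := by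
    intro x hx y hy h
    have hx : 0 < x := hx
    have hy : 0 < y := hy
    simp only at h
    rw [div_eq_div_iff hx.ne' hy.ne'] at h
    exact (mul_left_cancel₀ hk0.ne' h).symm
  conv_rhs => rw [← him]
  rw [lintegral_image_eq_lintegral_abs_deriv_mul measurableSet_Ioi hd hi]
  refine setLIntegral_congr_fun measurableSet_Ioi ?_
  intro x hx
  have hx : 0 < x := hx
  simp only
  rw [abs_neg, abs_of_nonneg (by positivity), ← ENNReal.ofReal_mul (by positivity)]
  have hs : 0 < √x := Real.sqrt_pos.2 hx
  have e : √(k / x) = t / (b * √x) := by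
    rw [Real.sqrt_div hk0.le, hk, Real.sqrt_sq (by positivity)]
    field_simp
  have hxs : x = √x ^ 2 := (Real.sq_sqrt hx.le).symm
  rw [e]
  have e1 : (b * (t / (b * √x)) - t / (t / (b * √x))) = -(b * √x - t / √x) := by
    field_simp
    ring
  rw [e1, neg_sq]
  have e2 : t / (2 * (x * √x)) = k / x ^ 2 * (b / (2 * (t / (b * √x)))) := by
    rw [hk]
    generalize √x = s at *
    subst hxs
    field_simp
  rw [e2, _root_.mul_assoc]

lemma gh_half (b t : ℝ) (hb : 0 < b) (ht : 0 < t) :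
    ∫⁻ x in Ioi (0:ℝ), ENNReal.ofReal (b / (2 * √x) * rexp (-(b * √x - t / √x) ^ 2 / 2)) ≤
    ∫⁻ x in Ioi (0:ℝ), ENNReal.ofReal (b / (2 * √x) * rexp (-(b * √x) ^ 2 / 2)) := by
  have h0 := gh_sub b 0 hb le_rfl
  have him : (fun x : ℝ => b * √x - 0 / √x) '' Ioi 0 = Ioi 0 := by
    ext y
    simp only [mem_image, mem_Ioi, zero_div, sub_zero]
    constructor
    · rintro ⟨x, hx, rfl⟩
      have hs : 0 < √x := Real.sqrt_pos.2 hx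
      positivity
    · intro hy
      refine ⟨(y / b) ^ 2, by positivity, ?_⟩
      rw [Real.sqrt_sq (by positivity)]
      field_simp
  rw [him] at h0
  simp only [zero_div, sub_zero, add_zero] at h0
  rw [h0]
  have h1 := gh_sub b t hb ht.le
  have h2 := gh_symm b t hb ht
  have hm1 : Measurable (fun x : ℝ => ENNReal.ofReal (b / (2 * √x) *
      rexp (-(b * √x - t / √x) ^ 2 / 2))) := by fun_prop
  have h3 : ∫⁻ x in Ioi (0:ℝ), ENNReal.ofReal ((b / (2 * √x) + t / (2 * (x * √x))) *
        rexp (-(b * √x - t / √x) ^ 2 / 2)) =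
      (∫⁻ x in Ioi (0:ℝ), ENNReal.ofReal (b / (2 * √x) * rexp (-(b * √x - t / √x) ^ 2 / 2))) +
      ∫⁻ x in Ioi (0:ℝ), ENNReal.ofReal (t / (2 * (x * √x)) *
        rexp (-(b * √x - t / √x) ^ 2 / 2)) := by
    rw [← lintegral_add_left hm1]
    refine setLIntegral_congr_fun measurableSet_Ioi ?_
    intro x hx
    have hx : 0 < x := hx
    simp only
    rw [← ENNReal.ofReal_add (by positivity) (by positivity), add_mul]
  rw [h2, h1] at h3
  have h4 : ∫⁻ u in (fun x : ℝ => b * √x - t / √x) '' Ioi 0, ENNReal.ofReal (rexp (-u ^ 2 / 2)) ≤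
      ∫⁻ u : ℝ, ENNReal.ofReal (rexp (-u ^ 2 / 2)) := setLIntegral_le_lintegral _ _
  have h5 : ∫⁻ u : ℝ, ENNReal.ofReal (rexp (-u ^ 2 / 2)) =
      (∫⁻ u in Ioi (0:ℝ), ENNReal.ofReal (rexp (-u ^ 2 / 2))) +
      ∫⁻ u in Ioi (0:ℝ), ENNReal.ofReal (rexp (-u ^ 2 / 2)) := by
    rw [← lintegral_add_compl _ (measurableSet_Ioi (a := (0:ℝ)))]
    congr 1
    rw [compl_Ioi]
    rw [setLIntegral_congr (Iio_ae_eq_Iic (a := (0:ℝ))).symm]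
    have := (Measure.measurePreserving_neg (volume : Measure ℝ)).setLIntegral_comp_preimage
      (measurableSet_Ioi (a := (0:ℝ))) (f := fun u => ENNReal.ofReal (rexp (-u ^ 2 / 2)))
      (by fun_prop)
    simpa using this
  rw [h3, h5, ← two_mul, ← two_mul] at h4
  exact (ENNReal.mul_le_mul_iff_right (by simp) (by simp)).1 h4

/-- the key inequality for exponential mixing. -/
lemma gh_exp (β ψ t : ℝ) (hψ : 0 < ψ) :
    ∫⁻ x in Ioi (0:ℝ), ENNReal.ofReal (1 / √x * rexp (-(t - β * x) ^ 2 / (2 * x)) *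
        rexp (-(ψ * x) / 2)) ≤
    ∫⁻ x in Ioi (0:ℝ), ENNReal.ofReal (1 / √x * rexp (-(0 - β * x) ^ 2 / (2 * x)) *
        rexp (-(ψ * x) / 2)) := by
  rcases eq_or_ne t 0 with rfl | ht
  · exact le_rfl
  have ht' : 0 < |t| := abs_pos.2 ht
  set b := √(β ^ 2 + ψ) with hbdef
  have hb2 : b ^ 2 = β ^ 2 + ψ := Real.sq_sqrt (by positivity)
  have hb : 0 < b := Real.sqrt_pos.2 (by positivity)
  have hβ : |β| ≤ b := by
    rw [← Real.sqrt_sq_eq_abs]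
    exact Real.sqrt_le_sqrt (by linarith)
  have h := gh_half b |t| hb ht'
  have hc : β * t ≤ b * |t| := by
    calc β * t ≤ |β * t| := le_abs_self _
      _ = |β| * |t| := abs_mul _ _
      _ ≤ _ := by gcongr
  calc _ ≤ ∫⁻ x in Ioi (0:ℝ), ENNReal.ofReal (2 / b) * ENNReal.ofReal (b / (2 * √x) *
        rexp (-(b * √x - |t| / √x) ^ 2 / 2)) := by
        refine setLIntegral_mono' measurableSet_Ioi ?_
        intro x hx
        have hx : 0 < x := hx
        rw [← ENNReal.ofReal_mul (by positivity)]
        apply ENNReal.ofReal_le_ofReal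
        have hs : 0 < √x := Real.sqrt_pos.2 hx
        have hxs : x = √x ^ 2 := (Real.sq_sqrt hx.le).symm
        have : 2 / b * (b / (2 * √x) * rexp (-(b * √x - |t| / √x) ^ 2 / 2)) =
          1 / √x * rexp (-(b * √x - |t| / √x) ^ 2 / 2) := by
          field_simp
        rw [this, mul_assoc, ← Real.exp_add]
        gcongr
        have e1 : (b * √x - |t| / √x) ^ 2 = (β ^ 2 + ψ) * x - 2 * (b * |t|) + t ^ 2 / x := by
          rw [← hb2, ← sq_abs t]
          generalize √x = s at *
          subst hxs
          field_simp
          ring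
        have e2 : -(t - β * x) ^ 2 / (2 * x) = -(t ^ 2 / x) / 2 + β * t - β ^ 2 * x / 2 := by
          field_simp
          ring
        rw [e1, e2]
        linarith
    _ = ENNReal.ofReal (2 / b) * ∫⁻ x in Ioi (0:ℝ), ENNReal.ofReal (b / (2 * √x) *
        rexp (-(b * √x - |t| / √x) ^ 2 / 2)) := by
        rw [lintegral_const_mul]
        fun_prop
    _ ≤ ENNReal.ofReal (2 / b) * ∫⁻ x in Ioi (0:ℝ), ENNReal.ofReal (b / (2 * √x) *
        rexp (-(b * √x) ^ 2 / 2)) := by gcongr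
    _ = ∫⁻ x in Ioi (0:ℝ), ENNReal.ofReal (2 / b) * ENNReal.ofReal (b / (2 * √x) *
        rexp (-(b * √x) ^ 2 / 2)) := by
        rw [lintegral_const_mul]
        fun_prop
    _ = _ := by
        refine setLIntegral_congr_fun measurableSet_Ioi ?_
        intro x hx
        have hx : 0 < x := hx
        simp only
        rw [← ENNReal.ofReal_mul (by positivity)]
        have hs : 0 < √x := Real.sqrt_pos.2 hx
        have : 2 / b * (b / (2 * √x) * rexp (-(b * √x) ^ 2 / 2)) =
          1 / √x * rexp (-(b * √x) ^ 2 / 2) := by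
          field_simp
        rw [this, mul_assoc, ← Real.exp_add]
        congr 3
        rw [mul_pow, hb2, Real.sq_sqrt hx.le]
        field_simp
        ring

lemma gh_gamma (lam x : ℝ) (h1 : lam < 1) (hx : 0 < x) :
    ∫⁻ u in Ioi (0:ℝ), ENNReal.ofReal (u ^ (-lam) * rexp (-(x * u))) =
      ENNReal.ofReal (Real.Gamma (1 - lam)) * ENNReal.ofReal (x ^ (lam - 1)) := by
  have h := Real.integral_rpow_mul_exp_neg_mul_Ioi (a := 1 - lam) (r := x) (by linarith) hx
  have hG := Real.Gamma_pos_of_pos (s := 1 - lam) (by linarith)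
  have e : (1 - lam - 1 : ℝ) = -lam := by ring
  rw [e] at h
  have hint : IntegrableOn (fun u : ℝ => u ^ (-lam) * rexp (-(x * u))) (Ioi 0) := by
    by_contra hc
    rw [integral_undef hc] at h
    have : 0 < (1 / x) ^ (1 - lam) * Real.Gamma (1 - lam) := by positivity
    linarith
  rw [← ofReal_integral_eq_lintegral_ofReal hint, h, ← ENNReal.ofReal_mul hG.le]
  · congr 1
    rw [mul_comm, one_div, Real.inv_rpow hx.le, ← Real.rpow_neg hx.le]
    congr 2
    ring
  · filter_upwards [ae_restrict_mem measurableSet_Ioi] with u hu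
    have hu : 0 < u := hu
    simp only [Pi.zero_apply]
    positivity

lemma gh_suff (lam β ψ t : ℝ) (hψ : 0 < ψ) (h1 : lam ≤ 1) :
    ∫⁻ x in Ioi (0:ℝ), ENNReal.ofReal (x ^ (lam - 1)) * ENNReal.ofReal
      (1 / √x * rexp (-(t - β * x) ^ 2 / (2 * x)) * rexp (-(ψ * x) / 2)) ≤
    ∫⁻ x in Ioi (0:ℝ), ENNReal.ofReal (x ^ (lam - 1)) * ENNReal.ofReal
      (1 / √x * rexp (-(0 - β * x) ^ 2 / (2 * x)) * rexp (-(ψ * x) / 2)) := by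
  rcases h1.eq_or_lt with rfl | h1
  · simpa using gh_exp β ψ t hψ
  have hG := Real.Gamma_pos_of_pos (s := 1 - lam) (by linarith)
  have key : ∀ t : ℝ, ENNReal.ofReal (Real.Gamma (1 - lam)) *
      ∫⁻ x in Ioi (0:ℝ), ENNReal.ofReal (x ^ (lam - 1)) * ENNReal.ofReal
      (1 / √x * rexp (-(t - β * x) ^ 2 / (2 * x)) * rexp (-(ψ * x) / 2)) =
      ∫⁻ u in Ioi (0:ℝ), ENNReal.ofReal (u ^ (-lam)) *
        ∫⁻ x in Ioi (0:ℝ), ENNReal.ofReal (1 / √x * rexp (-(t - β * x) ^ 2 / (2 * x)) *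
        rexp (-((ψ + 2 * u) * x) / 2)) := by
    intro t
    calc _ = ∫⁻ x in Ioi (0:ℝ), ENNReal.ofReal (Real.Gamma (1 - lam)) *
            (ENNReal.ofReal (x ^ (lam - 1)) * ENNReal.ofReal
          (1 / √x * rexp (-(t - β * x) ^ 2 / (2 * x)) * rexp (-(ψ * x) / 2))) := by
          rw [lintegral_const_mul]
          fun_prop
      _ = ∫⁻ x in Ioi (0:ℝ), ∫⁻ u in Ioi (0:ℝ), ENNReal.ofReal (u ^ (-lam) * rexp (-(x * u))) *
          ENNReal.ofReal
          (1 / √x * rexp (-(t - β * x) ^ 2 / (2 * x)) * rexp (-(ψ * x) / 2)) := by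
          refine setLIntegral_congr_fun measurableSet_Ioi ?_
          intro x hx
          simp only
          rw [lintegral_mul_const _ (by fun_prop), gh_gamma lam x h1 hx, _root_.mul_assoc (ENNReal.ofReal (Real.Gamma _))]
      _ = ∫⁻ u in Ioi (0:ℝ), ∫⁻ x in Ioi (0:ℝ), ENNReal.ofReal (u ^ (-lam) * rexp (-(x * u))) *
          ENNReal.ofReal
          (1 / √x * rexp (-(t - β * x) ^ 2 / (2 * x)) * rexp (-(ψ * x) / 2)) := by
          apply lintegral_lintegral_swap
          apply Measurable.aemeasurable
          unfold Function.uncurry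
          fun_prop
      _ = _ := by
          refine setLIntegral_congr_fun measurableSet_Ioi ?_
          intro u hu
          have hu : 0 < u := hu
          simp only
          rw [← lintegral_const_mul _ (by fun_prop)]
          refine setLIntegral_congr_fun measurableSet_Ioi ?_
          intro x hx
          have hx : 0 < x := hx
          simp only
          rw [← ENNReal.ofReal_mul (by positivity), ← ENNReal.ofReal_mul (by positivity)]
          congr 1
          have : rexp (-((ψ + 2 * u) * x) / 2) = rexp (-(x * u)) * rexp (-(ψ * x) / 2) := by
            rw [← Real.exp_add]
            congr 1
            ring
          rw [this]
          ring
  have hG' : ENNReal.ofReal (Real.Gamma (1 - lam)) ≠ 0 := by simpa using hG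
  refine (ENNReal.mul_le_mul_iff_right hG' ENNReal.ofReal_ne_top).1 ?_
  rw [key t, key 0]
  refine setLIntegral_mono' measurableSet_Ioi ?_
  intro u hu
  have hu : 0 < u := hu
  exact mul_le_mul_right (gh_exp β (ψ + 2 * u) t (by positivity)) _

lemma gh_int0 (p a : ℝ) (ha : 0 < a) (hp : -1 < p) :
    IntegrableOn (fun x : ℝ => x ^ p * rexp (-a * x)) (Ioi 0) := by
  simpa using integrableOn_rpow_mul_exp_neg_mul_rpow (p := 1) (s := p) (b := a) hp one_pos ha

lemma gh_int (p a χ : ℝ) (ha : 0 < a) (hχ : 0 ≤ χ) (h : 0 < χ ∨ -1 < p) :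
    IntegrableOn (fun x : ℝ => x ^ p * rexp (-(χ / x + a * x) / 2)) (Ioi 0) := by
  have hm : AEStronglyMeasurable (fun x : ℝ => x ^ p * rexp (-(χ / x + a * x) / 2))
      (volume.restrict (Ioi 0)) := by
    apply Measurable.aestronglyMeasurable
    fun_prop
  by_cases hp : -1 < p
  · refine Integrable.mono' (gh_int0 p (a / 2) (by positivity) hp) hm ?_
    filter_upwards [ae_restrict_mem measurableSet_Ioi] with x hx
    have hx : 0 < x := hx
    rw [Real.norm_of_nonneg (by positivity)]
    gcongr
    have : 0 ≤ χ / x := by positivity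
    linarith
  · have hχ : 0 < χ := by tauto
    obtain ⟨n, hn⟩ := exists_nat_gt (-1 - p)
    refine Integrable.mono' ((gh_int0 (p + n) (a / 2) (by positivity) (by linarith)).const_mul
      (n.factorial * (2 / χ) ^ n)) hm ?_
    filter_upwards [ae_restrict_mem measurableSet_Ioi] with x hx
    have hx : 0 < x := hx
    rw [Real.norm_of_nonneg (by positivity)]
    have h1 := Real.pow_div_factorial_le_exp (χ / (2 * x)) (by positivity) n
    have h2 : rexp (-(χ / (2 * x))) ≤ n.factorial * (2 / χ) ^ n * x ^ n := by
      rw [Real.exp_neg]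
      refine (inv_le_of_inv_le₀ (by positivity) (le_trans (le_of_eq ?_) h1))
      simp only [div_pow, mul_pow]
      field_simp
    have h3 : rexp (-(χ / x + a * x) / 2) = rexp (-(χ / (2 * x))) * rexp (-(a / 2) * x) := by
      rw [← Real.exp_add]
      congr 1
      field_simp
      ring
    rw [h3, Real.rpow_add hx, Real.rpow_natCast]
    calc x ^ p * (rexp (-(χ / (2 * x))) * rexp (-(a / 2) * x))
        ≤ x ^ p * ((n.factorial * (2 / χ) ^ n * x ^ n) * rexp (-(a / 2) * x)) := by gcongr
      _ = _ := by ring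

lemma gh_one_sub (v θ : ℝ) (hv : 0 ≤ v) (h0 : 0 < θ) (h1 : θ ≤ 1) :
    1 - v ^ θ ≤ rexp (-v) := by
  rcases le_total v 1 with h | h
  · have : v ≤ v ^ θ := by
      have := Real.rpow_le_rpow_of_exponent_ge' hv h h0.le h1
      simpa using this
    have := Real.add_one_le_exp (-v)
    linarith
  · have := Real.one_le_rpow h h0.le
    have := Real.exp_pos (-v)
    linarith

lemma gh_eq (lam χ ψ β t x : ℝ) (hx : 0 < x) :
    (2 * π * x) ^ (-(1:ℝ)/2) * Real.exp (-(t - β * x) ^ 2 / (2 * x)) *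
        (x ^ (lam - 1) * Real.exp (-(χ / x + ψ * x) / 2)) =
    (2 * π) ^ (-(1:ℝ)/2) * rexp (β * t) * (x ^ (lam - 3 / 2) *
      rexp (-(χ / x + (β ^ 2 + ψ) * x) / 2) * rexp (-(t ^ 2 / (2 * x)))) := by
  have h1 : x ^ (lam - 3 / 2) = x ^ (-(1:ℝ)/2) * x ^ (lam - 1) := by
    rw [← Real.rpow_add hx]
    congr 1
    ring
  have h2 : rexp (-(t - β * x) ^ 2 / (2 * x)) * rexp (-(χ / x + ψ * x) / 2) =
      rexp (β * t) * (rexp (-(χ / x + (β ^ 2 + ψ) * x) / 2) * rexp (-(t ^ 2 / (2 * x)))) := by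
    rw [← Real.exp_add, ← Real.exp_add, ← Real.exp_add]
    congr 1
    field_simp
    ring
  rw [h1, Real.mul_rpow (by positivity) hx.le]
  calc _ = (2 * π) ^ (-(1:ℝ)/2) * x ^ (-(1:ℝ)/2) * x ^ (lam - 1) *
        (rexp (-(t - β * x) ^ 2 / (2 * x)) * rexp (-(χ / x + ψ * x) / 2)) := by ring
    _ = _ := by rw [h2]; ring

lemma gh_nec (lam χ ψ β θ : ℝ) (ha : 0 < β ^ 2 + ψ) (hβ : β ≠ 0) (hχ : 0 ≤ χ)
    (hθ : 1 / 2 < θ) (hθ1 : θ ≤ 1) (h : 0 < χ ∨ -1 < lam - 3 / 2 - θ)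
    (hle : ∀ t, ∫⁻ x in Ioi (0:ℝ), ENNReal.ofReal
      ((2 * π * x) ^ (-(1:ℝ)/2) * Real.exp (-(t - β * x) ^ 2 / (2 * x)) *
        (x ^ (lam - 1) * Real.exp (-(χ / x + ψ * x) / 2))) ≤
      ∫⁻ x in Ioi (0:ℝ), ENNReal.ofReal
      ((2 * π * x) ^ (-(1:ℝ)/2) * Real.exp (-(0 - β * x) ^ 2 / (2 * x)) *
        (x ^ (lam - 1) * Real.exp (-(χ / x + ψ * x) / 2)))) : False := by
  set a := β ^ 2 + ψ with hadef
  set G : ℝ → ℝ := fun x => x ^ (lam - 3 / 2) * rexp (-(χ / x + a * x) / 2) with hG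
  have hGpos : ∀ x, 0 < x → 0 < G x := fun x hx => by simp only [hG]; positivity
  have iG : IntegrableOn G (Ioi 0) := gh_int _ a χ ha hχ (h.imp_right (by intro h; linarith))
  have iG' : IntegrableOn (fun x => G x * x ^ (-θ)) (Ioi 0) := by
    refine (gh_int (lam - 3 / 2 - θ) a χ ha hχ h).congr_fun ?_ measurableSet_Ioi
    intro x hx
    have hx : 0 < x := hx
    simp only [hG]
    rw [sub_eq_add_neg (lam - 3 / 2) θ, Real.rpow_add hx]
    ring
  have iGt : ∀ t : ℝ, IntegrableOn (fun x => G x * rexp (-(t ^ 2 / (2 * x)))) (Ioi 0) := by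
    intro t
    refine Integrable.mono' iG ?_ ?_
    · apply Measurable.aestronglyMeasurable
      fun_prop
    · filter_upwards [ae_restrict_mem measurableSet_Ioi] with x hx
      have hx : 0 < x := hx
      have := hGpos x hx
      rw [Real.norm_of_nonneg (by positivity)]
      have : rexp (-(t ^ 2 / (2 * x))) ≤ 1 := Real.exp_le_one_iff.2 (by
        have : 0 ≤ t ^ 2 / (2 * x) := by positivity
        linarith)
      nlinarith
  have hF : ∀ t : ℝ, ∫⁻ x in Ioi (0:ℝ), ENNReal.ofReal
      ((2 * π * x) ^ (-(1:ℝ)/2) * Real.exp (-(t - β * x) ^ 2 / (2 * x)) *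
        (x ^ (lam - 1) * Real.exp (-(χ / x + ψ * x) / 2))) =
      ENNReal.ofReal ((2 * π) ^ (-(1:ℝ)/2) * rexp (β * t) *
        ∫ x in Ioi (0:ℝ), G x * rexp (-(t ^ 2 / (2 * x)))) := by
    intro t
    rw [← integral_const_mul, ofReal_integral_eq_lintegral_ofReal ((iGt t).const_mul _)]
    · refine setLIntegral_congr_fun measurableSet_Ioi ?_
      intro x hx
      simp only
      rw [gh_eq _ _ _ _ _ _ hx]
    · filter_upwards [ae_restrict_mem measurableSet_Ioi] with x hx
      have hx : 0 < x := hx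
      have := hGpos x hx
      simp only [Pi.zero_apply]
      positivity
  set F0 := ∫ x in Ioi (0:ℝ), G x with hF0
  set C := ∫ x in Ioi (0:ℝ), G x * x ^ (-θ) with hC
  have hF0pos : 0 < F0 := by
    rw [hF0, setIntegral_pos_iff_support_of_nonneg_ae]
    · have : Function.support G ∩ Ioi 0 = Ioi 0 := by
        apply inter_eq_right.2
        intro x hx
        exact (hGpos x hx).ne'
      rw [this]
      simp
    · filter_upwards [ae_restrict_mem measurableSet_Ioi] with x hx
      exact (hGpos x hx).le
    · exact iG
  have main : ∀ t : ℝ, rexp (β * t) * (F0 - (t ^ 2 / 2) ^ θ * C) ≤ F0 := by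
    intro t
    have h1 := hle t
    rw [hF, hF] at h1
    have hnn : 0 ≤ ∫ x in Ioi (0:ℝ), G x := hF0pos.le
    simp only [mul_zero, Real.exp_zero, mul_one, ne_eq, OfNat.ofNat_ne_zero, not_false_eq_true,
      zero_pow, zero_div, neg_zero] at h1
    rw [ENNReal.ofReal_le_ofReal_iff (by positivity), mul_assoc] at h1
    have h2 := le_of_mul_le_mul_left h1 (by positivity)
    refine le_trans ?_ h2
    refine mul_le_mul_of_nonneg_left ?_ (by positivity)
    rw [hF0, hC, ← integral_const_mul, ← integral_sub iG (iG'.const_mul _)]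
    refine setIntegral_mono_on (iG.sub (iG'.const_mul _)) (iGt t) measurableSet_Ioi ?_
    intro x hx
    have hx : 0 < x := hx
    have h3 := gh_one_sub (t ^ 2 / (2 * x)) θ (by positivity) (by linarith) hθ1
    have h4 : (t ^ 2 / (2 * x)) ^ θ = (t ^ 2 / 2) ^ θ * x ^ (-θ) := by
      rw [← div_div, div_eq_mul_inv _ x, Real.mul_rpow (by positivity) (by positivity),
        Real.inv_rpow hx.le, Real.rpow_neg hx.le]
    rw [h4] at h3
    have := mul_le_mul_of_nonneg_left h3 (hGpos x hx).le
    linarith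
  have hCnn : 0 ≤ C := by
    refine setIntegral_nonneg measurableSet_Ioi ?_
    intro x hx
    have hx : 0 < x := hx
    have := hGpos x hx
    positivity
  have main2 : ∀ s : ℝ, 0 < s → 
      β ^ 2 * F0 ≤ rexp (β ^ 2 * s) * ((β ^ 2 / 2) ^ θ * C) * s ^ (2 * θ - 1) := by
    intro s hs
    have h1 := main (β * s)
    have h2 : ((β * s) ^ 2 / 2) ^ θ = (β ^ 2 / 2) ^ θ * (s * s ^ (2 * θ - 1)) := by
      have e1 : (β * s) ^ 2 / 2 = β ^ 2 / 2 * s ^ (2:ℝ) := by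
        rw [Real.rpow_two]
        ring
      rw [e1, Real.mul_rpow (by positivity) (by positivity), ← Real.rpow_mul hs.le]
      congr 1
      nth_rewrite 2 [← Real.rpow_one s]
      rw [← Real.rpow_add hs]
      congr 1
      ring
    have e3 : β * (β * s) = β ^ 2 * s := by ring
    rw [h2, e3] at h1
    have h4 := Real.add_one_le_exp (β ^ 2 * s)
    have h5 := mul_le_mul_of_nonneg_right h4 hF0pos.le
    refine le_of_mul_le_mul_left ?_ hs
    linarith
  have hlim : Filter.Tendsto (fun s : ℝ => rexp (β ^ 2 * s) * ((β ^ 2 / 2) ^ θ * C) * s ^ (2 * θ - 1))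
      (nhdsWithin 0 (Ioi 0)) (nhds 0) := by
    have : ContinuousAt
        (fun s : ℝ => rexp (β ^ 2 * s) * ((β ^ 2 / 2) ^ θ * C) * s ^ (2 * θ - 1)) 0 := by
      apply ContinuousAt.mul (by fun_prop)
      exact Real.continuousAt_rpow_const _ _ (Or.inr (by linarith))
    have h2 := this.tendsto
    simp only [Real.zero_rpow (show 2 * θ - 1 ≠ 0 by linarith), mul_zero] at h2
    exact h2.mono_left nhdsWithin_le_nhds
  have : β ^ 2 * F0 ≤ 0 := by
    refine ge_of_tendsto hlim ?_
    filter_upwards [self_mem_nhdsWithin] with s hs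
    exact main2 s hs
  have : 0 < β ^ 2 * F0 := by positivity
  linarith


/-- Corollary 1(ii): the mode of the generalized hyperbolic density is at `μ`
iff `β = 0`, or `χ = 0` (i.e. `δ = 0`) and `0 < λ ≤ 1`. -/
theorem generalized_hyperbolic_mode_at_mu_iff
    (lam χ ψ μ β : ℝ)
    (hlam_pos : 0 < lam → 0 ≤ χ ∧ 0 < ψ)
    (hlam_zero : lam = 0 → 0 < χ ∧ 0 < ψ)
    (hlam_neg : lam < 0 → 0 < χ ∧ 0 ≤ ψ)
    (hconv : 0 < β ^ 2 + ψ ∨ lam < 1/2)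
    (f : ℝ → ℝ≥0∞)
    (hf : ∀ y, f y = ∫⁻ x in Ioi (0:ℝ), ENNReal.ofReal
      ((2 * π * x) ^ (-(1:ℝ)/2) * Real.exp (-(y - μ - β * x) ^ 2 / (2 * x)) *
        (x ^ (lam - 1) * Real.exp (-(χ / x + ψ * x) / 2)))) :
    (∀ y, f y ≤ f μ) ↔ (β = 0 ∨ (χ = 0 ∧ 0 < lam ∧ lam ≤ 1)) := by

  have hψ0 : 0 ≤ ψ := by
    rcases lt_trichotomy lam 0 with h | h | h
    · exact (hlam_neg h).2
    · exact (hlam_zero h).2.le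
    · exact (hlam_pos h).2.le
  have hχ0 : 0 ≤ χ := by
    rcases lt_trichotomy lam 0 with h | h | h
    · exact (hlam_neg h).1.le
    · exact (hlam_zero h).1.le
    · exact (hlam_pos h).1
  constructor
  · intro hmax
    by_contra hcon
    push Not at hcon
    obtain ⟨hβ, hc⟩ := hcon
    have ha : 0 < β ^ 2 + ψ := by positivity
    have hle : ∀ t, ∫⁻ x in Ioi (0:ℝ), ENNReal.ofReal
        ((2 * π * x) ^ (-(1:ℝ)/2) * Real.exp (-(t - β * x) ^ 2 / (2 * x)) *
        (x ^ (lam - 1) * Real.exp (-(χ / x + ψ * x) / 2))) ≤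
        ∫⁻ x in Ioi (0:ℝ), ENNReal.ofReal
        ((2 * π * x) ^ (-(1:ℝ)/2) * Real.exp (-(0 - β * x) ^ 2 / (2 * x)) *
        (x ^ (lam - 1) * Real.exp (-(χ / x + ψ * x) / 2))) := by
      intro t
      have := hmax (μ + t)
      rw [hf, hf] at this
      simpa only [add_sub_cancel_left, sub_self] using this
    rcases hχ0.eq_or_lt with h0 | h0
    · have hl : 0 < lam := by
        rcases lt_trichotomy lam 0 with h | h | h
        · linarith [(hlam_neg h).1]
        · linarith [(hlam_zero h).1]
        · exact h
      have hl1 := hc h0.symm hl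
      refine gh_nec lam χ ψ β (min 1 (lam / 2)) ha hβ hχ0 ?_ (min_le_left _ _) (Or.inr ?_) hle
      · apply lt_min <;> linarith
      · have := min_le_right 1 (lam / 2)
        have : min 1 (lam / 2) < lam - 1 / 2 := by linarith
        linarith
    · exact gh_nec lam χ ψ β 1 ha hβ hχ0 (by norm_num) le_rfl (Or.inl h0) hle
  · rintro (rfl | ⟨rfl, hl, hl1⟩) y
    · rw [hf, hf]
      refine setLIntegral_mono' measurableSet_Ioi ?_
      intro x hx
      have hx : 0 < x := hx
      apply ENNReal.ofReal_le_ofReal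
      have h1 : rexp (-(y - μ - 0 * x) ^ 2 / (2 * x)) ≤ rexp (-(μ - μ - 0 * x) ^ 2 / (2 * x)) := by
        rw [Real.exp_le_exp]
        have : 0 ≤ (y - μ) ^ 2 / (2 * x) := by positivity
        simp only [zero_mul, sub_zero, sub_self, neg_div]
        simpa using this
      exact mul_le_mul_of_nonneg_right (mul_le_mul_of_nonneg_left h1 (by positivity))
        (by positivity)
    · have hψ := (hlam_pos hl).2
      have h := gh_suff lam β ψ (y - μ) hψ hl1
      have key : ∀ y, f y = ENNReal.ofReal ((2 * π) ^ (-(1:ℝ)/2)) *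
          ∫⁻ x in Ioi (0:ℝ), ENNReal.ofReal (x ^ (lam - 1)) * ENNReal.ofReal
          (1 / √x * rexp (-((y - μ) - β * x) ^ 2 / (2 * x)) * rexp (-(ψ * x) / 2)) := by
        intro y
        rw [hf, ← lintegral_const_mul _ (by fun_prop)]
        refine setLIntegral_congr_fun measurableSet_Ioi ?_
        intro x hx
        have hx : 0 < x := hx
        simp only
        rw [← ENNReal.ofReal_mul (by positivity), ← ENNReal.ofReal_mul (by positivity)]
        congr 1
        have e : 1 / √x = x ^ (-(1:ℝ)/2) := by
          rw [Real.sqrt_eq_rpow, neg_div, Real.rpow_neg hx.le, one_div]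
        rw [e, Real.mul_rpow (by positivity) hx.le, zero_div, zero_add]
        ring
      rw [key, key, sub_self]
      gcongr
end
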